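/- arXiv:2310.17795 — 2 statements merged into one kernel-verified Lean document; each statement's English description precedes it below -/
import Mathlib

section
/- For all integers θ ≥ 0, s ≥ θ, r ≥ 1, k ≥ 1, there exists a function f* : (ℕ ∪ {0}) × ℕ → ℕ such that the following holds. Let m ≥ 2 and N ≥ 4 be integers, let η be an integer with 0 ≤ η ≤ θ, let G be a graph with an (η,θ)-construction (T,X) with X = (X_t : t ∈ V(T)) and root t*, and let L be a hereditarily (T,X,m,s,r,k,N)-extendable list-assignment of G. Then for every Z ⊆ N_G^{≤(k+2)(θ+1)}[X_{t*}], every L|_Z-coloring c_Z of G[Z] can be extended to an L-coloring of G with weak diameter in G at most f*(η,N). -/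
open SimpleGraph

universe u v

/-- The data of a rooted tree-decomposition: a tree on the node type `ι`,
a root node, and a bag for each node. -/
structure RTD (V : Type u) (ι : Type v) where
  tree : SimpleGraph ι
  root : ι
  bag : ι → Set V

namespace RTD

variable {V : Type u} {ι : Type v}

/-- `t'` is a child of `t` in the rooted tree. -/
def IsChild (D : RTD V ι) (t t' : ι) : Prop :=
  D.tree.Adj t t' ∧ D.tree.dist D.root t' = D.tree.dist D.root t + 1

/-- `(D.tree, (D.bag t ∩ A : t))` is a (rooted) tree-decomposition of the induced
subgraph `G[A]`. -/
def IsTDOn (D : RTD V ι) (G : SimpleGraph V) (A : Set V) : Prop :=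
  D.tree.IsTree ∧
  (∀ v ∈ A, ∃ t, v ∈ D.bag t) ∧
  (∀ a b, a ∈ A → b ∈ A → G.Adj a b → ∃ t, a ∈ D.bag t ∧ b ∈ D.bag t) ∧
  (∀ v ∈ A, (D.tree.induce {t | v ∈ D.bag t}).Connected)

end RTD

/-- There is a walk of length at most `n` from `a` to `b` inside the induced
subgraph `G[A]` (i.e. `dist_{G[A]}(a,b) ≤ n`). -/
def DistLEIn {V : Type u} (G : SimpleGraph V) (A : Set V) (a b : V) (n : ℕ) : Prop :=
  ∃ w : G.Walk a b, w.length ≤ n ∧ ∀ v ∈ w.support, v ∈ A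

/-- `a` and `b` lie in a common monochromatic component of the coloring `c`
restricted to the set `S` of colored vertices. -/
def MonoReach {β : Type*} {α : Type*} (G : SimpleGraph β) (S : Set β) (c : β → α)
    (a b : β) : Prop :=
  ∃ w : G.Walk a b, ∀ v ∈ w.support, v ∈ S ∧ c v = c a

/-- `L` is a `(T, X ∩ A, m, s, r, k)`-legitimate list-assignment of the induced
subgraph `G[A]`:
(L1) every list has size `1` or `m`;
(L2) for every node `t`, the set of vertices of the bag at `t` with singleton lists
is `(s,r)`-centered in `G[A ∩ X_t]`;
(L3) the unique coloring determined by the singleton lists has weak diameter at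
most `k` in `G[A]`. -/
def LegitOn {V : Type u} {ι : Type v} (G : SimpleGraph V) (D : RTD V ι) (A : Set V)
    (L : V → Finset ℕ) (m s r k : ℕ) : Prop :=
  (∀ v ∈ A, (L v).card = 1 ∨ (L v).card = m) ∧
  (∀ t : ι, ∃ S : Set V, S ⊆ A ∩ D.bag t ∧ S.ncard ≤ s ∧
    ∀ z ∈ A ∩ D.bag t, (L z).card = 1 →
      ∃ x ∈ S, ∃ w : G.Walk z x, w.length ≤ r ∧ ∀ v ∈ w.support, v ∈ A ∩ D.bag t) ∧
  (∀ c : V → ℕ, (∀ v ∈ A, (L v).card = 1 → c v ∈ L v) →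
    ∀ a b : V, MonoReach G {v | v ∈ A ∧ (L v).card = 1} c a b → DistLEIn G A a b k)

/-- A child-extension at `t` of `G[A]` with respect to the rooted tree-decomposition
`(D.tree, (D.bag · ∩ A))`, with type `U` of new vertices: it is obtained from
`G[A ∩ X_t]` by adding the new vertices and new edges, each new edge joining two new
vertices belonging to the same child, or a new vertex belonging to a child `t'` and a
vertex of `X_t ∩ X_{t'}`, so that every component of the subgraph induced by the new
vertices has at most two vertices. -/
structure ChildExt {V : Type u} {ι : Type v} (G : SimpleGraph V) (D : RTD V ι)
    (A : Set V) (t : ι) (U : Type u) where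
  graph : SimpleGraph (↥(A ∩ D.bag t) ⊕ U)
  owner : U → ι
  base_adj : ∀ x y : ↥(A ∩ D.bag t),
    graph.Adj (Sum.inl x) (Sum.inl y) ↔ G.Adj (x : V) (y : V)
  owner_child : ∀ u : U, D.IsChild t (owner u)
  mixed_adj : ∀ (x : ↥(A ∩ D.bag t)) (u : U),
    graph.Adj (Sum.inl x) (Sum.inr u) → (x : V) ∈ D.bag (owner u)
  new_adj : ∀ u u' : U, graph.Adj (Sum.inr u) (Sum.inr u') → owner u = owner u'
  new_small : ∀ u₁ u₂ u₃ : U, graph.Adj (Sum.inr u₁) (Sum.inr u₂) →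
    graph.Adj (Sum.inr u₂) (Sum.inr u₃) → u₁ = u₃

/-- `L` is a `(T, X ∩ A, m, s, r, k, N)`-extendable list-assignment of `G[A]`:
(E1) it is legitimate, and (E2) for every node `t`, every child-extension at `t` and
every list-assignment of it agreeing with `L` on the bag at `t`, the child-extension
has a coloring from the lists with weak diameter at most `N` (in the child-extension). -/
def ExtOn {V : Type u} {ι : Type v} (G : SimpleGraph V) (D : RTD V ι) (A : Set V)
    (L : V → Finset ℕ) (m s r k N : ℕ) : Prop :=
  LegitOn G D A L m s r k ∧
  ∀ (t : ι) (U : Type u), Fintype U →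
    ∀ (E : ChildExt G D A t U) (Lt : (↥(A ∩ D.bag t) ⊕ U) → Finset ℕ),
      (∀ z, (Lt z).Nonempty) →
      (∀ x : ↥(A ∩ D.bag t), Lt (Sum.inl x) = L (x : V)) →
      ∃ c : (↥(A ∩ D.bag t) ⊕ U) → ℕ, (∀ z, c z ∈ Lt z) ∧
        ∀ a b, MonoReach E.graph Set.univ c a b → ∃ w : E.graph.Walk a b, w.length ≤ N

/-- `L` is a hereditarily `(T, X ∩ A, m, s, r, k, N)`-extendable list-assignment of
`G[A]`: (H1) it is legitimate, and (H2) for every induced subgraph `G[A']` of `G[A]`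
and every list-assignment `L'` with `L'(v) ⊇ L(v)`, if `L'` is legitimate for `G[A']`
then it is extendable for `G[A']`. -/
def HeredExtOn {V : Type u} {ι : Type v} (G : SimpleGraph V) (D : RTD V ι) (A : Set V)
    (L : V → Finset ℕ) (m s r k N : ℕ) : Prop :=
  LegitOn G D A L m s r k ∧
  ∀ A' : Set V, A' ⊆ A → ∀ L' : V → Finset ℕ, (∀ v ∈ A', L v ⊆ L' v) →
    LegitOn G D A' L' m s r k → ExtOn G D A' L' m s r k N

/-- Every connected component of `G[B]` has at most two vertices: no vertex of `B` has
two distinct neighbours in `B`. -/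
def SmallCompsOn {V : Type u} (G : SimpleGraph V) (B : Set V) : Prop :=
  ∀ x y z, x ∈ B → y ∈ B → z ∈ B → G.Adj x y → G.Adj y z → x = z

/-- The coloring `c` (with domain `S`) has weak diameter in `G` at most `N`. -/
def HasWeakDiamLE {β : Type*} {α : Type*} (G : SimpleGraph β) (S : Set β) (c : β → α)
    (N : ℕ) : Prop :=
  ∀ a b : β, MonoReach G S c a b → G.dist a b ≤ N

/-- `(D.tree, D.root, D.bag)` is an `(η,θ)`-construction of `G`: a rooted
tree-decomposition of `G` with adhesion at most `θ` such that
(C1) for every tree edge `tt'` whose adhesion set has more than `η` vertices, one of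
its ends has no child and every component of `G[X_{t'} − X_t]` (for that end `t'`) has
at most two vertices, and
(C2) the root bag has at most `θ` vertices and is nonempty if `η > 0`. -/
def IsConstruction {V : Type u} {ι : Type v} (G : SimpleGraph V) (D : RTD V ι)
    (η θ : ℕ) : Prop :=
  D.IsTDOn G Set.univ ∧
  (∀ t t', D.tree.Adj t t' → (D.bag t ∩ D.bag t').ncard ≤ θ) ∧
  (∀ t t', D.tree.Adj t t' → η < (D.bag t ∩ D.bag t').ncard →
    ((∀ z, ¬ D.IsChild t' z) ∧ SmallCompsOn G (D.bag t' \ D.bag t)) ∨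
      ((∀ z, ¬ D.IsChild t z) ∧ SmallCompsOn G (D.bag t \ D.bag t'))) ∧
  (D.bag D.root).ncard ≤ θ ∧
  (0 < η → (D.bag D.root).Nonempty)

/-! ### Nearness and connectivity inside a set -/

section Near

variable {V : Type u}

/-- The vertices `a` and `b` are at distance at most `n` in `G`. -/
def Near (G : SimpleGraph V) (n : ℕ) (a b : V) : Prop :=
  ∃ w : G.Walk a b, w.length ≤ n

/-- `a` is joined to `b` by a (possibly trivial) walk of `H` whose vertices lie in `S`. -/
def Conn (H : SimpleGraph V) (S : Set V) : V → V → Prop :=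
  Relation.ReflTransGen fun u v => H.Adj u v ∧ u ∈ S ∧ v ∈ S

variable {G H H' : SimpleGraph V} {S S' : Set V} {a b c : V} {i j : ℕ}

theorem Near.refl (n : ℕ) (a : V) : Near G n a a := ⟨.nil, by simp⟩

theorem Near.symm (h : Near G i a b) : Near G i b a := by
  obtain ⟨w, hw⟩ := h
  exact ⟨w.reverse, by simpa using hw⟩

theorem Near.trans (h : Near G i a b) (h' : Near G j b c) : Near G (i + j) a c := by
  obtain ⟨w, hw⟩ := h
  obtain ⟨w', hw'⟩ := h'
  exact ⟨w.append w', by rw [Walk.length_append]; omega⟩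

theorem Near.mono (h : Near G i a b) (hij : i ≤ j) : Near G j a b := by
  obtain ⟨w, hw⟩ := h
  exact ⟨w, hw.trans hij⟩

theorem near_of_adj (h : G.Adj a b) : Near G 1 a b := ⟨.cons h .nil, by simp⟩

theorem near_mul_length {K : ℕ} (hK : ∀ u v, H.Adj u v → Near G K u v) (w : H.Walk a b) :
    Near G (w.length * K) a b := by
  induction w with
  | nil => exact Near.refl _ _
  | cons h p ih =>
    exact ((hK _ _ h).trans ih).mono (by rw [Walk.length_cons, add_mul]; omega)

theorem near_of_mem_support (w : G.Walk a b) {p : V} (hp : p ∈ w.support) :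
    Near G w.length a p := by
  classical
  exact ⟨w.takeUntil p hp, w.length_takeUntil_le_length hp⟩

theorem Conn.symm (h : Conn H S a b) : Conn H S b a := by
  induction h with
  | refl => exact .refl
  | tail _ e ih => exact .head ⟨e.1.symm, e.2.2, e.2.1⟩ ih

theorem Conn.trans (h : Conn H S a b) (h' : Conn H S b c) : Conn H S a c :=
  Relation.ReflTransGen.trans h h'

/-- Connectivity transfers along any map of edges. -/
theorem Conn.lift (h : Conn H S a b)
    (hf : ∀ u v, H.Adj u v → u ∈ S → v ∈ S → H'.Adj u v ∧ u ∈ S' ∧ v ∈ S') :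
    Conn H' S' a b := by
  induction h with
  | refl => exact .refl
  | tail _ e ih => exact ih.tail (hf _ _ e.1 e.2.1 e.2.2)

theorem Conn.mono (hS : S ⊆ S') (h : Conn H S a b) : Conn H S' a b :=
  h.lift fun _ _ h hu hv => ⟨h, hS hu, hS hv⟩

theorem Conn.mem_right (h : Conn H S a b) (ha : a ∈ S) : b ∈ S := by
  cases h with
  | refl => exact ha
  | tail _ h => exact h.2.2

theorem Conn.single (h : H.Adj a b) (ha : a ∈ S) (hb : b ∈ S) : Conn H S a b :=
  Relation.ReflTransGen.single ⟨h, ha, hb⟩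

/-- A walk inside `S` starting at `a` stays in the set of vertices reachable from `a`. -/
theorem Conn.reachable_set (h : Conn H S a b) :
    Conn H {p | Conn H S a p} a b := by
  induction h with
  | refl => exact .refl
  | tail h e ih => exact ih.tail ⟨e.1, h, h.tail e⟩

theorem conn_of_walk (w : H.Walk a b) (hw : ∀ v ∈ w.support, v ∈ S) : Conn H S a b := by
  induction w with
  | nil => exact .refl
  | cons h p ih =>
    refine .head ⟨h, hw _ (by simp), hw _ (by simp)⟩ (ih fun v hv => hw v ?_)
    simp [hv]

theorem Conn.exists_walk (h : Conn H S a b) (ha : a ∈ S) :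
    ∃ w : H.Walk a b, ∀ v ∈ w.support, v ∈ S := by
  induction h with
  | refl => exact ⟨.nil, by simpa using ha⟩
  | tail _ e ih =>
    obtain ⟨w, hw⟩ := ih
    refine ⟨w.concat e.1, fun v hv => ?_⟩
    rw [Walk.support_concat, List.mem_append] at hv
    rcases hv with hv | hv
    · exact hw v hv
    · rw [List.mem_singleton.1 hv]
      exact e.2.2

/-- Split a walk at its last visit to `P`. -/
theorem Conn.last_visit (h : Conn H S a b) (ha : a ∈ S) (P : V → Prop) :
    (¬ P a ∧ ¬ P b ∧ Conn H {p | p ∈ S ∧ ¬ P p} a b) ∨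
      ∃ x ∈ S, P x ∧ Conn H S a x ∧ (x = b ∨
        ∃ y, y ∈ S ∧ ¬ P y ∧ H.Adj x y ∧ Conn H {p | p ∈ S ∧ ¬ P p} y b) := by
  induction h with
  | refl =>
    by_cases hP : P a
    · exact .inr ⟨a, ha, hP, .refl, .inl rfl⟩
    · exact .inl ⟨hP, hP, .refl⟩
  | @tail b c hab e ih =>
    by_cases hP : P c
    · exact .inr ⟨c, e.2.2, hP, hab.tail e, .inl rfl⟩
    by_cases hb : P b
    · exact .inr ⟨b, e.2.1, hb, hab, .inr ⟨c, e.2.2, hP, e.1, .refl⟩⟩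
    rcases ih with ⟨h1, h2, h3⟩ | ⟨x, hx, hPx, hax, rfl | ⟨y, hy, hPy, hxy, hyb⟩⟩
    · exact .inl ⟨h1, hP, h3.tail ⟨e.1, ⟨e.2.1, h2⟩, e.2.2, hP⟩⟩
    · exact absurd hPx hb
    · exact .inr ⟨x, hx, hPx, hax,
        .inr ⟨y, hy, hPy, hxy, hyb.tail ⟨e.1, ⟨e.2.1, hb⟩, e.2.2, hP⟩⟩⟩

/-- A set covered by `n` balls of radius `q` that is connected by jumps of length `K` has weak
diameter at most `n * (2 * q + K)`. -/
theorem Conn.near_of_cover {q K : ℕ} (R : Finset V) :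
    ∀ (S : Set V), (∀ u ∈ S, ∀ v ∈ S, H.Adj u v → Near G K u v) →
      (∀ v ∈ S, ∃ x ∈ R, Near G q v x) → ∀ a b, a ∈ S → Conn H S a b →
        Near G (R.card * (2 * q + K)) a b := by
  classical
  induction hn : R.card generalizing R with
  | zero =>
    intro S _ hR a b ha _
    obtain ⟨x, hx, -⟩ := hR a ha
    simp_all
  | succ n ih =>
    intro S hK hR a b ha hab
    obtain ⟨x, hx, hax⟩ := hR a ha
    rcases hab.last_visit ha (fun p => Near G q p x) with
      ⟨h, -⟩ | ⟨y, hy, hyx, -, rfl | ⟨z, hz, hzx, hyz, hzb⟩⟩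
    · exact absurd hax h
    · exact (hax.trans hyx.symm).mono (by nlinarith)
    · have := ih (R.erase x) (by rw [Finset.card_erase_of_mem hx, hn]; rfl)
        {p | p ∈ S ∧ ¬ Near G q p x} (fun u hu v hv => hK u hu.1 v hv.1) (fun v hv => by
          obtain ⟨y, hy, hvy⟩ := hR v hv.1
          refine ⟨y, Finset.mem_erase.2 ⟨?_, hy⟩, hvy⟩
          rintro rfl
          exact hv.2 hvy) z b ⟨hz, hzx⟩ hzb
      exact (((hax.trans hyx.symm).trans (hK _ hy _ hz hyz)).trans this).mono
        (by rw [add_mul]; omega)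

/-- The part of `A` at distance at most `d` from `R`. -/
def collar (G : SimpleGraph V) (A R : Set V) (d : ℕ) : Set V :=
  {p | p ∈ A ∧ ∃ y ∈ R, Near G d p y}

/-- The part of the collar of `R` that is connected to `R` by walks of `H` in the collar. -/
def ballIn (G H : SimpleGraph V) (A R : Set V) (d : ℕ) : Set V :=
  {v | ∃ x ∈ R, Conn H (collar G A R d) x v}

variable {A R : Set V} {d : ℕ}

theorem subset_collar (hR : R ⊆ A) : R ⊆ collar G A R d :=
  fun x hx => ⟨hR hx, x, hx, Near.refl _ _⟩

theorem subset_ballIn : R ⊆ ballIn G H A R d := fun x hx => ⟨x, hx, .refl⟩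

theorem ballIn_subset_collar (hR : R ⊆ A) : ballIn G H A R d ⊆ collar G A R d := by
  rintro v ⟨x, hx, h⟩
  exact h.mem_right (subset_collar hR hx)

theorem mem_ballIn_of_adj (hR : R ⊆ A) (ha : a ∈ ballIn G H A R d) (hab : H.Adj a b)
    (hb : b ∈ collar G A R d) : b ∈ ballIn G H A R d := by
  have hac := ballIn_subset_collar hR ha
  obtain ⟨x, hx, h⟩ := ha
  exact ⟨x, hx, h.tail ⟨hab, hac, hb⟩⟩

theorem exists_conn_ballIn (ha : a ∈ ballIn G H A R d) :
    ∃ x ∈ R, Conn H (ballIn G H A R d) x a := by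
  obtain ⟨x, hx, h⟩ := ha
  exact ⟨x, hx, h.reachable_set.mono fun p hp => ⟨x, hx, hp⟩⟩

theorem near_of_conn_ballIn [Finite V] {K n : ℕ} (hR : R ⊆ A) (hn : R.ncard ≤ n)
    (hK : ∀ u v, H.Adj u v → Near G K u v) (ha : a ∈ ballIn G H A R d)
    (h : Conn H (ballIn G H A R d) a b) : Near G (n * (2 * d + K)) a b := by
  have hfin : R.Finite := R.toFinite
  have := Conn.near_of_cover (G := G) (q := d) (K := K) hfin.toFinset _
    (fun u _ v _ => hK u v) (fun v hv => by
      obtain ⟨-, y, hy, h⟩ := ballIn_subset_collar hR hv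
      exact ⟨y, by simpa using hy, h⟩) a b ha h
  rw [Set.ncard_eq_toFinset_card R hfin] at hn
  exact this.mono (Nat.mul_le_mul_right _ hn)

end Near

/-! ### Ancestors, cones and adhesion sets in a rooted tree-decomposition -/

namespace RTD

variable {V : Type u} {ι : Type v}

open Classical in
/-- The parent of a node (the node itself if it has none). -/
noncomputable def par (D : RTD V ι) (t : ι) : ι :=
  if h : ∃ p, D.IsChild p t then h.choose else t

/-- `a` is an ancestor of `b` (possibly equal to it). -/
def Anc (D : RTD V ι) (a b : ι) : Prop :=
  Relation.ReflTransGen (fun y x => D.IsChild x y) b a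

/-- The vertices all of whose bags are at descendants of `t`. -/
def below (D : RTD V ι) (t : ι) : Set V := {v | ∀ s, v ∈ D.bag s → D.Anc t s}

/-- The adhesion set between `t` and its parent. -/
def adh (D : RTD V ι) (t : ι) : Set V := D.bag (D.par t) ∩ D.bag t

variable {D : RTD V ι} {a b c t t' s : ι} {x : V}

theorem isChild_unique (hT : D.tree.IsTree) (ha : D.IsChild a t) (hb : D.IsChild b t) :
    a = b := by
  have key : ∀ c, D.IsChild c t → ∃ p : D.tree.Walk D.root t, p.IsPath ∧ p.penultimate = c := by
    intro c hc
    obtain ⟨p, hp⟩ := hT.connected.exists_walk_length_eq_dist D.root c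
    refine ⟨p.concat hc.1, Walk.isPath_of_length_eq_dist _ ?_, by simp⟩
    rw [Walk.length_concat, hp, hc.2]
  obtain ⟨p, hp, rfl⟩ := key a ha
  obtain ⟨q, hq, rfl⟩ := key b hb
  rw [(hT.existsUnique_path _ _).unique hp hq]

theorem isChild_or_isChild (hT : D.tree.IsTree) (h : D.tree.Adj a b) :
    D.IsChild a b ∨ D.IsChild b a := by
  rcases hT.dist_eq_dist_add_one_of_adj D.root h with h' | h'
  · exact .inr ⟨h.symm, h'⟩
  · exact .inl ⟨h, h'⟩

theorem exists_isChild (hT : D.tree.IsTree) (ht : t ≠ D.root) : ∃ p, D.IsChild p t := by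
  obtain ⟨w, hw⟩ := hT.connected.exists_walk_length_eq_dist t D.root
  cases w with
  | nil => exact absurd rfl ht
  | @cons _ p _ h q =>
    refine ⟨p, (isChild_or_isChild hT h).resolve_left fun h' => ?_⟩
    have h1 := dist_le q
    have h2 := h'.2
    rw [Walk.length_cons] at hw
    rw [dist_comm, dist_comm (u := D.root)] at h2
    omega

theorem isChild_par (hT : D.tree.IsTree) (ht : t ≠ D.root) : D.IsChild (D.par t) t := by
  have h := exists_isChild hT ht
  rw [par, dif_pos h]
  exact h.choose_spec

theorem IsChild.ne_root (h : D.IsChild a b) : b ≠ D.root := by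
  rintro rfl
  have := h.2
  simp at this

theorem IsChild.par_eq (hT : D.tree.IsTree) (h : D.IsChild a b) : D.par b = a :=
  isChild_unique hT (isChild_par hT h.ne_root) h

theorem Anc.refl (a : ι) : D.Anc a a := Relation.ReflTransGen.refl

theorem Anc.trans (h : D.Anc a b) (h' : D.Anc b c) : D.Anc a c :=
  Relation.ReflTransGen.trans h' h

theorem Anc.dist_le (h : D.Anc a b) : D.tree.dist D.root a ≤ D.tree.dist D.root b := by
  induction h with
  | refl => rfl
  | tail _ e ih => exact le_trans (by rw [e.2]; omega) ih

theorem anc_par (hT : D.tree.IsTree) (ht : t ≠ D.root) : D.Anc (D.par t) t :=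
  Relation.ReflTransGen.single (isChild_par hT ht)

theorem not_anc_par (hT : D.tree.IsTree) (ht : t ≠ D.root) : ¬ D.Anc t (D.par t) := by
  intro h
  have h1 := h.dist_le
  have h2 := (isChild_par hT ht).2
  omega

theorem Anc.ne_root_and_par (hT : D.tree.IsTree) (h : D.Anc a b) (hab : a ≠ b) :
    b ≠ D.root ∧ D.Anc a (D.par b) := by
  rcases Relation.ReflTransGen.cases_head h with h | ⟨c, hc, h⟩
  · exact absurd h.symm hab
  · rw [hc.par_eq hT]
    exact ⟨hc.ne_root, h⟩

theorem Anc.antisymm (hT : D.tree.IsTree) (h : D.Anc a b) (h' : D.Anc b a) : a = b := by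
  by_contra hab
  obtain ⟨hb, h1⟩ := h.ne_root_and_par hT hab
  exact not_anc_par hT hb (h'.trans h1)

theorem anc_total (hT : D.tree.IsTree) (ha : D.Anc a c) (hb : D.Anc b c) :
    D.Anc a b ∨ D.Anc b a := by
  have U : Relator.RightUnique fun y x => D.IsChild x y :=
    fun _ _ _ h h' => isChild_unique hT h h'
  exact (Relation.ReflTransGen.total_of_right_unique U ha hb).symm

theorem root_anc (hT : D.tree.IsTree) (t : ι) : D.Anc D.root t := by
  induction hn : D.tree.dist D.root t generalizing t with
  | zero =>
    rw [(hT.connected.dist_eq_zero_iff).1 hn]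
    exact .refl _
  | succ n ih =>
    have ht : t ≠ D.root := by
      rintro rfl
      simp at hn
    have h := (isChild_par hT ht).2
    exact (ih (D.par t) (by omega)).trans (anc_par hT ht)

/-- `T` is a set of descendants of `r` that contains `r` and is closed under taking parents as
long as `r` is not reached. -/
structure Subtree (D : RTD V ι) (r : ι) (T : Set ι) : Prop where
  root_mem : r ∈ T
  anc : ∀ t ∈ T, D.Anc r t
  par_mem : ∀ t ∈ T, t ≠ r → D.par t ∈ T

/-- The children outside `T` of the nodes of `T`. -/
def boundary (D : RTD V ι) (T : Set ι) : Set ι := {t | t ∉ T ∧ t ≠ D.root ∧ D.par t ∈ T}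

variable {r : ι} {T : Set ι}

theorem Subtree.mem_of_anc (hT : D.tree.IsTree) (h : D.Subtree r T) (hs : s ∈ T)
    (ht : D.Anc r t) (hts : D.Anc t s) : t ∈ T := by
  have key : ∀ q, Relation.ReflTransGen (fun y x => D.IsChild x y) s q →
      D.Anc r q → q ∈ T := by
    intro q hq
    induction hq with
    | refl => exact fun _ => hs
    | @tail p q _ e ih =>
      intro hrq
      have hp := ih (hrq.trans (Relation.ReflTransGen.single e))
      rw [← e.par_eq hT]
      refine h.par_mem p hp ?_
      rintro rfl
      have h1 := hrq.dist_le
      have h2 := e.2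
      omega
  exact key t hts ht

theorem Subtree.anc_boundary (hT : D.tree.IsTree) (h : D.Subtree r T) (ht : t ∈ D.boundary T) :
    D.Anc r t := (h.anc _ ht.2.2).trans (anc_par hT ht.2.1)

theorem Subtree.not_anc_of_boundary (hT : D.tree.IsTree) (h : D.Subtree r T)
    (ht : t ∈ D.boundary T) (hs : s ∈ T) : ¬ D.Anc t s :=
  fun hts => ht.1 (h.mem_of_anc hT hs (h.anc_boundary hT ht) hts)

theorem Subtree.eq_of_anc_boundary (hT : D.tree.IsTree) (h : D.Subtree r T)
    (ht : t ∈ D.boundary T) (ht' : t' ∈ D.boundary T) (hs : D.Anc t s) (hs' : D.Anc t' s) :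
    t = t' := by
  by_contra hne
  rcases anc_total hT hs hs' with h' | h'
  · exact h.not_anc_of_boundary hT ht ht'.2.2 (h'.ne_root_and_par hT hne).2
  · exact h.not_anc_of_boundary hT ht' ht.2.2 (h'.ne_root_and_par hT (Ne.symm hne)).2

theorem Subtree.mem_or_boundary (h : D.Subtree r T) (hT : D.tree.IsTree) (hs : D.Anc r s) :
    s ∈ T ∨ ∃ t ∈ D.boundary T, D.Anc t s := by
  have key : ∀ q, Relation.ReflTransGen (fun y x => D.IsChild x y) s q →
      q ∈ T → s ∈ T ∨ ∃ t ∈ D.boundary T, D.Anc t s := by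
    intro q hq
    induction hq with
    | refl => exact fun h => .inl h
    | @tail p q hp e ih =>
      intro hqT
      by_cases hpT : p ∈ T
      · exact ih hpT
      · refine .inr ⟨p, ⟨hpT, e.ne_root, ?_⟩, hp⟩
        rwa [e.par_eq hT]
  exact key r hs h.root_mem

section Bags

variable {G : SimpleGraph V} (hD : D.IsTDOn G Set.univ)
include hD

theorem exists_mem_bag (v : V) : ∃ t, v ∈ D.bag t := hD.2.1 v trivial

theorem mem_below_or_adh (hx : x ∈ D.bag s) (hts : D.Anc t s) :
    x ∈ D.below t ∨ x ∈ D.adh t := by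
  by_contra! hcon
  obtain ⟨hb, hadh⟩ := hcon
  simp only [below, Set.mem_ofPred_eq, not_forall] at hb
  obtain ⟨q, hq, htq⟩ := hb
  obtain ⟨w⟩ := (hD.2.2.2 x trivial).preconnected ⟨s, hx⟩ ⟨q, hq⟩
  have key : ∀ (p q : {t | x ∈ D.bag t}) (w : (D.tree.induce {t | x ∈ D.bag t}).Walk p q),
      D.Anc t p → D.Anc t q := by
    intro p q w
    induction w with
    | nil => exact id
    | @cons p p' q e w ih =>
      intro hp
      apply ih
      by_contra hp'
      have e' : D.tree.Adj p p' := e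
      rcases isChild_or_isChild hD.1 e' with e' | e'
      · exact hp' (hp.trans (Relation.ReflTransGen.single e'))
      · by_cases hpt : t = p
        · refine hadh ⟨?_, hpt ▸ p.2⟩
          rw [hpt, e'.par_eq hD.1]
          exact p'.2
        · have := (hp.ne_root_and_par hD.1 hpt).2
          rw [e'.par_eq hD.1] at this
          exact hp' this
  exact htq (key _ _ w hts)

theorem not_mem_below_of_mem_adh (ht : t ≠ D.root) (hx : x ∈ D.adh t) : x ∉ D.below t :=
  fun h => not_anc_par hD.1 ht (h _ hx.1)

theorem adj_below {y : V} (hx : x ∈ D.below t) (hxy : G.Adj x y) :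
    y ∈ D.below t ∨ y ∈ D.adh t := by
  obtain ⟨s, hxs, hys⟩ := hD.2.2.1 x y trivial trivial hxy
  exact mem_below_or_adh hD hys (hx s hxs)

/-- Two different bags meet in at most `θ` vertices if the adhesion is at most `θ`. -/
theorem ncard_inter_le [Finite V] {θ : ℕ} (hθ : ∀ t, t ≠ D.root → (D.adh t).ncard ≤ θ)
    (hst : s ≠ t) : (D.bag s ∩ D.bag t).ncard ≤ θ := by
  have key : ∀ p s t, D.Anc p t → ¬ D.Anc p s →
      D.bag s ∩ D.bag t ⊆ D.adh p := by
    intro p s t hpt hps x hx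
    exact (mem_below_or_adh hD hx.2 hpt).resolve_left fun h => hps (h s hx.1)
  by_cases h : D.Anc t s
  · have hs := h.ne_root_and_par hD.1 hst.symm
    have := key s t s (.refl _) fun h' => hst (h'.antisymm hD.1 h)
    rw [Set.inter_comm]
    exact (Set.ncard_le_ncard this).trans (hθ s hs.1)
  · have ht : t ≠ D.root := by
      rintro rfl
      exact h (root_anc hD.1 s)
    exact (Set.ncard_le_ncard (key t s t (.refl _) h)).trans (hθ t ht)

end Bags

end RTD

/-! ### Regions -/

/-- A part `A` of the graph, decomposed along the subtree `C` with root `ρ`, with edges of an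
auxiliary graph `H` that joins vertices at distance at most `K` in `G`, and enlarged lists `ℓ`. -/
structure Region {V : Type u} {ι : Type v} (G : SimpleGraph V) (D : RTD V ι)
    (L : V → Finset ℕ) (m r k : ℕ) (A : Set V) (C : Set ι) (ρ : ι) (H : SimpleGraph V)
    (ℓ : V → Finset ℕ) (K : ℕ) : Prop where
  subtree : D.Subtree ρ C
  jump : ∀ u v, H.Adj u v → Near G K u v
  core_adj : ∀ t ∈ C, ∀ u v, u ∈ D.bag t → v ∈ D.bag t → u ∈ A → v ∈ A → (H.Adj u v ↔ G.Adj u v)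
  td : ∀ t, t ≠ D.root → t ≠ ρ → D.par t ∈ C → ∀ u v, u ∈ D.below t → u ∈ A → v ∈ A →
    H.Adj u v → v ∈ D.below t ∨ v ∈ D.adh t
  small : ∀ t ∈ D.boundary C, SmallCompsOn H (D.below t ∩ A)
  subset_list : ∀ v ∈ A, L v ⊆ ℓ v
  card_list : ∀ v ∈ A, (ℓ v).card = 1 ∨ (ℓ v).card = m
  good : ∀ t ∈ C, ∀ z p, z ∈ D.bag t → z ∈ A → (ℓ z).card = 1 → p ∈ D.bag t →
    Near G (r + k) z p → p ∈ A
  single : ∀ α a b, Conn H {v | v ∈ A ∧ ℓ v = {α}} a b → Near G k a b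
  cover : ∀ v ∈ A, ∃ s, D.Anc ρ s ∧ v ∈ D.bag s

/-- The components of `H[A]` that are monochromatic under `c` have weak diameter at most `F`. -/
def BoundedOn {V : Type u} (G H : SimpleGraph V) (A : Set V) (c : V → ℕ) (F : ℕ) : Prop :=
  ∀ α a b, Conn H {v | v ∈ A ∧ c v = α} a b → Near G F a b

section Region

variable {V : Type u} {ι : Type v} {G : SimpleGraph V} {D : RTD V ι}
  {L : V → Finset ℕ} {m s r k N θ : ℕ} {A : Set V} {C : Set ι} {ρ : ι} {H : SimpleGraph V}
  {ℓ : V → Finset ℕ} {K : ℕ}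

theorem eq_of_subset_of_card_eq_one {a b : Finset ℕ} (hab : a ⊆ b) (ha : a.Nonempty)
    (hb : b.card = 1) : a = b :=
  Finset.eq_of_subset_of_card_le hab (hb ▸ ha.card_pos)

theorem exists_mono_lists (hm : 1 ≤ m) (hL : LegitOn G D Set.univ L m s r k) :
    ∃ P : V → Finset ℕ, ∀ v, L v ⊆ P v ∧ (P v).card = m := by
  choose P hP using fun v => Infinite.exists_superset_card_eq (L v) m (by
    rcases hL.1 v trivial with h | h <;> omega)
  exact ⟨P, hP⟩

theorem Region.mem_bag_or_below (hD : D.IsTDOn G Set.univ)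
    (hR : Region G D L m r k A C ρ H ℓ K) {v : V} (hv : v ∈ A) :
    (∃ t ∈ C, v ∈ D.bag t) ∨ ∃ t ∈ D.boundary C, v ∈ D.below t := by
  obtain ⟨s, hs, hvs⟩ := hR.cover v hv
  rcases hR.subtree.mem_or_boundary hD.1 hs with h | ⟨t, ht, hts⟩
  · exact .inl ⟨s, h, hvs⟩
  · rcases RTD.mem_below_or_adh hD hvs hts with h | h
    · exact .inr ⟨t, ht, h⟩
    · exact .inl ⟨_, ht.2.2, h.1⟩

variable [Finite V]

/-- The lists of a region, on the bag at `ρ`, extend to a legitimate list-assignment. -/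
theorem Region.legitOn (hD : D.IsTDOn G Set.univ) (hθ : ∀ t, t ≠ D.root → (D.adh t).ncard ≤ θ)
    (hs : θ ≤ s) (hm : 2 ≤ m) (hne : ∀ v, (L v).Nonempty) (hL : LegitOn G D Set.univ L m s r k)
    (hR : Region G D L m r k A C ρ H ℓ K) {L' : V → Finset ℕ}
    (hin : ∀ v ∈ D.bag ρ, L' v = ℓ v) (hout : ∀ v ∉ D.bag ρ, (L' v).card = m) :
    LegitOn G D {v | v ∈ D.bag ρ → v ∈ A} L' m s r k := by
  classical
  have hone : ∀ v, (v ∈ D.bag ρ → v ∈ A) → (L' v).card = 1 →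
      v ∈ D.bag ρ ∧ v ∈ A ∧ L v = L' v ∧ (ℓ v).card = 1 := by
    intro v hv h1
    have hb : v ∈ D.bag ρ := by
      by_contra hb
      rw [hout v hb] at h1
      omega
    refine ⟨hb, hv hb, ?_, hin v hb ▸ h1⟩
    refine eq_of_subset_of_card_eq_one ?_ (hne v) h1
    rw [hin v hb]
    exact hR.subset_list v (hv hb)
  refine ⟨fun v hv => ?_, fun t => ?_, fun c hc a b hab => ?_⟩
  · by_cases hb : v ∈ D.bag ρ
    · rw [hin v hb]
      exact hR.card_list v (hv hb)
    · exact .inr (hout v hb)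
  · by_cases ht : ρ = t
    · subst ht
      obtain ⟨S, hS, hSs, hSc⟩ := hL.2.1 ρ
      refine ⟨S ∩ A, fun v hv => ⟨fun _ => hv.2, (hS hv.1).2⟩,
        (Set.ncard_le_ncard Set.inter_subset_left).trans hSs, fun z hz hz1 => ?_⟩
      obtain ⟨hzb, hzA, hLz, hℓz⟩ := hone z hz.1 hz1
      obtain ⟨x, hx, w, hw, hwb⟩ := hSc z ⟨trivial, hzb⟩ (hLz ▸ hz1)
      have hA : ∀ p ∈ w.support, p ∈ A := fun p hp =>
        hR.good ρ hR.subtree.root_mem z p hzb hzA hℓz (hwb p hp).2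
          ((near_of_mem_support w hp).mono (by omega))
      exact ⟨x, ⟨hx, hA x w.end_mem_support⟩, w, hw,
        fun p hp => ⟨fun _ => hA p hp, (hwb p hp).2⟩⟩
    · refine ⟨{z | z ∈ {v | v ∈ D.bag ρ → v ∈ A} ∩ D.bag t ∧ (L' z).card = 1}, fun z hz => hz.1,
        ?_, fun z hz hz1 => ⟨z, ⟨hz, hz1⟩, .nil, by simp, by simpa using hz⟩⟩
      refine (Set.ncard_le_ncard fun z hz => ?_).trans
        ((RTD.ncard_inter_le hD hθ ht).trans hs)
      exact ⟨(hone z hz.1.1 hz.2).1, hz.1.2⟩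
  · obtain ⟨w, hw⟩ := hab
    choose c₀ hc₀ using hne
    obtain ⟨w', hw', -⟩ := hL.2.2
      (fun v => if (v ∈ D.bag ρ → v ∈ A) ∧ (L' v).card = 1 then c v else c₀ v)
      (fun v _ _ => by
        split_ifs with h
        · rw [(hone v h.1 h.2).2.2.1]
          exact hc v h.1 h.2
        · exact hc₀ v) a b ⟨w, fun v hv => by
        have h := (hw v hv).1
        have ha := (hw a w.start_mem_support).1
        refine ⟨⟨trivial, by rw [(hone v h.1 h.2).2.2.1]; exact h.2⟩, ?_⟩
        dsimp only
        rw [if_pos ⟨h.1, h.2⟩, if_pos ⟨ha.1, ha.2⟩]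
        exact (hw v hv).2⟩
    refine ⟨w', hw', fun p hp hpb => ?_⟩
    have ha := (hw a w.start_mem_support).1
    obtain ⟨hab, haA, -, ha1⟩ := hone a ha.1 ha.2
    exact hR.good ρ hR.subtree.root_mem a p hab haA ha1 hpb
      ((near_of_mem_support w' hp).mono (by omega))

/-- A region whose subtree is a single node is colored by extendability. -/
theorem Region.exists_coloring_of_eq_root (hD : D.IsTDOn G Set.univ)
    (hθ : ∀ t, t ≠ D.root → (D.adh t).ncard ≤ θ)
    (hs : θ ≤ s) (hm : 2 ≤ m) (hne : ∀ v, (L v).Nonempty)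
    (hL : HeredExtOn G D Set.univ L m s r k N)
    (hR : Region G D L m r k A C ρ H ℓ K) (hC : ∀ t ∈ C, t = ρ) :
    ∃ c : V → ℕ, (∀ v ∈ A, c v ∈ ℓ v) ∧ BoundedOn G H A c (N * K) := by
  classical
  obtain ⟨P, hP⟩ := exists_mono_lists (by omega) hL.1
  set L' : V → Finset ℕ := fun v => if v ∈ D.bag ρ then ℓ v else P v with hL'
  have hin : ∀ v ∈ D.bag ρ, L' v = ℓ v := fun v hv => if_pos hv
  have hout : ∀ v ∉ D.bag ρ, L' v = P v := fun v hv => if_neg hv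
  set A' : Set V := {v | v ∈ D.bag ρ → v ∈ A} with hA'
  have hext := hL.2 A' (Set.subset_univ _) L' (fun v hv => by
    by_cases hb : v ∈ D.bag ρ
    · rw [hin v hb]
      exact hR.subset_list v (hv hb)
    · rw [hout v hb]
      exact (hP v).1) (hR.legitOn hD hθ hs hm hne hL.1 hin fun v hv => by
        rw [hout v hv]; exact (hP v).2)
  let U : Type u := {v : V // v ∈ A ∧ v ∉ D.bag ρ}
  have hown : ∀ u : U, ∃ t ∈ D.boundary C, u.1 ∈ D.below t := fun u => by
    refine (hR.mem_bag_or_below hD u.2.1).resolve_left ?_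
    rintro ⟨t, ht, hut⟩
    exact u.2.2 (hC t ht ▸ hut)
  choose own hownC hownb using hown
  have hpar : ∀ u, D.par (own u) = ρ := fun u => hC _ (hownC u).2.2
  have hneρ : ∀ u, own u ≠ ρ := fun u h => (hownC u).1 (h ▸ hR.subtree.root_mem)
  have htd : ∀ u : U, ∀ v ∈ A, H.Adj u.1 v → v ∈ D.below (own u) ∨ v ∈ D.adh (own u) :=
    fun u v hv h => hR.td _ (hownC u).2.1 (hneρ u) (hownC u).2.2 _ _ (hownb u) u.2.1 hv h
  have hnotin : ∀ (u : U) v, v ∈ D.bag ρ → v ∉ D.below (own u) := fun u v hv h =>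
    hR.subtree.not_anc_of_boundary hD.1 (hownC u) hR.subtree.root_mem (h _ hv)
  let f : ↥(A' ∩ D.bag ρ) ⊕ U → V := Sum.elim Subtype.val Subtype.val
  have hnew : ∀ u u' : U, H.Adj u.1 u'.1 → own u = own u' := fun u u' h => by
    rcases htd u _ u'.2.1 h with h | h
    · obtain ⟨q, hq⟩ := RTD.exists_mem_bag hD u'.1
      exact hR.subtree.eq_of_anc_boundary hD.1 (hownC u) (hownC u') (h q hq) (hownb u' q hq)
    · have h' := h.1
      rw [hpar] at h'
      exact absurd h' u'.2.2
  let E : ChildExt G D A' ρ U :=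
    { graph := H.comap f
      owner := own
      base_adj := fun x y => hR.core_adj ρ hR.subtree.root_mem _ _ x.2.2 y.2.2
        (x.2.1 x.2.2) (y.2.1 y.2.2)
      owner_child := fun u => by
        have := RTD.isChild_par hD.1 (hownC u).2.1
        rwa [hpar] at this
      mixed_adj := fun x u h =>
        ((htd u _ (x.2.1 x.2.2) (SimpleGraph.Adj.symm h)).resolve_left (hnotin u _ x.2.2)).2
      new_adj := hnew
      new_small := fun u₁ u₂ u₃ h h' => by
        refine Subtype.ext (hR.small (own u₁) (hownC u₁) _ u₂.1 _ ⟨hownb u₁, u₁.2.1⟩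
          ⟨?_, u₂.2.1⟩ ⟨?_, u₃.2.1⟩ h h')
        · rw [hnew _ _ h]
          exact hownb u₂
        · rw [hnew _ _ h, hnew _ _ h']
          exact hownb u₃ }
  have : Fintype U := Fintype.ofFinite U
  have hlist : ∀ z, f z ∈ A := by
    rintro (x | u)
    · exact x.2.1 x.2.2
    · exact u.2.1
  obtain ⟨c, hc, hcN⟩ := hext.2 ρ U inferInstance E (fun z => ℓ (f z))
    (fun z => (hne _).mono (hR.subset_list _ (hlist z))) (fun x => (hin _ x.2.2).symm)
  let g : ∀ v, v ∈ A → ↥(A' ∩ D.bag ρ) ⊕ U := fun v hv =>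
    if hb : v ∈ D.bag ρ then .inl ⟨v, fun _ => hv, hb⟩ else .inr ⟨v, hv, hb⟩
  have hfg : ∀ v hv, f (g v hv) = v := fun v hv => by
    simp only [g]
    split_ifs <;> rfl
  set c' : V → ℕ := fun v => if hv : v ∈ A then c (g v hv) else 0 with hc'
  have hc'A : ∀ v (hv : v ∈ A), c' v = c (g v hv) := fun v hv => dif_pos hv
  refine ⟨c', fun v hv => ?_, fun α a b hab => ?_⟩
  · rw [hc'A v hv]
    have := hc (g v hv)
    rwa [hfg v hv] at this
  · by_cases ha : a ∈ A ∧ c' a = α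
    swap
    · cases hab.symm with
      | refl => exact Near.refl _ _
      | tail _ h => exact absurd h.2.2 ha
    have key : ∀ hb : b ∈ A, MonoReach E.graph Set.univ c (g a ha.1) (g b hb) := by
      induction hab with
      | refl => exact fun _ => ⟨.nil, by simp⟩
      | @tail p q _ e ih =>
        intro hq
        obtain ⟨w, hw⟩ := ih e.2.1.1
        have hadj : E.graph.Adj (g p e.2.1.1) (g q hq) := by
          change H.Adj (f _) (f _)
          rw [hfg _ e.2.1.1, hfg _ hq]
          exact e.1
        refine ⟨w.concat hadj, fun z hz => ?_⟩
        rw [Walk.support_concat, List.mem_append] at hz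
        rcases hz with hz | hz
        · exact hw z hz
        · rw [List.mem_singleton.1 hz, ← hc'A _ hq, ← hc'A _ ha.1, e.2.2.2, ha.2]
          exact ⟨trivial, rfl⟩
    have hb := (hab.mem_right (S := {v | v ∈ A ∧ c' v = α}) ha).1
    obtain ⟨w, hw⟩ := hcN _ _ (key hb)
    have := near_mul_length hR.jump (w.map (⟨f, fun h => h⟩ : E.graph →g H))
    rw [Walk.length_map] at this
    change Near G _ (f _) (f _) at this
    rw [hfg _ ha.1, hfg _ hb] at this
    exact this.mono (Nat.mul_le_mul_right _ hw)

end Region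

/-! ### Restricting a region to a subtree, and cutting it along a ball -/

theorem Conn.bind {V : Type u} {H H' : SimpleGraph V} {S S' : Set V} {a b : V}
    (h : Conn H S a b)
    (hf : ∀ u v, H.Adj u v → u ∈ S → v ∈ S → Conn H' S' u v) : Conn H' S' a b := by
  induction h with
  | refl => exact .refl
  | tail _ e ih => exact ih.trans (hf _ _ e.1 e.2.1 e.2.2)

/-- The subtree `T` records the part of a region that is met by the set `B`. -/
structure Cut {V : Type u} {ι : Type v} (D : RTD V ι) (A : Set V) (C : Set ι) (ρ : ι)
    (B : Set V) (T : Set ι) : Prop where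
  subtree : D.Subtree ρ T
  subset : T ⊆ C
  subset_region : B ⊆ A
  meets : ∀ t ∈ T, t ≠ ρ → (D.adh t ∩ B).Nonempty
  avoids : ∀ t ∈ D.boundary T ∩ C, ∀ v ∈ B, v ∉ D.below t ∧ v ∉ D.adh t

section Cut

variable {V : Type u} {ι : Type v}

/-- The part of `A` in and below the node `t`. -/
def cone (D : RTD V ι) (A : Set V) (t : ι) : Set V := A ∩ (D.below t ∪ D.adh t)

/-- The part of `A` that is not strictly below a node of `Φ`. -/
def kept (D : RTD V ι) (A : Set V) (Φ : Set ι) : Set V := {v | v ∈ A ∧ ∀ t ∈ Φ, v ∉ D.below t}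

/-- The ball of radius `d` around the adhesion set of `t` in the cone of `t`. -/
def coneBall (G : SimpleGraph V) (D : RTD V ι) (A : Set V) (H : SimpleGraph V) (d : ℕ) (t : ι) :
    Set V := ballIn G H (cone D A t) (D.adh t ∩ A) d

/-- The vertex set of the region obtained by deleting `B` and shrinking the cones at `Φ`. -/
def cutSet (G : SimpleGraph V) (D : RTD V ι) (A : Set V) (H : SimpleGraph V) (d : ℕ)
    (B : Set V) (Φ : Set ι) : Set V :=
  (kept D A Φ \ B) ∪ {v | ∃ t ∈ Φ, v ∈ D.below t ∧ v ∈ coneBall G D A H d t}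

/-- The vertex `x` of an adhesion set is linked to the vertex `v` of the ball around it if a
monochromatic component may pass from `x` to `v`. -/
def Link (G : SimpleGraph V) (D : RTD V ι) (A : Set V) (H : SimpleGraph V) (ℓ : V → Finset ℕ)
    (d : ℕ) (Φ : Set ι) (x v : V) : Prop :=
  ∃ t ∈ Φ, x ∈ D.adh t ∧ x ∈ A ∧ v ∈ D.below t ∧ v ∈ coneBall G D A H d t ∧
    (((ℓ v).card ≠ 1 ∧ Conn H (coneBall G D A H d t) x v) ∨
      ∃ α y, ℓ v = {α} ∧ H.Adj x y ∧ y ∈ A ∧ y ∈ D.below t ∧ ℓ y = {α} ∧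
        Conn H {p | p ∈ A ∧ p ∈ D.below t ∧ ℓ p = {α}} y v)

/-- The graph on `cutSet`. -/
def cutGraph (G : SimpleGraph V) (D : RTD V ι) (A : Set V) (H : SimpleGraph V)
    (ℓ : V → Finset ℕ) (d : ℕ) (B : Set V) (Φ : Set ι) : SimpleGraph V :=
  SimpleGraph.fromRel fun u v =>
    (u ∈ kept D A Φ \ B ∧ v ∈ kept D A Φ \ B ∧ H.Adj u v) ∨ Link G D A H ℓ d Φ u v

open Classical in
/-- The lists on `cutSet`: vertices near `B` get the lists `P`. -/
noncomputable def cutList (G : SimpleGraph V) (D : RTD V ι) (A : Set V) (ℓ P : V → Finset ℕ)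
    (e : ℕ) (B : Set V) (Φ : Set ι) (v : V) : Finset ℕ :=
  if v ∈ kept D A Φ ∧ ∃ b ∈ B, Near G e v b then P v else ℓ v

variable {G : SimpleGraph V} {D : RTD V ι}
  {L : V → Finset ℕ} {m r k θ : ℕ} {A : Set V} {C : Set ι} {ρ : ι} {H : SimpleGraph V}
  {ℓ : V → Finset ℕ} {K d q : ℕ} {B : Set V} {T : Set ι} {P : V → Finset ℕ} {t t' : ι}

theorem Region.ne_root (hD : D.IsTDOn G Set.univ) (hR : Region G D L m r k A C ρ H ℓ K)
    (ht : t ∈ C) (htρ : t ≠ ρ) : t ≠ D.root :=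
  ((hR.subtree.anc t ht).ne_root_and_par hD.1 (Ne.symm htρ)).1

/-- Edges leave a cone only through the adhesion set. -/
theorem Region.mem_below_or_adh_of_adj (hD : D.IsTDOn G Set.univ)
    (hR : Region G D L m r k A C ρ H ℓ K) (ht : t ∈ C) (htρ : t ≠ ρ) {u v : V}
    (hu : u ∈ D.below t) (huA : u ∈ A) (hv : v ∈ A) (h : H.Adj u v) :
    v ∈ D.below t ∨ v ∈ D.adh t :=
  hR.td t (hR.ne_root hD ht htρ) htρ (hR.subtree.par_mem t ht htρ) u v hu huA hv h

theorem Region.restrict (hD : D.IsTDOn G Set.univ) (hR : Region G D L m r k A C ρ H ℓ K)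
    (ht : t ∈ C) (htρ : t ≠ ρ) :
    Region G D L m r k (cone D A t) {s | s ∈ C ∧ D.Anc t s} t H ℓ K where
  subtree :=
    { root_mem := ⟨ht, .refl _⟩
      anc := fun s hs => hs.2
      par_mem := fun s hs hst => by
        refine ⟨hR.subtree.par_mem s hs.1 ?_, (hs.2.ne_root_and_par hD.1 (Ne.symm hst)).2⟩
        rintro rfl
        exact htρ (hs.2.antisymm hD.1 (hR.subtree.anc t ht)) }
  jump := hR.jump
  core_adj := fun s hs u v hus hvs hu hv => hR.core_adj s hs.1 u v hus hvs hu.1 hv.1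
  td := fun s hs hst hp u v hu huA hv h => by
    refine hR.td s hs ?_ hp.1 u v hu huA.1 hv.1 h
    rintro rfl
    exact RTD.not_anc_par hD.1 hs (hR.subtree.anc _ hp.1)
  small := fun s hs x y z hx hy hz => by
    have : s ∈ D.boundary C :=
      ⟨fun h => hs.1 ⟨h, hs.2.2.2.trans (RTD.anc_par hD.1 hs.2.1)⟩, hs.2.1, hs.2.2.1⟩
    exact hR.small s this x y z ⟨hx.1, hx.2.1⟩ ⟨hy.1, hy.2.1⟩ ⟨hz.1, hz.2.1⟩
  subset_list := fun v hv => hR.subset_list v hv.1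
  card_list := fun v hv => hR.card_list v hv.1
  good := fun s hs z p hz hzA h1 hp hzp =>
    ⟨hR.good s hs.1 z p hz hzA.1 h1 hp hzp, RTD.mem_below_or_adh hD hp hs.2⟩
  single := fun α a b h => hR.single α a b (h.mono fun _ hp => ⟨hp.1.1, hp.2⟩)
  cover := fun v hv => by
    rcases hv.2 with h | h
    · obtain ⟨s, hs⟩ := RTD.exists_mem_bag hD v
      exact ⟨s, h s hs, hs⟩
    · exact ⟨t, .refl _, h.2⟩

theorem Region.conn_crosses (hD : D.IsTDOn G Set.univ) (hR : Region G D L m r k A C ρ H ℓ K)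
    (ht : t ∈ C) (htρ : t ≠ ρ) (hB : B ⊆ A) {x v : V} (h : Conn H B v x)
    (hv : v ∈ D.below t) (hx : x ∉ D.below t) : (D.adh t ∩ B).Nonempty := by
  by_contra hcon
  refine hx ?_
  clear hx
  induction h with
  | refl => exact hv
  | tail _ e ih =>
    exact (hR.mem_below_or_adh_of_adj hD ht htρ ih (hB e.2.1) (hB e.2.2) e.1).resolve_right
      fun h => hcon ⟨_, h, e.2.2⟩

/-- The nodes of a region whose bags meet a ball around vertices of the root bag. -/
theorem Region.exists_cut (hD : D.IsTDOn G Set.univ) (hR : Region G D L m r k A C ρ H ℓ K)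
    {R : Set V} (hRA : R ⊆ A) (hRρ : R ⊆ D.bag ρ) :
    ∃ T, Cut D A C ρ (ballIn G H A R d) T := by
  set B := ballIn G H A R d with hB
  have hBA : B ⊆ A := fun v hv => (ballIn_subset_collar hRA hv).1
  have cross : ∀ t ∈ C, t ≠ ρ → ∀ v ∈ B, v ∈ D.below t ∨ v ∈ D.adh t →
      (D.adh t ∩ B).Nonempty := by
    rintro t ht htρ v hv (hvt | hvt)
    · obtain ⟨x, hx, h⟩ := exists_conn_ballIn hv
      refine hR.conn_crosses hD ht htρ hBA h.symm hvt fun hxt => ?_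
      exact htρ ((hxt ρ (hRρ hx)).antisymm hD.1 (hR.subtree.anc t ht))
    · exact ⟨v, hvt, hv⟩
  have meets : ∀ t ∈ C, t ≠ ρ → (D.bag t ∩ B).Nonempty → (D.adh t ∩ B).Nonempty := by
    rintro t ht htρ ⟨v, hvt, hv⟩
    exact cross t ht htρ v hv (RTD.mem_below_or_adh hD hvt (.refl _))
  refine ⟨{t | t = ρ ∨ t ∈ C ∧ (D.bag t ∩ B).Nonempty}, ?_, ?_, hBA, ?_, ?_⟩
  · refine ⟨.inl rfl, ?_, ?_⟩
    · rintro t (rfl | ht)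
      · exact .refl _
      · exact hR.subtree.anc t ht.1
    · rintro t (rfl | ht) htρ
      · exact absurd rfl htρ
      · obtain ⟨y, hy, hyB⟩ := meets t ht.1 htρ ht.2
        exact .inr ⟨hR.subtree.par_mem t ht.1 htρ, y, hy.1, hyB⟩
  · rintro t (rfl | ht)
    · exact hR.subtree.root_mem
    · exact ht.1
  · rintro t (rfl | ht) htρ
    · exact absurd rfl htρ
    · exact meets t ht.1 htρ ht.2
  · rintro t ⟨ht, htC⟩ v hv
    by_contra hcon
    obtain ⟨y, hy, hyB⟩ := cross t htC (fun h => ht.1 (.inl h)) v hv (by tauto)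
    exact ht.1 (.inr ⟨htC, y, hy.2, hyB⟩)

theorem adh_inter_subset_cone : D.adh t ∩ A ⊆ cone D A t := fun _ hx => ⟨hx.2, .inr hx.1⟩

theorem coneBall_subset_cone : coneBall G D A H d t ⊆ cone D A t := fun _ hv =>
  (ballIn_subset_collar adh_inter_subset_cone hv).1

theorem cutSet_subset {Φ : Set ι} : cutSet G D A H d B Φ ⊆ A := by
  rintro v (hv | ⟨t, -, -, hv⟩)
  · exact hv.1.1
  · exact (coneBall_subset_cone hv).1

theorem near_of_conn_coneBall [Finite V] (hθ : ∀ t, t ≠ D.root → (D.adh t).ncard ≤ θ)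
    (ht : t ≠ D.root) (hR : Region G D L m r k A C ρ H ℓ K) {x v : V}
    (hx : x ∈ coneBall G D A H d t) (h : Conn H (coneBall G D A H d t) x v) :
    Near G (θ * (2 * d + K)) x v :=
  near_of_conn_ballIn adh_inter_subset_cone
    ((Set.ncard_le_ncard Set.inter_subset_left).trans (hθ t ht)) hR.jump hx h

theorem Cut.ne (hT : Cut D A C ρ B T) (ht : t ∈ D.boundary T ∩ C) : t ≠ ρ :=
  fun h => ht.1.1 (h ▸ hT.subtree.root_mem)

theorem Cut.eq_of_mem_below (hD : D.IsTDOn G Set.univ) (hT : Cut D A C ρ B T)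
    (ht : t ∈ D.boundary T) (ht' : t' ∈ D.boundary T) {v : V} (hv : v ∈ D.below t)
    (hv' : v ∈ D.below t') : t = t' := by
  obtain ⟨s, hs⟩ := RTD.exists_mem_bag hD v
  exact hT.subtree.eq_of_anc_boundary hD.1 ht ht' (hv s hs) (hv' s hs)

theorem Cut.not_mem_below (hD : D.IsTDOn G Set.univ) (hT : Cut D A C ρ B T)
    (ht : t ∈ D.boundary T) (ht' : t' ∈ T) {v : V} (hv : v ∈ D.bag t') : v ∉ D.below t :=
  fun h => hT.subtree.not_anc_of_boundary hD.1 ht ht' (h t' hv)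

theorem Cut.mem_kept (hD : D.IsTDOn G Set.univ) (hT : Cut D A C ρ B T)
    (ht : t ∈ T) {v : V} (hvA : v ∈ A) (hv : v ∈ D.bag t) : v ∈ kept D A (D.boundary T ∩ C) :=
  ⟨hvA, fun _ ht' => hT.not_mem_below hD ht'.1 ht hv⟩

theorem Cut.mem_kept_of_mem_adh (hD : D.IsTDOn G Set.univ) (hT : Cut D A C ρ B T)
    (ht : t ∈ D.boundary T ∩ C) {v : V} (hvA : v ∈ A) (hv : v ∈ D.adh t) :
    v ∈ kept D A (D.boundary T ∩ C) \ B :=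
  ⟨hT.mem_kept hD ht.1.2.2 hvA hv.1, fun hB => (hT.avoids t ht v hB).2 hv⟩

theorem Cut.subset_kept (hT : Cut D A C ρ B T) : B ⊆ kept D A (D.boundary T ∩ C) :=
  fun v hv => ⟨hT.subset_region hv, fun t ht => (hT.avoids t ht v hv).1⟩

theorem mem_kept_of_mem_cutSet (hD : D.IsTDOn G Set.univ) (hT : Cut D A C ρ B T)
    (ht : t ∈ T) {v : V} (hv : v ∈ cutSet G D A H d B (D.boundary T ∩ C)) (hvt : v ∈ D.bag t) :
    v ∈ kept D A (D.boundary T ∩ C) \ B := by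
  rcases hv with hv | ⟨t', ht', hv, -⟩
  · exact hv
  · exact absurd hv (hT.not_mem_below hD ht'.1 ht hvt)

theorem cutGraph_adj_of_link {Φ : Set ι} {x v : V} (h : Link G D A H ℓ d Φ x v) (hne : x ≠ v) :
    (cutGraph G D A H ℓ d B Φ).Adj x v := ⟨hne, .inl (.inr h)⟩

theorem cutGraph_adj {Φ : Set ι} {u v : V} (h : (cutGraph G D A H ℓ d B Φ).Adj u v) :
    (u ∈ kept D A Φ \ B ∧ v ∈ kept D A Φ \ B ∧ H.Adj u v) ∨ Link G D A H ℓ d Φ u v ∨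
      Link G D A H ℓ d Φ v u := by
  rcases h.2 with (h | h) | h | h
  · exact .inl h
  · exact .inr (.inl h)
  · exact .inl ⟨h.2.1, h.1, h.2.2.symm⟩
  · exact .inr (.inr h)

theorem Link.not_mem_kept {Φ : Set ι} {x v : V} (h : Link G D A H ℓ d Φ x v) :
    v ∉ kept D A Φ := by
  obtain ⟨t, ht, -, -, hv, -⟩ := h
  exact fun h => h.2 t ht hv

theorem Link.near [Finite V] (hD : D.IsTDOn G Set.univ)
    (hθ : ∀ t, t ≠ D.root → (D.adh t).ncard ≤ θ)
    (hR : Region G D L m r k A C ρ H ℓ K) (hT : Cut D A C ρ B T) {x v : V}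
    (h : Link G D A H ℓ d (D.boundary T ∩ C) x v) : Near G (θ * (2 * d + K) + K + k) x v := by
  obtain ⟨t, ht, hxt, hxA, hvt, hv, ⟨-, h⟩ | ⟨α, y, -, hxy, hyA, -, hy, h⟩⟩ := h
  · exact (near_of_conn_coneBall hθ (hR.ne_root hD ht.2 (hT.ne ht)) hR
      (subset_ballIn ⟨hxt, hxA⟩) h).mono (by omega)
  · exact ((hR.jump _ _ hxy).trans (hR.single α y v (h.mono fun p hp => ⟨hp.1, hp.2.2⟩))).mono
      (by omega)

theorem cutGraph_near [Finite V] (hD : D.IsTDOn G Set.univ)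
    (hθ : ∀ t, t ≠ D.root → (D.adh t).ncard ≤ θ)
    (hR : Region G D L m r k A C ρ H ℓ K) (hT : Cut D A C ρ B T) {u v : V}
    (h : (cutGraph G D A H ℓ d B (D.boundary T ∩ C)).Adj u v) :
    Near G (θ * (2 * d + K) + K + k) u v := by
  rcases cutGraph_adj h with h | h | h
  · exact (hR.jump _ _ h.2.2).mono (by omega)
  · exact h.near hD hθ hR hT
  · exact (h.near hD hθ hR hT).symm

theorem Region.cut [Finite V] (hD : D.IsTDOn G Set.univ)
    (hθ : ∀ t, t ≠ D.root → (D.adh t).ncard ≤ θ) (hm : 2 ≤ m)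
    (hP : ∀ v, L v ⊆ P v ∧ (P v).card = m)
    (hR : Region G D L m r k A C ρ H ℓ K) (hT : Cut D A C ρ B T) :
    Region G D L m r k (cutSet G D A H d B (D.boundary T ∩ C)) T ρ
      (cutGraph G D A H ℓ d B (D.boundary T ∩ C)) (cutList G D A ℓ P (r + k) B (D.boundary T ∩ C))
      (θ * (2 * d + K) + K + k) := by
  have hone : ∀ v, (cutList G D A ℓ P (r + k) B (D.boundary T ∩ C) v).card = 1 →
      cutList G D A ℓ P (r + k) B (D.boundary T ∩ C) v = ℓ v ∧
        (v ∈ kept D A (D.boundary T ∩ C) → ∀ b ∈ B, ¬ Near G (r + k) v b) := by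
    intro v hv
    unfold cutList at hv ⊢
    split_ifs at hv ⊢ with h
    · have := (hP v).2
      omega
    · exact ⟨rfl, fun hv b hb hvb => h ⟨hv, b, hb, hvb⟩⟩
  refine ⟨hT.subtree, fun u v h => cutGraph_near hD hθ hR hT h, ?_, ?_, ?_, ?_, ?_, ?_, ?_, ?_⟩
  · intro t ht u v hut hvt hu hv
    have hu' := mem_kept_of_mem_cutSet hD hT ht hu hut
    have hv' := mem_kept_of_mem_cutSet hD hT ht hv hvt
    rw [← hR.core_adj t (hT.subset ht) u v hut hvt hu'.1.1 hv'.1.1]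
    refine ⟨fun h => ?_, fun h => ⟨h.ne, .inl (.inl ⟨hu', hv', h⟩)⟩⟩
    rcases cutGraph_adj h with h | h | h
    · exact h.2.2
    · exact absurd hv'.1 h.not_mem_kept
    · exact absurd hu'.1 h.not_mem_kept
  · intro t ht htρ hpt u v hut hu hv h
    rcases cutGraph_adj h with h | h | h
    · exact hR.td t ht htρ (hT.subset hpt) u v hut h.1.1.1 h.2.1.1.1 h.2.2
    · obtain ⟨t', ht', hut', -, hvt', -⟩ := h
      refine .inl fun s hs => ?_
      exact (hut _ hut'.1).trans ((RTD.anc_par hD.1 ht'.1.2.1).trans (hvt' s hs))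
    · obtain ⟨t', ht', hvt', -, hut', -⟩ := h
      obtain ⟨s, hs⟩ := RTD.exists_mem_bag hD u
      refine RTD.mem_below_or_adh hD hvt'.2 ?_
      rcases RTD.anc_total hD.1 (hut s hs) (hut' s hs) with h | h
      · exact h
      · by_cases htt : t' = t
        · exact htt ▸ .refl _
        · exact absurd (h.ne_root_and_par hD.1 htt).2
            (hT.subtree.not_anc_of_boundary hD.1 ht'.1 hpt)
  · intro t ht x y z hx hy hz hxy hyz
    have hlink : ∀ x v, x ∈ D.below t → v ∈ D.below t →
        ¬ Link G D A H ℓ d (D.boundary T ∩ C) x v := by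
      rintro x v hx hv ⟨t', ht', hxt', -, hvt', -⟩
      obtain rfl := hT.eq_of_mem_below hD ht ht'.1 hv hvt'
      exact RTD.not_mem_below_of_mem_adh hD ht.2.1 hxt' hx
    have hadj : ∀ x y, x ∈ D.below t → y ∈ D.below t →
        (cutGraph G D A H ℓ d B (D.boundary T ∩ C)).Adj x y →
        x ∈ kept D A (D.boundary T ∩ C) ∧ H.Adj x y := by
      intro x y hx hy h
      rcases cutGraph_adj h with h | h | h
      · exact ⟨h.1.1, h.2.2⟩
      · exact absurd h (hlink _ _ hx hy)
      · exact absurd h (hlink _ _ hy hx)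
    have hxy' := hadj x y hx.1 hy.1 hxy
    have hyz' := hadj y z hy.1 hz.1 hyz
    by_cases htC : t ∈ C
    · exact absurd hx.1 (hxy'.1.2 t ⟨ht, htC⟩)
    · exact hR.small t ⟨htC, ht.2.1, hT.subset ht.2.2⟩ x y z ⟨hx.1, cutSet_subset hx.2⟩
        ⟨hy.1, cutSet_subset hy.2⟩ ⟨hz.1, cutSet_subset hz.2⟩ hxy'.2 hyz'.2
  · intro v hv
    unfold cutList
    split_ifs
    · exact (hP v).1
    · exact hR.subset_list v (cutSet_subset hv)
  · intro v hv
    unfold cutList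
    split_ifs
    · exact .inr (hP v).2
    · exact hR.card_list v (cutSet_subset hv)
  · intro t ht z p hzt hz hz1 hpt hzp
    have hz' := mem_kept_of_mem_cutSet hD hT ht hz hzt
    obtain ⟨hzl, hzB⟩ := hone z hz1
    have hpA := hR.good t (hT.subset ht) z p hzt hz'.1.1 (hzl ▸ hz1) hpt hzp
    exact .inl ⟨hT.mem_kept hD ht hpA hpt, fun hpB => hzB hz'.1 p hpB hzp⟩
  · intro α a b hab
    refine hR.single α a b (hab.bind fun u v h hu hv => ?_)
    have hmem : ∀ u, u ∈ cutSet G D A H d B (D.boundary T ∩ C) ∧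
        cutList G D A ℓ P (r + k) B (D.boundary T ∩ C) u = {α} → u ∈ A ∧ ℓ u = {α} := by
      rintro u ⟨hu, hu1⟩
      refine ⟨cutSet_subset hu, ?_⟩
      rw [← (hone u (by rw [hu1]; rfl)).1, hu1]
    have hlink : ∀ x v, x ∈ A ∧ ℓ x = {α} → v ∈ A ∧ ℓ v = {α} →
        Link G D A H ℓ d (D.boundary T ∩ C) x v → Conn H {v | v ∈ A ∧ ℓ v = {α}} x v := by
      rintro x v hx hv ⟨t, ht, -, -, -, -, ⟨h, -⟩ | ⟨β, y, hvβ, hxy, hyA, -, hy, h⟩⟩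
      · rw [hv.2] at h
        exact absurd rfl h
      · obtain rfl : β = α := by
          rw [hv.2] at hvβ
          exact (Finset.singleton_injective hvβ).symm
        exact .head ⟨hxy, hx, hyA, hy⟩ (h.mono fun p hp => ⟨hp.1, hp.2.2⟩)
    have hu' := hmem u hu
    have hv' := hmem v hv
    rcases cutGraph_adj h with h | h | h
    · exact Conn.single h.2.2 hu' hv'
    · exact hlink _ _ hu' hv' h
    · exact (hlink _ _ hv' hu' h).symm
  · exact fun v hv => hR.cover v (cutSet_subset hv)

theorem Cut.ncard_adh_inter_lt [Finite V] (hT : Cut D A C ρ B T) (ht : t ∈ T) (htρ : t ≠ ρ)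
    (h : (D.adh t ∩ A).ncard < q + 1) :
    (D.adh t ∩ cutSet G D A H d B (D.boundary T ∩ C)).ncard < q := by
  obtain ⟨y, hy, hyB⟩ := hT.meets t ht htρ
  have : D.adh t ∩ cutSet G D A H d B (D.boundary T ∩ C) ⊂ D.adh t ∩ A := by
    refine ⟨Set.inter_subset_inter_right _ cutSet_subset, fun h => ?_⟩
    rcases (h (show y ∈ D.adh t ∩ A from ⟨hy, hT.subset_region hyB⟩)).2 with h | ⟨t', ht', h, -⟩
    · exact h.2 hyB
    · exact (hT.avoids t' ht' y hyB).1 h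
  have := Set.ncard_lt_ncard this
  omega

end Cut

/-! ### Colorings that keep monochromatic components inside a ball -/

section Blocking

variable {V : Type u} {G H : SimpleGraph V} {A R : Set V} {ℓ : V → Finset ℕ} {c c₁ : V → ℕ}
  {W n m k K : ℕ}

/-- The vertex `v` is at distance at most `n` from `R`. -/
def NearSet (G : SimpleGraph V) (R : Set V) (n : ℕ) (v : V) : Prop := ∃ y ∈ R, Near G n v y

theorem NearSet.mono {i j : ℕ} {v : V} (h : NearSet G R i v) (hij : i ≤ j) : NearSet G R j v := by
  obtain ⟨y, hy, h⟩ := h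
  exact ⟨y, hy, h.mono hij⟩

theorem NearSet.trans {i j : ℕ} {u v : V} (h : NearSet G R i v) (huv : Near G j u v) :
    NearSet G R (j + i) u := by
  obtain ⟨y, hy, h⟩ := h
  exact ⟨y, hy, huv.trans h⟩

/-- In the layer of vertices at distance between `j * W` and `(j + 1) * W` from `R`, the color `a`
is used only on vertices with singleton lists. -/
def Blocks (G : SimpleGraph V) (A R : Set V) (ℓ : V → Finset ℕ) (c : V → ℕ) (W j a : ℕ) : Prop :=
  ∀ v ∈ A, NearSet G R ((j + 1) * W) v → ¬ NearSet G R (j * W) v → (ℓ v).card ≠ 1 → c v ≠ a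

/-- If `R` has at most `n` vertices, then each color used on `R` can be blocked in one of the
first `n` layers around `R`. -/
theorem exists_blocking [Finite V] (hn : R.ncard ≤ n) (hc₁ : ∀ v ∈ A, c₁ v ∈ ℓ v) :
    ∃ c : V → ℕ, (∀ v ∈ A, c v ∈ ℓ v) ∧ (∀ v, NearSet G R W v → c v = c₁ v) ∧
      ∀ x ∈ R, ∃ j, 1 ≤ j ∧ j ≤ n ∧ Blocks G A R ℓ c W j (c₁ x) := by
  classical
  have e : R ≃ Fin R.ncard := by
    have := Finite.equivFin R
    rwa [Nat.card_coe_set_eq] at this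
  let layer : R → V → Prop := fun x v =>
    NearSet G R (((e x : ℕ) + 1 + 1) * W) v ∧ ¬ NearSet G R (((e x : ℕ) + 1) * W) v
  have huniq : ∀ x y v, layer x v → layer y v → x = y := by
    have hle : ∀ x y v, layer x v → layer y v → (e x : ℕ) ≤ e y := by
      intro x y v hx hy
      by_contra! hlt
      exact hx.2 (hy.1.mono (Nat.mul_le_mul_right _ (by omega)))
    intro x y v hx hy
    exact e.injective (Fin.ext (le_antisymm (hle x y v hx hy) (hle y x v hy hx)))
  let c : V → ℕ := fun v =>
    if NearSet G R W v then c₁ v else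
      if h : ∃ b ∈ ℓ v, ∀ x, layer x v → b ≠ c₁ x then h.choose else c₁ v
  refine ⟨c, fun v hv => ?_, fun v hv => if_pos hv, fun x hx => ?_⟩
  · simp only [c]
    split_ifs with h1 h2
    · exact hc₁ v hv
    · exact h2.choose_spec.1
    · exact hc₁ v hv
  · refine ⟨(e ⟨x, hx⟩ : ℕ) + 1, by omega, by omega, fun v hv h1 h2 hcard => ?_⟩
    have hW : ¬ NearSet G R W v := fun h => h2 (h.mono (by nlinarith))
    have hex : ∃ b ∈ ℓ v, ∀ x, layer x v → b ≠ c₁ x := by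
      obtain ⟨b, hb, hbx⟩ : ∃ b ∈ ℓ v, b ≠ c₁ x := by
        by_contra! hcon
        exact hcard (Finset.card_eq_one.2 ⟨c₁ x, Finset.eq_singleton_iff_nonempty_unique_mem.2
          ⟨⟨_, hc₁ v hv⟩, hcon⟩⟩)
      refine ⟨b, hb, fun y hy => ?_⟩
      rwa [huniq y ⟨x, hx⟩ v hy ⟨h1, h2⟩]
    simp only [c, if_neg hW, dif_pos hex]
    exact hex.choose_spec.2 ⟨x, hx⟩ ⟨h1, h2⟩

/-- If `c` agrees with `c₁` on a ball around `R` in which `c₁` blocks the color `a`, then no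
component of color `a` that meets `R` leaves this ball. -/
theorem mem_ballIn_of_blocks (hRA : R ⊆ A) (hc : ∀ v ∈ A, c v ∈ ℓ v)
    (hcc₁ : ∀ v ∈ ballIn G H A R ((n + 1) * (k + 2 * K)), c v = c₁ v)
    (hK : ∀ u v, H.Adj u v → Near G K u v)
    (hk : ∀ α a b, Conn H {v | v ∈ A ∧ ℓ v = {α}} a b → Near G k a b) {j a : ℕ}
    (hjn : j ≤ n) (hb : Blocks G A R ℓ c₁ (k + 2 * K) j a) {x v : V} (hx : x ∈ R)
    (h : Conn H {v | v ∈ A ∧ c v = a} x v) :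
    v ∈ ballIn G H A R ((n + 1) * (k + 2 * K)) := by
  set W := k + 2 * K with hW
  have hjW : (j + 1) * W = j * W + W := by ring
  have hnW : (j + 1) * W ≤ (n + 1) * W := Nat.mul_le_mul_right _ (by omega)
  suffices v ∈ ballIn G H A R ((n + 1) * W) ∧ (NearSet G R (j * W) v ∨
      ∃ u, NearSet G R (j * W + K) u ∧ (u ∈ A ∧ ℓ u = {a}) ∧
        Conn H {v | v ∈ A ∧ ℓ v = {a}} u v) from this.1
  induction h with
  | refl => exact ⟨subset_ballIn hx, .inl ⟨x, hx, Near.refl _ _⟩⟩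
  | @tail v v' _ e ih =>
    obtain ⟨hv, hinv⟩ := ih
    have hnear : NearSet G R ((j + 1) * W) v' := by
      rcases hinv with h | ⟨u, hu, -, huv⟩
      · exact (h.trans (hK _ _ e.1.symm)).mono (by omega)
      · exact (hu.trans ((hK _ _ e.1.symm).trans (hk _ _ _ huv.symm))).mono (by omega)
    have hv'b := mem_ballIn_of_adj hRA hv e.1 ⟨e.2.2.1, hnear.mono hnW⟩
    refine ⟨hv'b, ?_⟩
    by_cases hlow : NearSet G R (j * W) v'
    · exact .inl hlow
    have h1 : (ℓ v').card = 1 := by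
      by_contra h1
      exact hb v' e.2.2.1 hnear hlow h1 (hcc₁ v' hv'b ▸ e.2.2.2)
    have hv' : ℓ v' = {a} := by
      obtain ⟨β, hβ⟩ := Finset.card_eq_one.1 h1
      have := hc v' e.2.2.1
      rw [hβ, Finset.mem_singleton, e.2.2.2] at this
      rw [hβ, this]
    rcases hinv with h | ⟨u, hu, hua, huv⟩
    · exact .inr ⟨v', (h.trans (hK _ _ e.1.symm)).mono (by omega), ⟨e.2.2.1, hv'⟩, .refl⟩
    · exact .inr ⟨u, hu, hua, huv.tail ⟨e.1, huv.mem_right hua, e.2.2.1, hv'⟩⟩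

end Blocking

/-! ### Gluing colorings of the cones to a coloring of the kept part -/

section Glue

variable {V : Type u} {ι : Type v} {G : SimpleGraph V} {D : RTD V ι}
  {L : V → Finset ℕ} {m r k θ : ℕ} {A : Set V} {C : Set ι} {ρ : ι} {H : SimpleGraph V}
  {ℓ : V → Finset ℕ} {K d : ℕ} {B : Set V} {T : Set ι} {c c₁ : V → ℕ}

/-- The coloring `c` of `A` arises from `c₁` by recoloring inside the cones at `Φ`, so that no
monochromatic component leaves the ball around an adhesion set that it meets. -/
structure Glued (G : SimpleGraph V) (D : RTD V ι) (A : Set V) (H : SimpleGraph V)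
    (ℓ : V → Finset ℕ) (d W : ℕ) (Φ : Set ι) (c₁ c : V → ℕ) : Prop where
  mem_list : ∀ v ∈ A, c v ∈ ℓ v
  mem_list₁ : ∀ v ∈ A, c₁ v ∈ ℓ v
  eq_kept : ∀ v ∈ kept D A Φ, c v = c₁ v
  eq_near : ∀ t ∈ Φ, ∀ v ∈ coneBall G D A H d t, NearSet G (D.adh t ∩ A) W v → c v = c₁ v
  mem_ball : ∀ t ∈ Φ, ∀ x ∈ D.adh t ∩ A, ∀ v,
    Conn H {v | v ∈ cone D A t ∧ c v = c x} x v → v ∈ coneBall G D A H d t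

/-- The graph `cutGraph` together with the edges of `H` between kept vertices. -/
def glueGraph (G : SimpleGraph V) (D : RTD V ι) (A : Set V) (H : SimpleGraph V)
    (ℓ : V → Finset ℕ) (d : ℕ) (B : Set V) (Φ : Set ι) : SimpleGraph V :=
  cutGraph G D A H ℓ d B Φ ⊔
    SimpleGraph.fromRel fun u v => u ∈ kept D A Φ ∧ v ∈ kept D A Φ ∧ H.Adj u v

/-- Every monochromatic component that starts at a kept vertex is traced by `glueGraph`. -/
theorem Glued.conn (hD : D.IsTDOn G Set.univ) (hR : Region G D L m r k A C ρ H ℓ K)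
    (hT : Cut D A C ρ B T) (hg : Glued G D A H ℓ d (k + 2 * K) (D.boundary T ∩ C) c₁ c)
    {a : ℕ} {u v : V} (hu : u ∈ kept D A (D.boundary T ∩ C))
    (h : Conn H {v | v ∈ A ∧ c v = a} u v) :
    (v ∈ kept D A (D.boundary T ∩ C) →
      Conn (glueGraph G D A H ℓ d B (D.boundary T ∩ C))
        {v | v ∈ cutSet G D A H d B (D.boundary T ∩ C) ∪ B ∧ c₁ v = a} u v) ∧
    ∀ t ∈ D.boundary T ∩ C, v ∈ D.below t → ∃ x ∈ D.adh t ∩ A,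
      Conn (glueGraph G D A H ℓ d B (D.boundary T ∩ C))
        {v | v ∈ cutSet G D A H d B (D.boundary T ∩ C) ∪ B ∧ c₁ v = a} u x ∧
      c x = a ∧ Conn H {v | v ∈ cone D A t ∧ c v = a} x v ∧
      ((∃ y, H.Adj x y ∧ y ∈ A ∧ y ∈ D.below t ∧ ℓ y = {a} ∧
          Conn H {p | p ∈ A ∧ p ∈ D.below t ∧ ℓ p = {a}} y v) ∨
        ∃ g, g ∈ D.below t ∧ g ∈ coneBall G D A H d t ∧ (ℓ g).card ≠ 1 ∧ c₁ g = a ∧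
          Conn (glueGraph G D A H ℓ d B (D.boundary T ∩ C))
            {v | v ∈ cutSet G D A H d B (D.boundary T ∩ C) ∪ B ∧ c₁ v = a} u g ∧
          Conn H (coneBall G D A H d t) g v) := by
  set Φ := D.boundary T ∩ C with hΦ
  set S := {v | v ∈ cutSet G D A H d B Φ ∪ B ∧ c₁ v = a} with hS
  set J := glueGraph G D A H ℓ d B Φ with hJ
  have kept_mem : ∀ v ∈ kept D A Φ, c v = a → v ∈ S := fun v hv hva => by
    refine ⟨?_, hg.eq_kept v hv ▸ hva⟩
    by_cases hB : v ∈ B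
    · exact .inr hB
    · exact .inl (.inl ⟨hv, hB⟩)
  have adh_kept : ∀ t ∈ Φ, ∀ x ∈ D.adh t ∩ A, x ∈ kept D A Φ := fun t ht x hx =>
    (hT.mem_kept_of_mem_adh hD ht hx.2 hx.1).1
  have link : ∀ t ∈ Φ, ∀ x ∈ D.adh t ∩ A, ∀ g, g ∈ D.below t → Link G D A H ℓ d Φ x g →
      J.Adj x g := fun t ht x hx g hgt h => by
    refine .inl (cutGraph_adj_of_link h ?_)
    rintro rfl
    exact RTD.not_mem_below_of_mem_adh hD ht.1.2.1 hx.1 hgt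
  have gad_mem : ∀ t ∈ Φ, ∀ g, g ∈ D.below t → g ∈ coneBall G D A H d t → c₁ g = a → g ∈ S :=
    fun t ht g hgt hgb hga => ⟨.inl (.inr ⟨t, ht, hgt, hgb⟩), hga⟩
  have conn_ball : ∀ t ∈ Φ, ∀ x ∈ D.adh t ∩ A, c x = a → ∀ v,
      Conn H {v | v ∈ cone D A t ∧ c v = a} x v → Conn H (coneBall G D A H d t) x v :=
    fun t ht x hx hxa v h =>
      h.reachable_set.mono fun p hp => hg.mem_ball t ht x hx p (by rw [hxa]; exact hp)
  have single : ∀ v ∈ A, c v = a → (ℓ v).card = 1 → ℓ v = {a} := fun v hv hva h1 => by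
    obtain ⟨β, hβ⟩ := Finset.card_eq_one.1 h1
    have := hg.mem_list v hv
    rw [hβ, Finset.mem_singleton, hva] at this
    rw [hβ, this]
  have enter : ∀ t ∈ Φ, ∀ x ∈ D.adh t ∩ A, Conn J S u x → c x = a → ∀ g, g ∈ D.below t →
      Conn H {v | v ∈ cone D A t ∧ c v = a} x g → g ∈ A → c g = a → (ℓ g).card ≠ 1 →
      NearSet G (D.adh t ∩ A) (k + 2 * K) g →
      ∃ g', g' ∈ D.below t ∧ g' ∈ coneBall G D A H d t ∧ (ℓ g').card ≠ 1 ∧ c₁ g' = a ∧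
        Conn J S u g' ∧ Conn H (coneBall G D A H d t) g' g := by
    intro t ht x hx hux hxa g hgt hxg hgA hga hg1 hnear
    have hxb := conn_ball t ht x hx hxa g hxg
    have hgb : g ∈ coneBall G D A H d t := hxb.mem_right (subset_ballIn hx)
    have hga' : c₁ g = a := hg.eq_near t ht g hgb hnear ▸ hga
    exact ⟨g, hgt, hgb, hg1, hga', hux.tail ⟨link t ht x hx g hgt
      ⟨t, ht, hx.1, hx.2, hgt, hgb, .inl ⟨hg1, hxb⟩⟩,
      kept_mem x (adh_kept t ht x hx) hxa, gad_mem t ht g hgt hgb hga'⟩, .refl⟩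
  have hC : ∀ t ∈ Φ, ∀ v v', v ∈ D.below t → v ∈ A → v' ∈ A → H.Adj v v' →
      v' ∈ D.below t ∨ v' ∈ D.adh t := fun t ht v v' hv hvA hv'A h =>
    hR.mem_below_or_adh_of_adj hD ht.2 (hT.ne ht) hv hvA hv'A h
  induction h with
  | refl => exact ⟨fun _ => .refl, fun t ht hut => absurd hut (hu.2 t ht)⟩
  | @tail v v' _ e ih =>
    obtain ⟨hadj, ⟨hvA, hva⟩, hv'A, hv'a⟩ := e
    by_cases hv : v ∈ kept D A Φ
    · have huv := ih.1 hv
      refine ⟨fun hv' => huv.tail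
        ⟨.inr ⟨hadj.ne, .inl ⟨hv, hv', hadj⟩⟩, kept_mem v hv hva, kept_mem v' hv' hv'a⟩,
        fun t ht hv't => ?_⟩
      have hvt : v ∈ D.adh t ∩ A :=
        ⟨(hC t ht v' v hv't hv'A hvA hadj.symm).resolve_left (hv.2 t ht), hvA⟩
      have hvv' : Conn H {v | v ∈ cone D A t ∧ c v = a} v v' :=
        Conn.single hadj ⟨⟨hvA, .inr hvt.1⟩, hva⟩ ⟨⟨hv'A, .inl hv't⟩, hv'a⟩
      refine ⟨v, hvt, huv, hva, hvv', ?_⟩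
      by_cases h1 : (ℓ v').card = 1
      · exact .inl ⟨v', hadj, hv'A, hv't, single v' hv'A hv'a h1, .refl⟩
      · exact .inr (enter t ht v hvt huv hva v' hv't hvv' hv'A hv'a h1
          ⟨v, hvt, (hR.jump _ _ hadj.symm).mono (by omega)⟩)
    · obtain ⟨t, ht, hvt⟩ : ∃ t ∈ Φ, v ∈ D.below t := by
        by_contra! hcon
        exact hv ⟨hvA, hcon⟩
      obtain ⟨x, hx, hux, hxa, hxv, hcase⟩ := ih.2 t ht hvt
      have hvb : Conn H (coneBall G D A H d t) x v := conn_ball t ht x hx hxa v hxv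
      have hvball : v ∈ coneBall G D A H d t := hvb.mem_right (subset_ballIn hx)
      rcases hC t ht v v' hvt hvA hv'A hadj with hv't | hv't
      · refine ⟨fun h => absurd hv't (h.2 t ht), fun t' ht' hv't' => ?_⟩
        obtain rfl := hT.eq_of_mem_below hD ht.1 ht'.1 hv't hv't'
        have hxv' := hxv.tail ⟨hadj, ⟨⟨hvA, .inl hvt⟩, hva⟩, ⟨hv'A, .inl hv't⟩, hv'a⟩
        have hv'ball : v' ∈ coneBall G D A H d t :=
          (conn_ball t ht x hx hxa v' hxv').mem_right (subset_ballIn hx)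
        refine ⟨x, hx, hux, hxa, hxv', ?_⟩
        rcases hcase with ⟨y, hxy, hyA, hyt, hy, hyv⟩ | ⟨g, hgt, hgb, hg1, hga, hug, hgv⟩
        · have hv1 := (hyv.mem_right (by exact ⟨hyA, hyt, hy⟩)).2.2
          by_cases h1 : (ℓ v').card = 1
          · exact .inl ⟨y, hxy, hyA, hyt, hy, hyv.tail
              ⟨hadj, ⟨hvA, hvt, hv1⟩, hv'A, hv't, single v' hv'A hv'a h1⟩⟩
          · refine .inr (enter t ht x hx hux hxa v' hv't hxv' hv'A hv'a h1 ⟨x, hx, ?_⟩)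
            have hyv' : Near G k y v := hR.single a y v (hyv.mono fun p hp => ⟨hp.1, hp.2.2⟩)
            exact (((hR.jump _ _ hadj.symm).trans hyv'.symm).trans
              (hR.jump _ _ hxy.symm)).mono (by omega)
        · exact .inr ⟨g, hgt, hgb, hg1, hga, hug, hgv.tail ⟨hadj, hvball, hv'ball⟩⟩
      · have hv'R : v' ∈ D.adh t ∩ A := ⟨hv't, hv'A⟩
        have hv'k := adh_kept t ht v' hv'R
        refine ⟨fun _ => ?_, fun t' ht' h => absurd h (hv'k.2 t' ht')⟩
        have hv'S := kept_mem v' hv'k hv'a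
        have hv'b : v' ∈ coneBall G D A H d t := subset_ballIn hv'R
        rcases hcase with ⟨y, hxy, hyA, hyt, hy, hyv⟩ | ⟨g, hgt, hgb, hg1, hga, hug, hgv⟩
        · have hv1 := (hyv.mem_right (by exact ⟨hyA, hyt, hy⟩)).2.2
          have hva₁ : c₁ v = a := by
            have := hg.mem_list₁ v hvA
            rwa [hv1, Finset.mem_singleton] at this
          have hvS := gad_mem t ht v hvt hvball hva₁
          have hxS := kept_mem x (adh_kept t ht x hx) hxa
          exact (hux.tail ⟨link t ht x hx v hvt ⟨t, ht, hx.1, hx.2, hvt, hvball,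
            .inr ⟨a, y, hv1, hxy, hyA, hyt, hy, hyv⟩⟩, hxS, hvS⟩).tail
            ⟨(link t ht v' hv'R v hvt ⟨t, ht, hv't, hv'A, hvt, hvball,
              .inr ⟨a, v, hv1, hadj.symm, hvA, hvt, hv1, .refl⟩⟩).symm, hvS, hv'S⟩
        · refine hug.tail ⟨(link t ht v' hv'R g hgt ⟨t, ht, hv't, hv'A, hgt, hgb,
            .inl ⟨hg1, ?_⟩⟩).symm, gad_mem t ht g hgt hgb hga, hv'S⟩
          exact Conn.symm (hgv.tail ⟨hadj, hvball, hv'b⟩)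

/-- If `c₁` agrees with a bounded coloring `c₀` away from `R`, then it is bounded. -/
theorem glueGraph_near [Finite V] (hD : D.IsTDOn G Set.univ)
    (hθ : ∀ t, t ≠ D.root → (D.adh t).ncard ≤ θ) (hR : Region G D L m r k A C ρ H ℓ K)
    (hT : Cut D A C ρ B T) {R : Set V} (hRθ : R.ncard ≤ θ) (hBR : ∀ b ∈ B, NearSet G R d b)
    {P : V → Finset ℕ} {c₀ : V → ℕ} {E M : ℕ} (hM : θ * (2 * d + K) + K + k = M)
    (hc₀ : ∀ v ∈ cutSet G D A H d B (D.boundary T ∩ C),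
      c₀ v ∈ cutList G D A ℓ P (r + k) B (D.boundary T ∩ C) v)
    (hE : BoundedOn G (cutGraph G D A H ℓ d B (D.boundary T ∩ C))
      (cutSet G D A H d B (D.boundary T ∩ C)) c₀ E)
    (hc₁ : ∀ v ∉ B, c₀ v ∈ ℓ v → c₁ v = c₀ v) {a : ℕ} {u v : V}
    (h : Conn (glueGraph G D A H ℓ d B (D.boundary T ∩ C))
        {v | v ∈ cutSet G D A H d B (D.boundary T ∩ C) ∪ B ∧ c₁ v = a} u v) :
    Near G (θ * (2 * (E + M + (r + k + d)) + M) + E) u v := by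
  set Φ := D.boundary T ∩ C with hΦ
  set S := {v | v ∈ cutSet G D A H d B Φ ∪ B ∧ c₁ v = a} with hS
  set J := glueGraph G D A H ℓ d B Φ with hJ
  have hJM : ∀ u v, J.Adj u v → Near G M u v := by
    rintro u v (h | ⟨-, h | h⟩)
    · exact hM ▸ cutGraph_near hD hθ hR hT h
    · exact (hR.jump _ _ h.2.2).mono (by omega)
    · exact (hR.jump _ _ h.2.2.symm).mono (by omega)
  let far : V → Prop := fun v => v ∈ B ∨ c₁ v ≠ c₀ v
  have hfar : ∀ v ∈ S, far v → NearSet G R (r + k + d) v := by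
    intro v hv hfv
    by_cases hB : v ∈ B
    · exact (hBR v hB).mono (by omega)
    have hvc := hv.1.resolve_right hB
    have hlist : ∃ b ∈ B, Near G (r + k) v b := by
      by_contra hcon
      have := hc₀ v hvc
      rw [cutList, if_neg fun h => hcon h.2] at this
      exact (hfv.resolve_left hB) (hc₁ v hB this)
    obtain ⟨b, hb, hvb⟩ := hlist
    exact (hBR b hb).trans hvb
  have hnear : ∀ u v, Conn J {p | p ∈ S ∧ ¬ far p} u v → Near G E u v := by
    intro u v h
    refine hE a u v (h.lift fun p q hpq hp hq => ?_)
    have hmem : ∀ p ∈ S, ¬ far p → p ∉ B ∧ p ∈ cutSet G D A H d B Φ ∧ c₀ p = a := by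
      intro p hp hfp
      simp only [far, not_or, not_not] at hfp
      exact ⟨hfp.1, hp.1.resolve_right hfp.1, hfp.2 ▸ hp.2⟩
    have hp' := hmem p hp.1 hp.2
    have hq' := hmem q hq.1 hq.2
    refine ⟨?_, hp'.2, hq'.2⟩
    rcases hpq with h | ⟨hne, h | h⟩
    · exact h
    · exact ⟨hne, .inl (.inl ⟨⟨h.1, hp'.1⟩, ⟨h.2.1, hq'.1⟩, h.2.2⟩)⟩
    · exact ⟨hne, .inr (.inl ⟨⟨h.1, hq'.1⟩, ⟨h.2.1, hp'.1⟩, h.2.2⟩)⟩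
  by_cases hu : u ∈ S
  swap
  · cases h.symm with
    | refl => exact Near.refl _ _
    | tail _ h => exact absurd h.2.2 hu
  rcases h.last_visit hu far with ⟨-, -, h⟩ | ⟨x, hx, hfx, hux, -⟩
  · exact (hnear u v h).mono (by omega)
  · have hcov : ∀ p ∈ {p | Conn J S u p}, ∃ y ∈ R.toFinite.toFinset,
        Near G (E + M + (r + k + d)) p y := by
      intro p hp
      suffices NearSet G R (E + M + (r + k + d)) p by
        obtain ⟨y, hy, h⟩ := this
        exact ⟨y, by simpa using hy, h⟩
      rcases (hux.symm.trans hp).last_visit hx far with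
        ⟨h, -⟩ | ⟨z, hz, hfz, -, rfl | ⟨w, -, -, hzw, hwp⟩⟩
      · exact absurd hfx h
      · exact (hfar _ hz hfz).mono (by omega)
      · exact (hfar _ hz hfz).trans ((hnear _ _ hwp).symm.trans (hJM _ _ hzw.symm))
    have := Conn.near_of_cover R.toFinite.toFinset {p | Conn J S u p}
      (fun p _ q _ => hJM p q) hcov u v .refl h.reachable_set
    rw [← Set.ncard_eq_toFinset_card R] at this
    exact (this.mono (Nat.mul_le_mul_right _ hRθ)).mono (by omega)

end Glue

/-! ### The inductive construction -/

section Extension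

variable {V : Type u} {ι : Type v} {G : SimpleGraph V} {D : RTD V ι}
  {L : V → Finset ℕ} {m s r k N θ : ℕ} {A : Set V} {C : Set ι} {ρ : ι} {H : SimpleGraph V}
  {ℓ : V → Finset ℕ} {K d : ℕ} {B : Set V} {T : Set ι} {c c₁ : V → ℕ}

/-- If precolorings of the balls around the adhesion sets extend to the cones, then every
coloring of the kept part can be glued to colorings of the cones. -/
theorem Region.exists_glued [Finite V] (hD : D.IsTDOn G Set.univ)
    (hθ : ∀ t, t ≠ D.root → (D.adh t).ncard ≤ θ) (hR : Region G D L m r k A C ρ H ℓ K)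
    (hT : Cut D A C ρ B T) (hd : (θ + 1) * (k + 2 * K) = d) (hc₁ : ∀ v ∈ A, c₁ v ∈ ℓ v) {F : ℕ}
    (hext : ∀ t ∈ D.boundary T ∩ C, ∀ p : V → ℕ, (∀ v ∈ cone D A t, p v ∈ ℓ v) →
      ∃ c : V → ℕ, (∀ v ∈ cone D A t, c v ∈ ℓ v) ∧
        (∀ v ∈ coneBall G D A H d t, c v = p v) ∧ BoundedOn G H (cone D A t) c F) :
    ∃ c, Glued G D A H ℓ d (k + 2 * K) (D.boundary T ∩ C) c₁ c ∧
      ∀ t ∈ D.boundary T ∩ C, BoundedOn G H (cone D A t) c F := by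
  classical
  set Φ := D.boundary T ∩ C with hΦ
  have hR' : ∀ t ∈ Φ, (D.adh t ∩ A).ncard ≤ θ := fun t ht =>
    (Set.ncard_le_ncard Set.inter_subset_left).trans (hθ t ht.1.2.1)
  have hp : ∀ t : Φ, ∃ p : V → ℕ, (∀ v ∈ cone D A t, p v ∈ ℓ v) ∧
      (∀ v, NearSet G (D.adh t ∩ A) (k + 2 * K) v → p v = c₁ v) ∧
      ∀ x ∈ D.adh t ∩ A, ∃ j, 1 ≤ j ∧ j ≤ θ ∧
        Blocks G (cone D A t) (D.adh t ∩ A) ℓ p (k + 2 * K) j (c₁ x) := fun t =>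
    exists_blocking (hR' t t.2) fun v hv => hc₁ v hv.1
  choose p hpl hpn hpb using hp
  choose cc hcl hcp hcb using fun t : Φ => hext t t.2 (p t) (hpl t)
  let c : V → ℕ := fun v => if h : ∃ t : Φ, v ∈ D.below t then cc h.choose v else c₁ v
  have c_below : ∀ t : Φ, ∀ v ∈ D.below t, c v = cc t v := fun t v hv => by
    have h : ∃ t : Φ, v ∈ D.below t := ⟨t, hv⟩
    have := hT.eq_of_mem_below hD h.choose.2.1 t.2.1 h.choose_spec hv
    simp only [c, dif_pos h, Subtype.ext this]
  have c_kept : ∀ v ∈ kept D A Φ, c v = c₁ v := fun v hv =>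
    dif_neg fun ⟨t, h⟩ => hv.2 t t.2 h
  have adh_kept : ∀ t : Φ, ∀ x ∈ D.adh t ∩ A, x ∈ kept D A Φ := fun t x hx =>
    (hT.mem_kept_of_mem_adh hD t.2 hx.2 hx.1).1
  have c_adh : ∀ t : Φ, ∀ x ∈ D.adh t ∩ A, c x = cc t x := fun t x hx => by
    rw [c_kept x (adh_kept t x hx), hcp t x (subset_ballIn hx), hpn t x ⟨x, hx, Near.refl _ _⟩]
  have c_cone : ∀ t : Φ, ∀ v ∈ cone D A t, c v = cc t v := by
    rintro t v ⟨hvA, hv | hv⟩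
    · exact c_below t v hv
    · exact c_adh t v ⟨hv, hvA⟩
  have conn : ∀ (t : Φ) {a : ℕ} {u v : V}, Conn H {v | v ∈ cone D A t ∧ c v = a} u v →
      Conn H {v | v ∈ cone D A t ∧ cc t v = a} u v := fun t a u v h =>
    h.lift fun x y e hx hy =>
      ⟨e, ⟨hx.1, c_cone t x hx.1 ▸ hx.2⟩, hy.1, c_cone t y hy.1 ▸ hy.2⟩
  refine ⟨c, ⟨fun v hv => ?_, hc₁, c_kept, fun t ht v hv hvn => ?_, fun t ht x hx v h => ?_⟩,
    fun t ht a u v h => hcb ⟨t, ht⟩ a u v (conn ⟨t, ht⟩ h)⟩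
  · by_cases hk : v ∈ kept D A Φ
    · exact c_kept v hk ▸ hc₁ v hv
    · obtain ⟨t, ht, hvt⟩ : ∃ t ∈ Φ, v ∈ D.below t := by
        by_contra! hcon
        exact hk ⟨hv, hcon⟩
      exact c_below ⟨t, ht⟩ v hvt ▸ hcl ⟨t, ht⟩ v ⟨hv, .inl hvt⟩
  · rw [c_cone ⟨t, ht⟩ v (coneBall_subset_cone hv), hcp ⟨t, ht⟩ v hv, hpn ⟨t, ht⟩ v hvn]
  · obtain ⟨j, -, hj, hb⟩ := hpb ⟨t, ht⟩ x hx
    rw [← c_kept x (adh_kept ⟨t, ht⟩ x hx)] at hb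
    subst hd
    exact mem_ballIn_of_blocks adh_inter_subset_cone (hcl ⟨t, ht⟩) (hcp ⟨t, ht⟩) hR.jump
      (fun α a b h => hR.single α a b (h.mono fun v hv => ⟨hv.1.1, hv.2⟩)) hj hb hx
      (conn ⟨t, ht⟩ h)

/-- The glued coloring is bounded if it is bounded on the traces of `glueGraph` and on cones. -/
theorem Glued.boundedOn [Finite V] (hD : D.IsTDOn G Set.univ)
    (hθ : ∀ t, t ≠ D.root → (D.adh t).ncard ≤ θ) (hR : Region G D L m r k A C ρ H ℓ K)
    (hT : Cut D A C ρ B T) (hg : Glued G D A H ℓ d (k + 2 * K) (D.boundary T ∩ C) c₁ c)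
    {F F' M : ℕ} (hM : θ * (2 * d + K) ≤ M)
    (hF : ∀ a u v, Conn (glueGraph G D A H ℓ d B (D.boundary T ∩ C))
        {v | v ∈ cutSet G D A H d B (D.boundary T ∩ C) ∪ B ∧ c₁ v = a} u v → Near G F u v)
    (hFF' : 2 * (F + M) ≤ F')
    (hcone : ∀ t ∈ D.boundary T ∩ C, BoundedOn G H (cone D A t) c F') :
    BoundedOn G H A c F' := by
  set Φ := D.boundary T ∩ C with hΦ
  intro a u v h
  have mem_of_conn : ∀ {p q}, p ∈ A → Conn H {v | v ∈ A ∧ c v = a} p q → q ∈ A := by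
    intro p q hp h
    cases h with
    | refl => exact hp
    | tail _ e => exact e.2.2.1
  have below_of : ∀ q ∈ A, q ∉ kept D A Φ → ∃ t ∈ Φ, q ∈ D.below t := fun q hqA hqk => by
    by_contra! hcon
    exact hqk ⟨hqA, hcon⟩
  have key : ∀ p ∈ kept D A Φ, ∀ q, Conn H {v | v ∈ A ∧ c v = a} p q → Near G (F + M) p q := by
    intro p hp q hpq
    obtain ⟨h1, h2⟩ := hg.conn hD hR hT hp hpq
    by_cases hq : q ∈ kept D A Φ
    · exact (hF a p q (h1 hq)).mono (by omega)
    · obtain ⟨t, ht, hqt⟩ := below_of q (mem_of_conn hp.1 hpq) hq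
      obtain ⟨x, hx, hpx, hxa, hxq, -⟩ := h2 t ht hqt
      have hball : Conn H (coneBall G D A H d t) x q :=
        hxq.reachable_set.mono fun y hy => hg.mem_ball t ht x hx y (by rw [hxa]; exact hy)
      exact (hF a p x hpx).trans
        ((near_of_conn_coneBall hθ ht.1.2.1 hR (subset_ballIn hx) hball).mono hM)
  by_cases hk : ∃ p ∈ kept D A Φ, Conn H {v | v ∈ A ∧ c v = a} u p
  · obtain ⟨p, hp, hup⟩ := hk
    exact ((key p hp u hup.symm).symm.trans (key p hp v (hup.symm.trans h))).mono (by omega)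
  · push Not at hk
    by_cases huA : u ∈ A
    swap
    · cases h.symm with
      | refl => exact Near.refl _ _
      | tail _ e => exact absurd e.2.2.1 huA
    obtain ⟨t, ht, hut⟩ := below_of u huA fun h => hk u h .refl
    suffices v ∈ D.below t ∧ Conn H {v | v ∈ cone D A t ∧ c v = a} u v from
      hcone t ht a u v this.2
    induction h with
    | refl => exact ⟨hut, .refl⟩
    | @tail p q hup e ih =>
      obtain ⟨hpt, hp⟩ := ih
      have hqt : q ∈ D.below t := by
        refine (hR.mem_below_or_adh_of_adj hD ht.2 (hT.ne ht) hpt e.2.1.1 e.2.2.1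
          e.1).resolve_right fun hq => hk q ?_ (hup.tail e)
        exact (hT.mem_kept_of_mem_adh hD ht e.2.2.1 hq).1
      exact ⟨hqt, hp.tail ⟨e.1, ⟨⟨e.2.1.1, .inl hpt⟩, e.2.1.2⟩, ⟨e.2.2.1, .inl hqt⟩, e.2.2.2⟩⟩

/-- The weak diameter bound for regions with adhesion less than `q` and jumps of length `K`. -/
def weakDiamBound (θ r k N : ℕ) : ℕ → ℕ → ℕ
  | 0, K => N * K
  | q + 1, K =>
    let d := (θ + 1) * (k + 2 * K)
    let M := θ * (2 * d + K) + K + k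
    let E := weakDiamBound θ r k N q M
    2 * (θ * (2 * (E + M + (r + k + d)) + M) + E + M)

variable [Finite V] [Finite ι]

/-- A precoloring of a ball around a few vertices of the root bag extends to a region, if regions
of smaller adhesion can be colored. -/
theorem Region.exists_extension (hD : D.IsTDOn G Set.univ)
    (hθ : ∀ t, t ≠ D.root → (D.adh t).ncard ≤ θ) (hm : 2 ≤ m) (hne : ∀ v, (L v).Nonempty)
    (hL : LegitOn G D Set.univ L m s r k) {q d M E : ℕ} (hd : (θ + 1) * (k + 2 * K) = d)
    (hM : θ * (2 * d + K) + K + k = M)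
    (hE : ∀ {A : Set V} {C : Set ι} {ρ : ι} {H : SimpleGraph V} {ℓ : V → Finset ℕ},
      Region G D L m r k A C ρ H ℓ M → (∀ t ∈ C, t ≠ ρ → (D.adh t ∩ A).ncard < q) →
      ∃ c : V → ℕ, (∀ v ∈ A, c v ∈ ℓ v) ∧ BoundedOn G H A c E)
    (hR : Region G D L m r k A C ρ H ℓ K)
    (hq : ∀ t ∈ C, t ≠ ρ → (D.adh t ∩ A).ncard < q + 1)
    {R : Set V} (hRA : R ⊆ A) (hRρ : R ⊆ D.bag ρ) (hRθ : R.ncard ≤ θ) {b : V → ℕ}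
    (hb : ∀ v ∈ ballIn G H A R d, b v ∈ ℓ v) :
    ∃ c : V → ℕ, (∀ v ∈ A, c v ∈ ℓ v) ∧ (∀ v ∈ ballIn G H A R d, c v = b v) ∧
      BoundedOn G H A c (2 * (θ * (2 * (E + M + (r + k + d)) + M) + E + M)) := by
  classical
  induction hn : C.ncard using Nat.strong_induction_on generalizing A C ρ R b with
  | _ n ih =>
  subst hn
  obtain ⟨P, hP⟩ := exists_mono_lists (by omega) hL
  obtain ⟨T, hT⟩ := hR.exists_cut (d := d) hD hRA hRρ
  set B := ballIn G H A R d with hB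
  obtain ⟨c₀, hc₀, hc₀E⟩ := hE (hM ▸ hR.cut (d := d) hD hθ hm hP hT) fun t ht htρ =>
    hT.ncard_adh_inter_lt ht htρ (hq t (hT.subset ht) htρ)
  choose e he using hne
  let c₁ : V → ℕ := fun v => if v ∈ B then b v else if c₀ v ∈ ℓ v then c₀ v else e v
  have hc₁B : ∀ v ∈ B, c₁ v = b v := fun v hv => if_pos hv
  have hc₁ : ∀ v ∈ A, c₁ v ∈ ℓ v := fun v hv => by
    simp only [c₁]
    split_ifs with h1 h2
    · exact hb v h1
    · exact h2
    · exact hR.subset_list v hv (he v)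
  obtain ⟨c, hg, hcone⟩ := hR.exists_glued hD hθ hT hd hc₁ fun t ht p hp =>
    have htρ := hT.ne ht
    ih {s | s ∈ C ∧ D.Anc t s}.ncard
      (Set.ncard_lt_ncard ⟨fun s hs => hs.1, fun h => htρ ((h hR.subtree.root_mem).2.antisymm hD.1
        (hR.subtree.anc t ht.2))⟩)
      (hR.restrict hD ht.2 htρ)
      (fun s hs _ => (Set.ncard_le_ncard (Set.inter_subset_inter_right _ fun v hv => hv.1)).trans_lt
        (hq s hs.1 fun hsρ => htρ ((hsρ ▸ hs.2).antisymm hD.1 (hR.subtree.anc t ht.2))))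
      adh_inter_subset_cone (fun v hv => hv.1.2)
      ((Set.ncard_le_ncard Set.inter_subset_left).trans (hθ t ht.1.2.1))
      (fun v hv => hp v (coneBall_subset_cone hv)) rfl
  refine ⟨c, hg.mem_list, fun v hv => ?_, hg.boundedOn hD hθ hR hT (M := M) (by omega)
    (fun a u v h => glueGraph_near hD hθ hR hT hRθ (fun v hv => (ballIn_subset_collar hRA hv).2)
      hM hc₀ hc₀E (fun v hv h => ?_) h) le_rfl hcone⟩
  · rw [hg.eq_kept v (hT.subset_kept hv), hc₁B v hv]
  · simp only [c₁, if_neg hv, if_pos h]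

/-- Regions of adhesion less than `q` can be colored. -/
theorem Region.exists_coloring (hD : D.IsTDOn G Set.univ)
    (hθ : ∀ t, t ≠ D.root → (D.adh t).ncard ≤ θ) (hs : θ ≤ s) (hm : 2 ≤ m)
    (hne : ∀ v, (L v).Nonempty) (hL : HeredExtOn G D Set.univ L m s r k N) {q : ℕ}
    (hR : Region G D L m r k A C ρ H ℓ K)
    (hq : ∀ t ∈ C, t ≠ ρ → (D.adh t ∩ A).ncard < q) :
    ∃ c : V → ℕ, (∀ v ∈ A, c v ∈ ℓ v) ∧ BoundedOn G H A c (weakDiamBound θ r k N q K) := by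
  induction q generalizing A C ρ H ℓ K with
  | zero =>
    exact hR.exists_coloring_of_eq_root hD hθ hs hm hne hL fun t ht => by
      by_contra h
      exact absurd (hq t ht h) (by omega)
  | succ q ih =>
    obtain ⟨c, hc, -, hcF⟩ := hR.exists_extension hD hθ hm hne hL.1 rfl rfl ih hq
      (Set.empty_subset A) (Set.empty_subset _) (by simp) (b := 0)
      (by rintro v ⟨x, hx, -⟩; exact absurd hx (Set.notMem_empty x))
    exact ⟨c, hc, hcF⟩

end Extension

/-! ### The region of a construction -/

section Construction

variable {V : Type u} {ι : Type v} {G : SimpleGraph V} {D : RTD V ι}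
  {L : V → Finset ℕ} {m s r k η θ : ℕ}

theorem IsConstruction.ncard_adh_le (hG : IsConstruction G D η θ) :
    ∀ t, t ≠ D.root → (D.adh t).ncard ≤ θ := fun _ ht =>
  hG.2.1 _ _ (RTD.isChild_par hG.1.1 ht).1

/-- A node with a large adhesion set to its parent is a leaf with small components. -/
theorem IsConstruction.leaf (hG : IsConstruction G D η θ) {t : ι} (ht : t ≠ D.root)
    (hη : η < (D.adh t).ncard) :
    (∀ z, ¬ D.IsChild t z) ∧ SmallCompsOn G (D.bag t \ D.bag (D.par t)) := by
  have h := RTD.isChild_par hG.1.1 ht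
  exact (hG.2.2.1 _ _ h.1 hη).resolve_right fun h' => h'.1 t h

theorem IsConstruction.region (hG : IsConstruction G D η θ) (hL : LegitOn G D Set.univ L m s r k) :
    Region G D L m r k Set.univ {t | t ≠ D.root → (D.adh t).ncard ≤ η} D.root G L 1 where
  subtree :=
    { root_mem := fun h => absurd rfl h
      anc := fun t _ => RTD.root_anc hG.1.1 t
      par_mem := fun t _ ht hp => by
        by_contra! hη
        exact (hG.leaf hp hη).1 t (RTD.isChild_par hG.1.1 ht) }
  jump := fun _ _ => near_of_adj
  core_adj := fun _ _ _ _ _ _ _ _ => Iff.rfl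
  td := fun _ _ _ _ _ _ hu _ _ h => RTD.adj_below hG.1 hu h
  small := fun t ht => by
    have hη : η < (D.adh t).ncard := by
      by_contra! h
      exact ht.1 fun _ => h
    obtain ⟨hleaf, hsmall⟩ := hG.leaf ht.2.1 hη
    have hsub : ∀ v ∈ D.below t, v ∈ D.bag t \ D.bag (D.par t) := fun v hv => by
      refine ⟨?_, fun h => RTD.not_anc_par hG.1.1 ht.2.1 (hv _ h)⟩
      obtain ⟨q, hq⟩ := RTD.exists_mem_bag hG.1 v
      rcases Relation.ReflTransGen.cases_tail (hv q hq) with h | ⟨z, -, hz⟩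
      · exact h ▸ hq
      · exact absurd hz (hleaf z)
    exact fun x y z hx hy hz => hsmall x y z (hsub x hx.1) (hsub y hy.1) (hsub z hz.1)
  subset_list := fun _ _ => subset_rfl
  card_list := hL.1
  good := fun _ _ _ _ _ _ _ _ _ => trivial
  single := fun α a b h => by
    by_cases ha : L a = {α}
    swap
    · cases h.symm with
      | refl => exact Near.refl _ _
      | tail _ e => exact absurd e.2.2.2 ha
    obtain ⟨w, hw⟩ := h.exists_walk ⟨trivial, ha⟩
    classical
    obtain ⟨w', hw', -⟩ := hL.2.2 (fun v => if h : (L v).Nonempty then h.choose else 0)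
      (fun v _ h1 => by
        have h : (L v).Nonempty := Finset.card_pos.1 (by omega)
        simp only [dif_pos h]
        exact h.choose_spec) a b ⟨w, fun v hv => by
        have hv := (hw v hv).2
        exact ⟨⟨trivial, by rw [hv, Finset.card_singleton]⟩, by simp only [hv, ha]⟩⟩
    exact ⟨w', hw'⟩
  cover := fun v _ => by
    obtain ⟨t, ht⟩ := RTD.exists_mem_bag hG.1 v
    exact ⟨t, RTD.root_anc hG.1.1 t, ht⟩

end Construction

/-- **Lemma (main technical lemma).** For all integers `θ ≥ 0`, `s ≥ θ`, `r ≥ 1`,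
`k ≥ 1`, there is a function `f* : ℕ × ℕ → ℕ` such that the following holds. Let
`m ≥ 2` and `N ≥ 4` be integers, let `0 ≤ η ≤ θ`, let `G` be a graph with an
`(η,θ)`-construction `(T,X)` with root `t*`, and let `L` be a hereditarily
`(T,X,m,s,r,k,N)`-extendable list-assignment of `G`. Then for every
`Z ⊆ N_G^{≤(k+2)(θ+1)}[X_{t*}]`, every `L|_Z`-coloring `c_Z` of `G[Z]` can be extended
to an `L`-coloring of `G` with weak diameter in `G` at most `f*(η,N)`. -/
theorem tree_extension_list (θ s r k : ℕ) (hs : θ ≤ s) (hr : 1 ≤ r) (hk : 1 ≤ k) :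
    ∃ f : ℕ → ℕ → ℕ,
      ∀ m N η : ℕ, 2 ≤ m → 4 ≤ N → η ≤ θ →
      ∀ (V : Type u) (ι : Type v) [Fintype V] [Fintype ι],
      ∀ (G : SimpleGraph V) (D : RTD V ι),
        IsConstruction G D η θ →
        ∀ L : V → Finset ℕ,
          (∀ x, (L x).Nonempty) →
          HeredExtOn G D Set.univ L m s r k N →
          ∀ Z : Set V,
            (∀ z ∈ Z, ∃ x ∈ D.bag D.root, ∃ w : G.Walk z x,
              w.length ≤ (k + 2) * (θ + 1)) →
          ∀ cZ : V → ℕ, (∀ v ∈ Z, cZ v ∈ L v) →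
          ∃ c : V → ℕ, (∀ v, c v ∈ L v) ∧ (∀ v ∈ Z, c v = cZ v) ∧
            HasWeakDiamLE G Set.univ c (f η N) := by
  refine ⟨fun η N => weakDiamBound θ r k N (η + 1) 1, ?_⟩
  intro m N η hm _ _ V ι _ _ G D hG L hne hL Z hZ cZ hcZ
  classical
  have hZB : ∀ z ∈ Z, z ∈ ballIn G G Set.univ (D.bag D.root) ((θ + 1) * (k + 2 * 1)) := by
    intro z hz
    obtain ⟨x, hx, w, hw⟩ := hZ z hz
    refine ⟨x, hx, Conn.symm (conn_of_walk w fun v hv => ⟨trivial, x, hx, ?_⟩)⟩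
    refine Near.mono (near_of_mem_support w.reverse (by simpa using hv)).symm ?_
    rw [Walk.length_reverse]
    linarith
  choose e he using hne
  have hR := hG.region hL.1
  obtain ⟨c, hc, hcb, hcF⟩ := hR.exists_extension (q := η) hG.1 hG.ncard_adh_le hm
    (fun v => ⟨e v, he v⟩) hL.1 rfl rfl
    (fun hR hq => hR.exists_coloring hG.1 hG.ncard_adh_le hs hm (fun v => ⟨e v, he v⟩) hL hq)
    (fun t ht htρ => by
      rw [Set.inter_univ]
      exact Nat.lt_succ_of_le (ht htρ))
    (Set.subset_univ _) subset_rfl hG.2.2.2.1 (b := fun v => if v ∈ Z then cZ v else e v)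
    (fun v _ => by
      split_ifs with h
      · exact hcZ v h
      · exact he v)
  refine ⟨c, fun v => hc v trivial, fun v hv => (hcb v (hZB v hv)).trans (if_pos hv), ?_⟩
  rintro a b ⟨w, hw⟩
  obtain ⟨w', hw'⟩ := hcF (c a) a b (conn_of_walk w hw)
  exact (dist_le w').trans hw'
end

section
/- For all positive integers w and k, there exists a positive integer N such that for every graph G of tree-width at most w, every 2-list-assignment L of G, and every pre-L-coloring c_0 of G with weak diameter in G at most k, c_0 can be extended to an L-coloring of G with weak diameter in G at most N. -/
open SimpleGraph

universe u

/-- `(T, X)` is a tree-decomposition of `G`. -/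
def IsTreeDecomp {V : Type*} {ι : Type*} (G : SimpleGraph V) (T : SimpleGraph ι)
    (X : ι → Set V) : Prop :=
  T.IsTree ∧
  (∀ v : V, ∃ t, v ∈ X t) ∧
  (∀ ⦃a b : V⦄, G.Adj a b → ∃ t, a ∈ X t ∧ b ∈ X t) ∧
  (∀ v : V, (T.induce {t | v ∈ X t}).Connected)

/-- `G` has tree-width at most `w`. -/
def TreewidthLE {V : Type*} (G : SimpleGraph V) (w : ℕ) : Prop :=
  ∃ (ι : Type) (_ : Fintype ι) (T : SimpleGraph ι) (X : ι → Set V),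
    IsTreeDecomp G T X ∧ ∀ t, (X t).ncard ≤ w + 1

/-- A rooted tree-decomposition of `G[W]` with root bag `X`, all of whose bags have at most `w`
vertices, where moreover vertices whose neighbourhood lies in a single bag may be attached to
that bag without being counted in it. -/
inductive RootedDecomp {V : Type u} (w : ℕ) (G : SimpleGraph V) : Set V → Set V → Prop
  | bag {X : Set V} : X.ncard ≤ w → RootedDecomp w G X X
  | join {W₁ W₂ X : Set V} : RootedDecomp w G W₁ X → RootedDecomp w G W₂ X → W₁ ∩ W₂ ⊆ X →
      (∀ u ∈ W₁, u ∉ X → ∀ v ∈ W₂, v ∉ X → ¬ G.Adj u v) → RootedDecomp w G (W₁ ∪ W₂) X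
  | move {W X X' : Set V} : RootedDecomp w G W X → X'.ncard ≤ w → W ∩ X' ⊆ X →
      (∀ u ∈ W, u ∉ X' → ∀ v ∈ X', v ∉ W → ¬ G.Adj u v) → RootedDecomp w G (W ∪ X') X'
  | leaf {W X : Set V} {f : V} : RootedDecomp w G W X → f ∉ W →
      (∀ u ∈ W, G.Adj f u → u ∈ X) → RootedDecomp w G (insert f W) X

namespace RootedDecomp

variable {V : Type u} {w : ℕ} {G H : SimpleGraph V} {W X : Set V}

theorem root_subset (h : RootedDecomp w G W X) : X ⊆ W := by
  induction h with
  | bag _ => exact subset_rfl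
  | join _ _ _ _ ih _ => exact ih.trans Set.subset_union_left
  | move => exact Set.subset_union_right
  | leaf _ _ _ ih => exact ih.trans (Set.subset_insert _ _)

theorem ncard_root_le (h : RootedDecomp w G W X) : X.ncard ≤ w := by
  induction h with
  | bag h => exact h
  | join _ _ _ _ ih _ => exact ih
  | move _ h => exact h
  | leaf _ _ _ ih => exact ih

theorem of_adj (h : RootedDecomp w G W X)
    (hH : ∀ u ∈ W, ∀ v ∈ W, H.Adj u v → G.Adj u v ∨ (u ∈ X ∧ v ∈ X)) :
    RootedDecomp w H W X := by
  induction h with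
  | bag h => exact .bag h
  | join _ _ hX hn ih₁ ih₂ =>
    refine .join (ih₁ fun u hu v hv => hH u (.inl hu) v (.inl hv))
      (ih₂ fun u hu v hv => hH u (.inr hu) v (.inr hv)) hX ?_
    intro u hu hux v hv hvx huv
    rcases hH u (.inl hu) v (.inr hv) huv with h | h
    · exact hn u hu hux v hv hvx h
    · exact hux h.1
  | move h₁ hw hX hn ih =>
    refine .move (ih ?_) hw hX ?_
    · intro u hu v hv huv
      rcases hH u (.inl hu) v (.inl hv) huv with h | h
      · exact .inl h
      · exact .inr ⟨hX ⟨hu, h.1⟩, hX ⟨hv, h.2⟩⟩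
    · intro u hu hux v hv hvx huv
      rcases hH u (.inl hu) v (.inr hv) huv with h | h
      · exact hn u hu hux v hv hvx h
      · exact hux h.1
  | leaf h₁ hf hn ih =>
    refine .leaf (ih fun u hu v hv => hH u (.inr hu) v (.inr hv)) hf ?_
    intro u hu hfu
    rcases hH _ (.inl rfl) u (.inr hu) hfu with h | h
    · exact hn u hu h
    · exact h.2

theorem attach_leaves (h : RootedDecomp w G W X) {F : Set V} (hF : F.Finite)
    (hFW : Disjoint F W) (hn : ∀ f ∈ F, ∀ u ∈ F ∪ W, G.Adj f u → u ∈ X) :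
    RootedDecomp w G (F ∪ W) X := by
  induction F, hF using Set.Finite.induction_on with
  | empty => simpa using h
  | @insert a F ha hF ih =>
    rw [Set.insert_union]
    rw [Set.disjoint_insert_left] at hFW
    refine .leaf (ih hFW.2 ?_) ?_ ?_
    · exact fun f hf u hu => hn f (.inr hf) u (by rw [Set.insert_union]; exact .inr hu)
    · rintro (h' | h')
      exacts [ha h', hFW.1 h']
    · exact fun u hu => hn a (.inl rfl) u (by rw [Set.insert_union]; exact .inr hu)

/-- A nonempty graph may be decomposed with a nonempty root bag. -/
theorem exists_nonempty_root (h : RootedDecomp w G W X) (hw : 0 < w) (hW : W.Nonempty) :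
    ∃ X', X'.Nonempty ∧ RootedDecomp w G W X' := by
  induction h with
  | @bag X h => exact ⟨X, hW, .bag h⟩
  | @join W₁ W₂ X h₁ h₂ hX hn ih₁ ih₂ =>
    rcases X.eq_empty_or_nonempty with rfl | hne
    · have key : ∀ {A B : Set V}, RootedDecomp w G A ∅ →
          (∃ X', X'.Nonempty ∧ RootedDecomp w G B X') → A ∩ B ⊆ ∅ →
          (∀ u ∈ A, ∀ v ∈ B, ¬ G.Adj u v) →
          ∃ X', X'.Nonempty ∧ RootedDecomp w G (A ∪ B) X' := by
        rintro A B hA ⟨Y, hY, hB⟩ hAB hn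
        have hYB := hB.root_subset
        refine ⟨Y, hY, ?_⟩
        have := RootedDecomp.join (hA.move hB.ncard_root_le
          ((Set.inter_subset_inter_right A hYB).trans hAB)
          fun u hu _ v hv _ => hn u hu v (hYB hv)) hB ?_ ?_
        · rwa [Set.union_assoc, Set.union_eq_right.2 hYB] at this
        · rintro x ⟨hx | hx, hx'⟩
          · exact (hAB ⟨hx, hx'⟩).elim
          · exact hx
        · rintro u (hu | hu) hu' v hv _
          · exact hn u hu v hv
          · exact (hu' hu).elim
      rcases W₂.eq_empty_or_nonempty with rfl | hW₂
      · obtain ⟨Y, hY, hd⟩ := ih₁ (by simpa using hW)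
        exact ⟨Y, hY, by simpa using hd⟩
      · exact key h₁ (ih₂ hW₂) hX fun u hu v hv => hn u hu (by simp) v hv (by simp)
    · exact ⟨X, hne, .join h₁ h₂ hX hn⟩
  | @move W X X' h hc hX hn ih =>
    rcases X'.eq_empty_or_nonempty with rfl | hne
    · obtain ⟨Y, hY, hd⟩ := ih (by simpa using hW)
      exact ⟨Y, hY, by simpa using hd⟩
    · exact ⟨X', hne, .move h hc hX hn⟩
  | @leaf W X f h hf hn ih =>
    rcases X.eq_empty_or_nonempty with rfl | hne
    · rcases W.eq_empty_or_nonempty with rfl | hW'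
      · exact ⟨{f}, by simp, by
          simpa using RootedDecomp.bag (G := G) (X := {f}) (by simpa using Nat.succ_le_of_lt hw)⟩
      · obtain ⟨Y, hY, hd⟩ := ih hW'
        exact ⟨Y, hY, hd.leaf hf fun u hu hfu => (hn u hu hfu).elim⟩
    · exact ⟨X, hne, .leaf h hf hn⟩

end RootedDecomp

/-- A part `W` of a decomposed graph, with root bag `X`, that is attached to the rest of the graph
along the set `A`. -/
structure HangingPart (V : Type u) where
  W : Set V
  X : Set V
  A : Set V

/-- The vertices of a hanging part that are not shared with the rest of the graph. -/
def HangingPart.interior {V : Type u} (P : HangingPart V) : Set V := P.W \ P.A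

/-- Deleting a set `Z` all of whose pieces reach the root bag cuts a decomposition into a
decomposition of smaller width and hanging parts avoiding `Z`. In the decomposition of smaller
width, the attachment set of each part may be made a clique, and the interior of each part may be
replaced by independent vertices joined to the attachment set. -/
theorem RootedDecomp.exists_hangingParts {V : Type u} [Finite V] {w : ℕ} {G : SimpleGraph V}
    {W X : Set V} (h : RootedDecomp (w + 1) G W X) (Z : Set V) (hXZ : (X ∩ Z).Nonempty)
    (hZ : ∀ Y ⊆ W ∩ Z, Y.Nonempty → (∀ u ∈ Y, ∀ v ∈ W ∩ Z, G.Adj u v → v ∈ Y) →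
      (Y ∩ X).Nonempty) :
    ∃ 𝓟 : Set (HangingPart V),
      (∀ P ∈ 𝓟, RootedDecomp (w + 1) G P.W P.X ∧ P.A ⊆ P.X ∧ P.W ⊆ W \ Z ∧
        (∀ u ∈ P.interior, ∀ v ∈ W, G.Adj u v → v ∈ P.W) ∧ Disjoint P.interior X) ∧
      (∀ P ∈ 𝓟, ∀ Q ∈ 𝓟, P ≠ Q → Disjoint P.interior Q.W) ∧
      ∀ H : SimpleGraph V,
        (∀ u ∈ W \ Z, ∀ v ∈ W \ Z, H.Adj u v →
          (G.Adj u v ∧ ∀ P ∈ 𝓟, u ∉ P.interior ∧ v ∉ P.interior) ∨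
          (∃ P ∈ 𝓟, (u ∈ P.A ∧ v ∈ P.W) ∨ (v ∈ P.A ∧ u ∈ P.W)) ∨ (u ∈ X ∧ v ∈ X)) →
        RootedDecomp w H (W \ Z) (X \ Z) := by
  have hcard : ∀ X : Set V, X.ncard ≤ w + 1 → (X ∩ Z).Nonempty → (X \ Z).ncard ≤ w := by
    rintro X hX ⟨x, hx, hxZ⟩
    have : (X \ Z).ncard < X.ncard :=
      Set.ncard_lt_ncard ⟨Set.sdiff_subset, fun h => (h hx).2 hxZ⟩ (Set.toFinite _)
    omega
  induction h with
  | @bag X hX =>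
    exact ⟨∅, by simp, by simp, fun H _ => .bag (hcard X hX hXZ)⟩
  | @join W₁ W₂ X h₁ h₂ hX hn ih₁ ih₂ =>
    have hX₁ := h₁.root_subset
    have hX₂ := h₂.root_subset
    have hn' : ∀ u ∈ W₂, u ∉ X → ∀ v ∈ W₁, v ∉ X → ¬ G.Adj u v :=
      fun u hu hux v hv hvx huv => hn v hv hvx u hu hux huv.symm
    obtain ⟨𝓟₁, hP₁, hd₁, hH₁⟩ := ih₁ hXZ (by
      intro Y hY hne hcl
      by_contra hYX
      refine hYX (hZ Y (fun y hy => ⟨.inl (hY hy).1, (hY hy).2⟩) hne ?_)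
      rintro u hu v ⟨hv | hv, hvZ⟩ huv
      · exact hcl u hu v ⟨hv, hvZ⟩ huv
      · have hux : u ∉ X := fun hux => hYX ⟨u, hu, hux⟩
        by_cases hvx : v ∈ X
        · exact hcl u hu v ⟨hX₁ hvx, hvZ⟩ huv
        · exact (hn u (hY hu).1 hux v hv hvx huv).elim)
    obtain ⟨𝓟₂, hP₂, hd₂, hH₂⟩ := ih₂ hXZ (by
      intro Y hY hne hcl
      by_contra hYX
      refine hYX (hZ Y (fun y hy => ⟨.inr (hY hy).1, (hY hy).2⟩) hne ?_)
      rintro u hu v ⟨hv | hv, hvZ⟩ huv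
      · have hux : u ∉ X := fun hux => hYX ⟨u, hu, hux⟩
        by_cases hvx : v ∈ X
        · exact hcl u hu v ⟨hX₂ hvx, hvZ⟩ huv
        · exact (hn' u (hY hu).1 hux v hv hvx huv).elim
      · exact hcl u hu v ⟨hv, hvZ⟩ huv)
    have hint₁ : ∀ P ∈ 𝓟₁, ∀ u ∈ P.interior, u ∈ W₁ ∧ u ∉ X := fun P hP u hu =>
      ⟨((hP₁ P hP).2.2.1 hu.1).1, fun hux => Set.disjoint_left.1 (hP₁ P hP).2.2.2.2 hu hux⟩
    have hint₂ : ∀ P ∈ 𝓟₂, ∀ u ∈ P.interior, u ∈ W₂ ∧ u ∉ X := fun P hP u hu =>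
      ⟨((hP₂ P hP).2.2.1 hu.1).1, fun hux => Set.disjoint_left.1 (hP₂ P hP).2.2.2.2 hu hux⟩
    refine ⟨𝓟₁ ∪ 𝓟₂, ?_, ?_, ?_⟩
    · rintro P (hP | hP)
      · obtain ⟨a, b, c, d, e⟩ := hP₁ P hP
        refine ⟨a, b, fun x hx => ⟨.inl (c hx).1, (c hx).2⟩, ?_, e⟩
        rintro u hu v (hv | hv) huv
        · exact d u hu v hv huv
        · by_cases hvx : v ∈ X
          · exact d u hu v (hX₁ hvx) huv
          · exact (hn u (hint₁ P hP u hu).1 (hint₁ P hP u hu).2 v hv hvx huv).elim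
      · obtain ⟨a, b, c, d, e⟩ := hP₂ P hP
        refine ⟨a, b, fun x hx => ⟨.inr (c hx).1, (c hx).2⟩, ?_, e⟩
        rintro u hu v (hv | hv) huv
        · by_cases hvx : v ∈ X
          · exact d u hu v (hX₂ hvx) huv
          · exact (hn' u (hint₂ P hP u hu).1 (hint₂ P hP u hu).2 v hv hvx huv).elim
        · exact d u hu v hv huv
    · rintro P (hP | hP) Q (hQ | hQ) hPQ
      · exact hd₁ P hP Q hQ hPQ
      · refine Set.disjoint_left.2 fun u hu huQ => ?_
        exact (hint₁ P hP u hu).2 (hX ⟨(hint₁ P hP u hu).1, ((hP₂ Q hQ).2.2.1 huQ).1⟩)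
      · refine Set.disjoint_left.2 fun u hu huQ => ?_
        exact (hint₂ P hP u hu).2 (hX ⟨((hP₁ Q hQ).2.2.1 huQ).1, (hint₂ P hP u hu).1⟩)
      · exact hd₂ P hP Q hQ hPQ
    · intro H hH
      rw [Set.union_sdiff_distrib]
      refine .join (hH₁ H ?_) (hH₂ H ?_) ?_ ?_
      · intro u hu v hv huv
        rcases hH u ⟨.inl hu.1, hu.2⟩ v ⟨.inl hv.1, hv.2⟩ huv with h | ⟨P, hP | hP, h⟩ | h
        · exact .inl ⟨h.1, fun P hP => h.2 P (.inl hP)⟩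
        · exact .inr (.inl ⟨P, hP, h⟩)
        · obtain ⟨-, b, c, -, -⟩ := hP₂ P hP
          have hb := b.trans (hP₂ P hP).1.root_subset
          refine .inr (.inr ?_)
          rcases h with h | h
          · exact ⟨hX ⟨hu.1, (c (hb h.1)).1⟩, hX ⟨hv.1, (c h.2).1⟩⟩
          · exact ⟨hX ⟨hu.1, (c h.2).1⟩, hX ⟨hv.1, (c (hb h.1)).1⟩⟩
        · exact .inr (.inr h)
      · intro u hu v hv huv
        rcases hH u ⟨.inr hu.1, hu.2⟩ v ⟨.inr hv.1, hv.2⟩ huv with h | ⟨P, hP | hP, h⟩ | h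
        · exact .inl ⟨h.1, fun P hP => h.2 P (.inr hP)⟩
        · obtain ⟨-, b, c, -, -⟩ := hP₁ P hP
          have hb := b.trans (hP₁ P hP).1.root_subset
          refine .inr (.inr ?_)
          rcases h with h | h
          · exact ⟨hX ⟨(c (hb h.1)).1, hu.1⟩, hX ⟨(c h.2).1, hv.1⟩⟩
          · exact ⟨hX ⟨(c h.2).1, hu.1⟩, hX ⟨(c (hb h.1)).1, hv.1⟩⟩
        · exact .inr (.inl ⟨P, hP, h⟩)
        · exact .inr (.inr h)
      · exact fun x hx => ⟨hX ⟨hx.1.1, hx.2.1⟩, hx.1.2⟩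
      · intro u hu hux v hv hvx huv
        have hux' : u ∉ X := fun h => hux ⟨h, hu.2⟩
        have hvx' : v ∉ X := fun h => hvx ⟨h, hv.2⟩
        rcases hH u ⟨.inl hu.1, hu.2⟩ v ⟨.inr hv.1, hv.2⟩ huv with h | ⟨P, hP | hP, h⟩ | h
        · exact hn u hu.1 hux' v hv.1 hvx' h.1
        · obtain ⟨-, b, c, -, -⟩ := hP₁ P hP
          have hb := b.trans (hP₁ P hP).1.root_subset
          refine hvx' (hX ⟨?_, hv.1⟩)
          rcases h with h | h
          exacts [(c h.2).1, (c (hb h.1)).1]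
        · obtain ⟨-, b, c, -, -⟩ := hP₂ P hP
          have hb := b.trans (hP₂ P hP).1.root_subset
          refine hux' (hX ⟨hu.1, ?_⟩)
          rcases h with h | h
          exacts [(c (hb h.1)).1, (c h.2).1]
        · exact hux' h.1
  | @move W X X' h hc hX hn ih =>
    have hXW := h.root_subset
    by_cases hXZ' : (X ∩ Z).Nonempty
    · obtain ⟨𝓟, hP, hd, hH⟩ := ih hXZ' (by
        intro Y hY hne hcl
        by_contra hYX
        obtain ⟨y, hy, hy'⟩ := hZ Y (fun y hy => ⟨.inl (hY hy).1, (hY hy).2⟩) hne (by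
          rintro u hu v ⟨hv, hvZ⟩ huv
          by_cases hvW : v ∈ W
          · exact hcl u hu v ⟨hvW, hvZ⟩ huv
          · have hv : v ∈ X' := hv.resolve_left hvW
            have hux : u ∉ X' := fun hux => hYX ⟨u, hu, hX ⟨(hY hu).1, hux⟩⟩
            exact (hn u (hY hu).1 hux v hv hvW huv).elim)
        exact hYX ⟨y, hy, hX ⟨(hY hy).1, hy'⟩⟩)
      have hint : ∀ P ∈ 𝓟, ∀ u ∈ P.interior, u ∈ W ∧ u ∉ X' := fun P hp u hu =>
        ⟨((hP P hp).2.2.1 hu.1).1, fun hux => Set.disjoint_left.1 (hP P hp).2.2.2.2 hu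
          (hX ⟨((hP P hp).2.2.1 hu.1).1, hux⟩)⟩
      refine ⟨𝓟, ?_, hd, ?_⟩
      · intro P hp
        obtain ⟨a, b, c, d, e⟩ := hP P hp
        refine ⟨a, b, fun x hx => ⟨.inl (c hx).1, (c hx).2⟩, ?_,
          Set.disjoint_left.2 fun u hu => (hint P hp u hu).2⟩
        intro u hu v hv huv
        by_cases hvW : v ∈ W
        · exact d u hu v hvW huv
        · exact (hn u (hint P hp u hu).1 (hint P hp u hu).2 v (hv.resolve_left hvW) hvW huv).elim
      · intro H hH'
        rw [Set.union_sdiff_distrib]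
        refine .move (hH H ?_) (hcard _ hc hXZ) (fun x hx => ⟨hX ⟨hx.1.1, hx.2.1⟩, hx.1.2⟩) ?_
        · intro u hu v hv huv
          rcases hH' u ⟨.inl hu.1, hu.2⟩ v ⟨.inl hv.1, hv.2⟩ huv with h | h | h
          · exact .inl h
          · exact .inr (.inl h)
          · exact .inr (.inr ⟨hX ⟨hu.1, h.1⟩, hX ⟨hv.1, h.2⟩⟩)
        · intro u hu hux v hv hvW huv
          have hux' : u ∉ X' := fun h => hux ⟨h, hu.2⟩
          have hvW' : v ∉ W := fun h => hvW ⟨h, hv.2⟩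
          rcases hH' u ⟨.inl hu.1, hu.2⟩ v ⟨.inr hv.1, hv.2⟩ huv with h | ⟨P, hp, h⟩ | h
          · exact hn u hu.1 hux' v hv.1 hvW' h.1
          · obtain ⟨-, b, c, -, -⟩ := hP P hp
            have hb := b.trans (hP P hp).1.root_subset
            rcases h with h | h
            exacts [hvW' (c h.2).1, hvW' (c (hb h.1)).1]
          · exact hux' h.1
    · have hWZ : ∀ x ∈ W, x ∉ Z := by
        intro x hx hxZ
        have hYX : ∀ u ∈ W ∩ Z, u ∉ X' := fun u hu hux => hXZ' ⟨u, hX ⟨hu.1, hux⟩, hu.2⟩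
        obtain ⟨y, hy, hy'⟩ := hZ (W ∩ Z) (fun y hy => ⟨.inl hy.1, hy.2⟩) ⟨x, hx, hxZ⟩ (by
          rintro u hu v ⟨hv, hvZ⟩ huv
          by_contra hvW
          have hvW : v ∉ W := fun h => hvW ⟨h, hvZ⟩
          exact hn u hu.1 (hYX u hu) v (hv.resolve_left hvW) hvW huv)
        exact hYX y hy hy'
      have hint : ∀ u ∈ W \ (X ∩ X'), u ∉ X' := fun u hu hux => hu.2 ⟨hX ⟨hu.1, hux⟩, hux⟩
      refine ⟨{⟨W, X, X ∩ X'⟩}, ?_, ?_, ?_⟩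
      · rintro P rfl
        refine ⟨h, Set.inter_subset_left, fun x hx => ⟨.inl hx, hWZ x hx⟩, ?_,
          Set.disjoint_left.2 hint⟩
        intro u hu v hv huv
        by_contra hvW
        exact hn u hu.1 (hint u hu) v (hv.resolve_left hvW) hvW huv
      · rintro P rfl Q rfl h
        exact (h rfl).elim
      · intro H hH
        have heq : (W ∪ X') \ Z = (W \ (X ∩ X')) ∪ (X' \ Z) := by
          ext x
          constructor
          · rintro ⟨hx | hx, hxZ⟩
            · by_cases hx' : x ∈ X'
              · exact .inr ⟨hx', hxZ⟩
              · exact .inl ⟨hx, fun h => hx' h.2⟩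
            · exact .inr ⟨hx, hxZ⟩
          · rintro (hx | hx)
            · exact ⟨.inl hx.1, hWZ x hx.1⟩
            · exact ⟨.inr hx.1, hx.2⟩
        rw [heq]
        refine (RootedDecomp.bag (hcard X' hc hXZ)).attach_leaves (Set.toFinite _)
          (Set.disjoint_left.2 fun u hu hu' => hint u hu hu'.1) ?_
        intro f hf u hu hfu
        rcases hH f (heq ▸ .inl hf) u (heq ▸ hu) hfu with h | ⟨P, rfl, h⟩ | h
        · exact ((h.2 _ rfl).1 hf).elim
        · rcases h with h | h
          · exact (hf.2 h.1).elim
          · exact ⟨h.1.2, hWZ u (hXW h.1.1)⟩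
        · exact (hint f hf h.1).elim
  | @leaf W X f h hf hn ih =>
    have hXW := h.root_subset
    obtain ⟨𝓟, hP, hd, hH⟩ := ih hXZ (by
      intro Y hY hne hcl
      by_contra hYX
      refine hYX (hZ Y (fun y hy => ⟨.inr (hY hy).1, (hY hy).2⟩) hne ?_)
      rintro u hu v ⟨rfl | hv, hvZ⟩ huv
      · exact (hYX ⟨u, hu, hn u (hY hu).1 huv.symm⟩).elim
      · exact hcl u hu v ⟨hv, hvZ⟩ huv)
    refine ⟨𝓟, ?_, hd, ?_⟩
    · intro P hp
      obtain ⟨a, b, c, d, e⟩ := hP P hp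
      refine ⟨a, b, fun x hx => ⟨.inr (c hx).1, (c hx).2⟩, ?_, e⟩
      rintro u hu v (rfl | hv) huv
      · exact (Set.disjoint_left.1 e hu (hn u (c hu.1).1 huv.symm)).elim
      · exact d u hu v hv huv
    · intro H hH'
      have key := hH H fun u hu v hv => hH' u ⟨.inr hu.1, hu.2⟩ v ⟨.inr hv.1, hv.2⟩
      by_cases hfZ : f ∈ Z
      · rwa [Set.insert_sdiff_of_mem _ hfZ]
      · rw [Set.insert_sdiff_of_notMem _ hfZ]
        refine .leaf key (fun h => hf h.1) ?_
        intro u hu hfu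
        rcases hH' f ⟨.inl rfl, hfZ⟩ u ⟨.inr hu.1, hu.2⟩ hfu with h | ⟨P, hp, h⟩ | h
        · exact ⟨hn u hu.1 h.1, hu.2⟩
        · obtain ⟨-, b, c, -, -⟩ := hP P hp
          have hb := b.trans (hP P hp).1.root_subset
          rcases h with h | h
          exacts [(hf (c (hb h.1)).1).elim, (hf (c h.2).1).elim]
        · exact (hf (hXW h.1)).elim

theorem RootedDecomp.not_adj_of_zero {V : Type u} [Finite V] {G : SimpleGraph V} {W X : Set V}
    (h : RootedDecomp 0 G W X) : X = ∅ ∧ ∀ u ∈ W, ∀ v ∈ W, ¬ G.Adj u v := by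
  induction h with
  | @bag X h =>
    obtain rfl : X = ∅ := (Set.ncard_eq_zero (Set.toFinite _)).1 (by omega)
    simp
  | @join W₁ W₂ X h₁ h₂ hX hn ih₁ ih₂ =>
    obtain ⟨rfl, ih₁⟩ := ih₁
    refine ⟨rfl, ?_⟩
    rintro u (hu | hu) v (hv | hv) huv
    · exact ih₁ u hu v hv huv
    · exact hn u hu (by simp) v hv (by simp) huv
    · exact hn v hv (by simp) u hu (by simp) huv.symm
    · exact ih₂.2 u hu v hv huv
  | @move W X X' h hc hX hn ih =>
    obtain rfl : X' = ∅ := (Set.ncard_eq_zero (Set.toFinite _)).1 (by omega)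
    simpa using ih.2
  | @leaf W X f h hf hn ih =>
    obtain ⟨rfl, ih⟩ := ih
    refine ⟨rfl, ?_⟩
    rintro u (rfl | hu) v (rfl | hv) huv
    · exact huv.ne rfl
    · exact hn v hv huv
    · exact hn u hu huv.symm
    · exact ih u hu v hv huv

section Metric

variable {V : Type u} {G H : SimpleGraph V}

/-- The vertices at distance at most `r` from the set `X`. -/
def nearSet (G : SimpleGraph V) (X : Set V) (r : ℕ) : Set V :=
  {v | ∃ x ∈ X, G.edist x v ≤ r}

/-- The subgraph of `G` consisting of the edges whose ends have the same color. -/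
def monoGraph (G : SimpleGraph V) (c : V → ℕ) : SimpleGraph V where
  Adj u v := G.Adj u v ∧ c u = c v
  symm := ⟨fun _ _ h => ⟨h.1.symm, h.2.symm⟩⟩
  loopless := ⟨fun _ h => h.1.ne rfl⟩

/-- The subgraph of `G` consisting of the edges with both ends in `W`. -/
def restrictTo (G : SimpleGraph V) (W : Set V) : SimpleGraph V where
  Adj u v := G.Adj u v ∧ u ∈ W ∧ v ∈ W
  symm := ⟨fun _ _ h => ⟨h.1.symm, h.2.2, h.2.1⟩⟩
  loopless := ⟨fun _ h => h.1.ne rfl⟩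

theorem restrictTo_le (W : Set V) : restrictTo G W ≤ G := fun _ _ h => h.1

theorem monoGraph_le (c : V → ℕ) : monoGraph G c ≤ G := fun _ _ h => h.1

theorem SimpleGraph.Reachable.color_eq {c : V → ℕ} {u v : V}
    (h : (monoGraph G c).Reachable u v) : c u = c v := by
  obtain ⟨p⟩ := h
  induction p with
  | nil => rfl
  | cons h _ ih => exact h.2.trans ih

theorem SimpleGraph.Adj.edist_le_one {u v : V} (h : G.Adj u v) : G.edist u v ≤ 1 :=
  (edist_eq_one_iff_adj.2 h).le

theorem edist_le_add {u v w : V} {a b : ℕ} (h₁ : G.edist u v ≤ a) (h₂ : G.edist v w ≤ b) :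
    G.edist u w ≤ (a + b : ℕ) := by
  push_cast
  exact G.edist_triangle.trans (add_le_add h₁ h₂)

theorem edist_le_of_le {u v : V} {a b : ℕ} (h₁ : G.edist u v ≤ a) (h₂ : a ≤ b) :
    G.edist u v ≤ b :=
  h₁.trans (by exact_mod_cast h₂)

theorem subset_nearSet (X : Set V) (r : ℕ) : X ⊆ nearSet G X r :=
  fun x hx => ⟨x, hx, by simp⟩

theorem nearSet_mono (X : Set V) {r s : ℕ} (h : r ≤ s) : nearSet G X r ⊆ nearSet G X s :=
  fun _ ⟨x, hx, hv⟩ => ⟨x, hx, edist_le_of_le hv h⟩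

theorem mem_nearSet_of_edist {X : Set V} {r s : ℕ} {u v : V} (h : u ∈ nearSet G X r)
    (huv : G.edist u v ≤ s) : v ∈ nearSet G X (r + s) := by
  obtain ⟨x, hx, hu⟩ := h
  exact ⟨x, hx, edist_le_add hu huv⟩

theorem mem_nearSet_of_adj {X : Set V} {r : ℕ} {u v : V} (h : u ∈ nearSet G X r)
    (huv : G.Adj u v) : v ∈ nearSet G X (r + 1) :=
  mem_nearSet_of_edist h (by simpa using huv.edist_le_one)

/-- An invariant of the steps of a walk is preserved along reachability. -/
theorem SimpleGraph.Reachable.invariant {u v : V} (h : G.Reachable u v) {I : V → Prop} (hu : I u)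
    (hI : ∀ a b, G.Reachable u a → I a → G.Adj a b → I b) : I v := by
  rw [reachable_iff_reflTransGen] at h
  induction h with
  | refl => exact hu
  | tail h hab ih => exact hI _ _ ((reachable_iff_reflTransGen _ _).2 h) ih hab

theorem edist_le_mul_of_adj {M n : ℕ} (hM : ∀ u v, H.Adj u v → G.edist u v ≤ M) {u v : V}
    (h : H.edist u v ≤ n) : G.edist u v ≤ (M * n : ℕ) := by
  have key : ∀ {u v : V} (p : H.Walk u v), G.edist u v ≤ (M * p.length : ℕ) := by
    intro u v p
    induction p with
    | nil => simp
    | cons h p ih =>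
      refine edist_le_of_le (edist_le_add (hM _ _ h) ih) ?_
      rw [Walk.length_cons]
      ring_nf
      rfl
  have hne : H.edist u v ≠ ⊤ := fun h' => by simp [h'] at h
  obtain ⟨p, hp⟩ := exists_walk_of_edist_ne_top hne
  rw [← hp] at h
  exact edist_le_of_le (key p) (Nat.mul_le_mul_left _ (by exact_mod_cast h))

/-- A connected set covered by `m` balls of radius `r` has weak diameter less than
`m * (2 * r + 1)`. -/
theorem edist_le_of_covered [Finite V] {B : SimpleGraph V} (hB : B ≤ G) {X : Set V} {m r : ℕ}
    (hX : X.ncard ≤ m) {u v : V} (huv : B.Reachable u v)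
    (hcov : ∀ y, B.Reachable u y → y ∈ nearSet G X r) :
    G.edist u v ≤ (m * (2 * r + 1) : ℕ) := by
  have hivt : ∀ n : ℕ, (n : ℕ∞) ≤ G.edist u v → ∃ y, B.Reachable u y ∧ G.edist u y = n := by
    intro n
    refine huv.invariant (I := fun v => (n : ℕ∞) ≤ G.edist u v →
      ∃ y, B.Reachable u y ∧ G.edist u y = n) ?_ ?_
    · intro h
      refine ⟨u, .rfl, ?_⟩
      simp at h
      simp [h]
    · intro a b hua ih hab hn
      by_cases h : (n : ℕ∞) ≤ G.edist u a
      · exact ih h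
      · refine ⟨b, hua.trans hab.reachable, le_antisymm ?_ hn⟩
        have h1 : G.edist u b ≤ G.edist u a + 1 :=
          G.edist_triangle.trans (add_le_add_right (hB hab).edist_le_one _)
        exact h1.trans (Order.add_one_le_of_lt (not_le.1 h))
  by_contra! hlt
  have hex : ∀ j : Fin (m + 1), ∃ x : X, ∃ y, G.edist u y = (j.1 * (2 * r + 1) : ℕ) ∧
      G.edist x.1 y ≤ r := by
    intro j
    obtain ⟨y, hy, hy'⟩ := hivt (j.1 * (2 * r + 1)) (le_trans (by
      exact_mod_cast Nat.mul_le_mul_right _ (Nat.lt_succ_iff.1 j.2)) hlt.le)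
    obtain ⟨x, hx, hxy⟩ := hcov y hy
    exact ⟨⟨x, hx⟩, y, hy', hxy⟩
  choose f y hy hfy using hex
  have hlt' : ∀ i j : Fin (m + 1), i < j → f i ≠ f j := by
    intro i j hij hf
    have h1 := edist_le_add (edist_le_add (hy i).le (G.edist_comm.trans_le (hfy i)))
      (hf ▸ hfy j)
    rw [hy j, Nat.cast_le] at h1
    have : i.1 + 1 ≤ j.1 := hij
    nlinarith [Nat.mul_le_mul_right (2 * r + 1) this]
  have hinj : Function.Injective f := by
    intro i j hf
    by_contra hij
    rcases lt_or_gt_of_ne hij with h | h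
    · exact hlt' i j h hf
    · exact hlt' j i h hf.symm
  have := Nat.card_le_card_of_injective f hinj
  rw [Nat.card_eq_fintype_card, Fintype.card_fin, Nat.card_coe_set_eq] at this
  omega

/-- Coloring the layers around `X` so that layers `2 * i + 2` and `2 * i + 3` avoid the color of
the `i`-th vertex of `X` confines the monochromatic components that meet `X`. -/
theorem exists_confining_coloring [Finite V] {X : Set V} {m : ℕ} (hX : X.ncard ≤ m)
    {p q c₀ : V → ℕ} (hc₀ : ∀ v, c₀ v = p v ∨ c₀ v = q v)
    (hpq : ∀ u v, G.Adj u v → p u = q u → p v = q v → p u ≠ p v) :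
    ∃ cZ : V → ℕ, (∀ v, cZ v = p v ∨ cZ v = q v) ∧ (∀ v ∈ nearSet G X 1, cZ v = c₀ v) ∧
      ∀ c : V → ℕ, (∀ v ∈ nearSet G X (2 * m + 1), c v = cZ v) →
        ∀ x ∈ X, ∀ v, (monoGraph G c).Reachable x v → v ∈ nearSet G X (2 * m + 1) := by
  classical
  obtain ⟨idx, hidx, hinj⟩ : ∃ idx : V → ℕ, (∀ x ∈ X, idx x < m) ∧ Set.InjOn idx X := by
    refine ⟨fun v => if h : v ∈ X then (Finite.equivFin X ⟨v, h⟩).1 else 0, ?_, ?_⟩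
    · intro x hx
      simp only [hx, dite_true]
      exact (Finite.equivFin X ⟨x, hx⟩).2.trans_le (by rwa [Nat.card_coe_set_eq])
    · intro x hx y hy hxy
      simp only [hx, hy, dite_true] at hxy
      simpa using (Finite.equivFin X).injective (Fin.ext hxy)
  let rank : V → ℕ := fun v => sInf {n | v ∈ nearSet G X n}
  let cZ : V → ℕ := fun v => if v ∈ nearSet G X 1 then c₀ v else
    if ∃ x ∈ X, idx x = (rank v - 2) / 2 ∧ c₀ x = p v then q v else p v
  have hrank : ∀ v n, v ∈ nearSet G X (n + 1) → v ∉ nearSet G X n → rank v = n + 1 := by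
    intro v n h h'
    refine le_antisymm (Nat.sInf_le h) ?_
    have hne : {n | v ∈ nearSet G X n}.Nonempty := ⟨_, h⟩
    by_contra! hlt
    exact h' (nearSet_mono X (Nat.lt_succ_iff.1 hlt) (Nat.sInf_mem hne))
  have havoid : ∀ x ∈ X, ∀ v, v ∉ nearSet G X 1 → (rank v - 2) / 2 = idx x → cZ v = c₀ x →
      p v = q v ∧ p v = c₀ x := by
    intro x hx v hv hr hcv
    simp only [cZ, hv, if_false] at hcv
    split_ifs at hcv with hx'
    · obtain ⟨y, hy, hyx, hyp⟩ := hx'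
      obtain rfl : y = x := hinj hy hx (hyx.trans hr)
      exact ⟨hyp.symm.trans hcv.symm, hyp.symm⟩
    · exact (hx' ⟨x, hx, hr.symm, hcv.symm⟩).elim
  refine ⟨cZ, ?_, fun v hv => by simp [cZ, hv], ?_⟩
  · intro v
    simp only [cZ]
    split_ifs
    exacts [hc₀ v, .inr rfl, .inl rfl]
  · intro c hc x hx v hxv
    have hxi := hidx x hx
    have hcx : c x = c₀ x := by
      rw [hc x (subset_nearSet X _ hx)]
      simp only [cZ, subset_nearSet X 1 hx, if_true]
    refine nearSet_mono X (show 2 * idx x + 2 ≤ 2 * m + 1 by omega)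
      (hxv.invariant (I := (· ∈ nearSet G X (2 * idx x + 2))) (subset_nearSet X _ hx) ?_)
    intro a b hxa ha hab
    by_contra hb
    have hb' := mem_nearSet_of_adj ha hab.1
    have hca : c a = c₀ x := hxa.color_eq.symm.trans hcx
    have hcb : c b = c₀ x := hab.2.symm.trans hca
    have ha' : a ∉ nearSet G X (2 * idx x + 1) := fun h => hb (mem_nearSet_of_adj h hab.1)
    have hra := hrank a _ ha ha'
    have hrb := hrank b _ hb' hb
    rw [hc a (nearSet_mono X (by omega) ha)] at hca
    rw [hc b (nearSet_mono X (by omega) hb')] at hcb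
    have h1 := havoid x hx a (fun h => ha' (nearSet_mono X (by omega) h)) (by omega) hca
    have h2 := havoid x hx b (fun h => hb (nearSet_mono X (by omega) h)) (by omega) hcb
    exact hpq a b hab.1 h1.1 h2.1 (h1.2.trans h2.2.symm)

end Metric

/-- Every decomposed graph of width `w`, with two colors `p v` and `q v` available at each vertex
`v` and no monochromatic edge among the vertices with `p v = q v`, has a coloring of weak diameter
at most `N` that is prescribed near the root bag and whose components meeting the root bag have
radius at most `M`. -/
def HasRootedColorings (w M N : ℕ) : Prop :=
  ∀ (V : Type u) [Finite V] (G : SimpleGraph V) (W X : Set V), RootedDecomp w G W X →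
    (∀ u v, G.Adj u v → u ∈ W ∧ v ∈ W) → ∀ p q c₀ : V → ℕ, (∀ v, c₀ v = p v ∨ c₀ v = q v) →
    (∀ u v, G.Adj u v → p u = q u → p v = q v → p u ≠ p v) →
    ∃ c : V → ℕ, (∀ v, c v = p v ∨ c v = q v) ∧ (∀ v ∈ nearSet G X 1, c v = c₀ v) ∧
      (∀ x ∈ X, ∀ v, (monoGraph G c).Reachable x v → G.edist x v ≤ M) ∧
      ∀ u v, (monoGraph G c).Reachable u v → G.edist u v ≤ N

theorem edist_le_of_forall_not_adj {V : Type u} {G : SimpleGraph V} (hG : ∀ u v, ¬ G.Adj u v)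
    {c : V → ℕ} {u v : V} (h : (monoGraph G c).Reachable u v) (n : ℕ) : G.edist u v ≤ n := by
  have : u = v := h.invariant (I := (u = ·)) rfl fun a b _ _ hab => (hG a b hab.1).elim
  simp [this]

theorem hasRootedColorings_zero (M N : ℕ) : HasRootedColorings.{u} 0 M N := by
  intro V _ G W X h hsupp p q c₀ hc₀ _
  have hG : ∀ u v, ¬ G.Adj u v := fun u v huv =>
    h.not_adj_of_zero.2 u (hsupp u v huv).1 v (hsupp u v huv).2 huv
  exact ⟨c₀, hc₀, fun _ _ => rfl, fun _ _ _ h => edist_le_of_forall_not_adj hG h M,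
    fun _ _ h => edist_le_of_forall_not_adj hG h N⟩

/-- Consequences of a gluing of colorings of hanging parts, of a deleted set `Z`, and of a torso
`G'` of the rest, when the torso records all connections made inside the hanging parts. -/
theorem edist_le_of_glued {V : Type u} {G G' : SimpleGraph V} {W Z : Set V}
    {𝓟 : Set (HangingPart V)} {p q c c' : V → ℕ} {cP : HangingPart V → V → ℕ} {M N' : ℕ}
    (hsupp : ∀ u v, G.Adj u v → u ∈ W ∧ v ∈ W)
    (hpq : ∀ u v, G.Adj u v → p u = q u → p v = q v → p u ≠ p v)
    (hc : ∀ v, c v = p v ∨ c v = q v)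
    (h𝓟 : ∀ P ∈ 𝓟, P.A ⊆ P.W ∧ P.W ⊆ W \ Z ∧ (∀ u ∈ P.interior, ∀ v ∈ W, G.Adj u v → v ∈ P.W))
    (hdisj : ∀ P ∈ 𝓟, ∀ Q ∈ 𝓟, P ≠ Q → Disjoint P.interior Q.W)
    (hG' : ∀ u v, u ≠ v → u ∈ W \ Z → v ∈ W \ Z →
      ((G.Adj u v ∧ ∀ P ∈ 𝓟, u ∉ P.interior ∧ v ∉ P.interior) ∨
        ∃ P ∈ 𝓟, ((u ∈ P.A ∧ v ∈ P.W) ∨ (v ∈ P.A ∧ u ∈ P.W)) ∧ ¬ (p u = q u ∧ p v = q v) ∧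
          (restrictTo G P.W).edist u v ≤ M) → G'.Adj u v)
    (hM : 1 ≤ M) (hG'M : ∀ u v, G'.Adj u v → G.edist u v ≤ M)
    (hN' : ∀ u v, (monoGraph G' c').Reachable u v → G'.edist u v ≤ N')
    (hcP : ∀ P ∈ 𝓟, ∀ v ∈ P.W, c v = cP P v)
    (hc' : ∀ v, v ∉ Z → (∀ P ∈ 𝓟, v ∉ P.interior) → c v = c' v)
    (hAM : ∀ P ∈ 𝓟, ∀ x ∈ P.A, ∀ v, (monoGraph (restrictTo G P.W) (cP P)).Reachable x v →
      (restrictTo G P.W).edist x v ≤ M)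
    (hrule : ∀ P ∈ 𝓟, ∀ a ∈ P.A, p a = q a → ∀ v ∈ P.interior, G.Adj a v → c v = p a →
      p v ≠ q v → c' v = p a)
    {u v : V} (huW : u ∈ W) (huZ : u ∉ Z) (hu : ∀ P ∈ 𝓟, u ∉ P.interior)
    (huv : (monoGraph (restrictTo G Zᶜ) c).Reachable u v) :
    G.edist u v ≤ (M * N' + 2 * M : ℕ) := by
  have hinv : (v ∈ W ∧ v ∉ Z ∧ (∀ P ∈ 𝓟, v ∉ P.interior) ∧ (monoGraph G' c').Reachable u v) ∨
      ∃ P ∈ 𝓟, v ∈ P.interior ∧ ∃ y a, y ∈ P.W ∧ p y ≠ q y ∧ a ∈ P.A ∧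
        (monoGraph G' c').Reachable u y ∧
        (monoGraph (restrictTo G P.W) (cP P)).Reachable y v ∧
        (monoGraph (restrictTo G P.W) (cP P)).Reachable a y := by
    refine huv.invariant (I := fun v => (v ∈ W ∧ v ∉ Z ∧ (∀ P ∈ 𝓟, v ∉ P.interior) ∧
      (monoGraph G' c').Reachable u v) ∨
      ∃ P ∈ 𝓟, v ∈ P.interior ∧ ∃ y a, y ∈ P.W ∧ p y ≠ q y ∧ a ∈ P.A ∧
        (monoGraph G' c').Reachable u y ∧
        (monoGraph (restrictTo G P.W) (cP P)).Reachable y v ∧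
        (monoGraph (restrictTo G P.W) (cP P)).Reachable a y) (.inl ⟨huW, huZ, hu, .rfl⟩) ?_
    rintro a b hua ha ⟨⟨hab, haZ, hbZ⟩, hcab⟩
    obtain ⟨haW, hbW⟩ := hsupp a b hab
    by_cases hb : ∀ P ∈ 𝓟, b ∉ P.interior
    · refine .inl ⟨hbW, hbZ, hb, ?_⟩
      have hcb := hc' b hbZ hb
      rcases ha with ⟨-, -, ha, hra⟩ | ⟨P, hP, ha, y, a', hyW, hyS, ha'A, hry, hya, ha'y⟩
      · refine hra.trans (Adj.reachable ⟨hG' a b hab.ne ⟨haW, haZ⟩ ⟨hbW, hbZ⟩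
          (.inl ⟨hab, fun P hP => ⟨ha P hP, hb P hP⟩⟩), ?_⟩)
        rw [← hc' a haZ ha, hcab, hcb]
      · have hbP : b ∈ P.W := (h𝓟 P hP).2.2 a ha b hbW hab
        have hbA : b ∈ P.A := by
          by_contra h
          exact hb P hP ⟨hbP, h⟩
        have hyb : (monoGraph (restrictTo G P.W) (cP P)).Reachable y b :=
          hya.trans (Adj.reachable ⟨⟨hab, ha.1, hbP⟩, by
            rw [← hcP P hP a ha.1, hcab, hcP P hP b hbP]⟩)
        by_cases hne : y = b
        · exact hne ▸ hry
        · refine hry.trans (Adj.reachable ⟨hG' y b hne ((h𝓟 P hP).2.1 hyW) ⟨hbW, hbZ⟩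
            (.inr ⟨P, hP, .inr ⟨hbA, hyW⟩, fun h => hyS h.1, ?_⟩), ?_⟩)
          · rw [edist_comm]
            exact hAM P hP b hbA y hyb.symm
          · rw [← hry.color_eq, ← hc' u huZ hu, hua.color_eq, ← hcb]
            exact hcab
    · push Not at hb
      obtain ⟨Q, hQ, hb⟩ := hb
      refine .inr ⟨Q, hQ, hb, ?_⟩
      have haQ : a ∈ Q.W := (h𝓟 Q hQ).2.2 b hb a haW hab.symm
      have hstep : (monoGraph (restrictTo G Q.W) (cP Q)).Adj a b :=
        ⟨⟨hab, haQ, hb.1⟩, by rw [← hcP Q hQ a haQ, hcab, hcP Q hQ b hb.1]⟩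
      rcases ha with ⟨-, -, ha, hra⟩ | ⟨P, hP, ha, y, a', hyW, hyS, ha'A, hry, hya, ha'y⟩
      · have haA : a ∈ Q.A := by
          by_contra h
          exact ha Q hQ ⟨haQ, h⟩
        by_cases haS : p a = q a
        · have hca : c a = p a := by
            rcases hc a with h | h
            exacts [h, h.trans haS.symm]
          have hbS : p b ≠ q b := by
            intro hbS
            have hcb : c b = p b := by
              rcases hc b with h | h
              exacts [h, h.trans hbS.symm]
            exact hpq a b hab haS hbS (by rw [← hca, hcab, hcb])
          have hcb := hrule Q hQ a haA haS b hb hab (by rw [← hcab, hca]) hbS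
          refine ⟨b, a, hb.1, hbS, haA, hra.trans (Adj.reachable ⟨hG' a b hab.ne ⟨haW, haZ⟩
            ⟨hbW, hbZ⟩ (.inr ⟨Q, hQ, .inl ⟨haA, hb.1⟩, fun h => hbS h.2, ?_⟩), ?_⟩), .rfl,
            hstep.reachable⟩
          · exact edist_le_of_le (a := 1) (by simpa using Adj.edist_le_one hstep.1) hM
          · rw [← hc' a haZ ha, hca, hcb]
        · exact ⟨a, a, haQ, haS, haA, hra, hstep.reachable, .rfl⟩
      · have hPQ : Q = P := by
          by_contra hne
          exact Set.disjoint_left.1 (hdisj Q hQ P hP hne) hb ((h𝓟 P hP).2.2 a ha b hbW hab)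
        subst hPQ
        exact ⟨y, a', hyW, hyS, ha'A, hry, hya.trans hstep.reachable, ha'y⟩
  rcases hinv with ⟨-, -, -, h⟩ | ⟨P, hP, hv, y, a, hyW, hyS, haA, huy, hyv, hay⟩
  · exact edist_le_of_le (edist_le_mul_of_adj hG'M (hN' u v h)) (by omega)
  · have h1 := edist_le_mul_of_adj hG'M (hN' u y huy)
    have h2 := (edist_anti (restrictTo_le P.W)).trans (hAM P hP a haA y hay)
    have h3 := (edist_anti (restrictTo_le P.W)).trans (hAM P hP a haA v (hay.trans hyv))
    rw [edist_comm] at h2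
    exact edist_le_of_le (edist_le_add h1 (edist_le_add h2 h3)) (by omega)

/-- If the components of `G - Z` that leave the hanging parts have weak diameter at most `D`, then
the components of `G` are either inside a hanging part, or short, or stay close to `Z`. -/
theorem edist_le_of_delete {V : Type u} [Finite V] {G : SimpleGraph V} {W X Z : Set V}
    {𝓟 : Set (HangingPart V)} {c : V → ℕ} {cP : HangingPart V → V → ℕ} {D m r N : ℕ}
    (hsupp : ∀ u v, G.Adj u v → u ∈ W ∧ v ∈ W)
    (h𝓟 : ∀ P ∈ 𝓟, P.W ⊆ W \ Z ∧ (∀ u ∈ P.interior, ∀ v ∈ W, G.Adj u v → v ∈ P.W))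
    (hdisj : ∀ P ∈ 𝓟, ∀ Q ∈ 𝓟, P ≠ Q → Disjoint P.interior Q.W)
    (hcP : ∀ P ∈ 𝓟, ∀ v ∈ P.W, c v = cP P v)
    (hPN : ∀ P ∈ 𝓟, ∀ u v, (monoGraph (restrictTo G P.W) (cP P)).Reachable u v →
      (restrictTo G P.W).edist u v ≤ N)
    (hD : ∀ u v, u ∈ W → u ∉ Z → (∀ P ∈ 𝓟, u ∉ P.interior) →
      (monoGraph (restrictTo G Zᶜ) c).Reachable u v → G.edist u v ≤ D)
    (hX : X.ncard ≤ m) (hZX : Z ⊆ nearSet G X r)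
    (hN : m * (2 * (r + (1 + D)) + 1) ≤ N) (hN' : D + D ≤ N)
    {u v : V} (huv : (monoGraph G c).Reachable u v) : G.edist u v ≤ N := by
  by_cases hz : ∃ z ∈ Z, (monoGraph G c).Reachable u z
  · obtain ⟨z, hz, huz⟩ := hz
    refine edist_le_of_le (edist_le_of_covered (monoGraph_le c) hX huv (r := r + (1 + D)) ?_) hN
    intro y huy
    have hinv : y ∈ Z ∨ ∃ a, (a ∈ W ∧ a ∉ Z ∧ ∀ P ∈ 𝓟, a ∉ P.interior) ∧
        (∃ z ∈ Z, G.Adj z a) ∧ (monoGraph (restrictTo G Zᶜ) c).Reachable a y := by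
      refine (huz.symm.trans huy).invariant (I := fun y => y ∈ Z ∨
        ∃ a, (a ∈ W ∧ a ∉ Z ∧ ∀ P ∈ 𝓟, a ∉ P.interior) ∧
        (∃ z ∈ Z, G.Adj z a) ∧ (monoGraph (restrictTo G Zᶜ) c).Reachable a y) (.inl hz) ?_
      intro s t _ hs hst
      by_cases ht : t ∈ Z
      · exact .inl ht
      by_cases hsZ : s ∈ Z
      · refine .inr ⟨t, ⟨(hsupp s t hst.1).2, ht, fun P hP hti => ?_⟩, ⟨s, hsZ, hst.1⟩, .rfl⟩
        exact ((h𝓟 P hP).1 ((h𝓟 P hP).2 t hti s (hsupp s t hst.1).1 hst.1.symm)).2 hsZ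
      · obtain ⟨a, ha, hza, has⟩ := hs.resolve_left hsZ
        exact .inr ⟨a, ha, hza, has.trans (Adj.reachable ⟨⟨hst.1, hsZ, ht⟩, hst.2⟩)⟩
    rcases hinv with hy | ⟨a, ha, ⟨z', hz', hza⟩, hay⟩
    · exact nearSet_mono X (by omega) (hZX hy)
    · exact mem_nearSet_of_edist (hZX hz')
        (edist_le_add (by simpa using hza.edist_le_one) (hD a y ha.1 ha.2.1 ha.2.2 hay))
  · have hBZ : ∀ y, (monoGraph G c).Reachable u y →
        (monoGraph (restrictTo G Zᶜ) c).Reachable u y := by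
      intro y huy
      refine huy.invariant (I := fun y => (monoGraph (restrictTo G Zᶜ) c).Reachable u y) .rfl ?_
      intro s t hus hs hst
      exact hs.trans (Adj.reachable ⟨⟨hst.1, fun h => hz ⟨s, h, hus⟩,
        fun h => hz ⟨t, h, hus.trans hst.reachable⟩⟩, hst.2⟩)
    by_cases hcore : ∃ a, (monoGraph G c).Reachable u a ∧ a ∈ W ∧ ∀ P ∈ 𝓟, a ∉ P.interior
    · obtain ⟨a, hua, haW, ha⟩ := hcore
      have haZ : a ∉ Z := fun h => hz ⟨a, h, hua⟩
      have h1 := hD a u haW haZ ha (hBZ a hua).symm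
      have h2 := hD a v haW haZ ha ((hBZ a hua).symm.trans (hBZ v huv))
      rw [edist_comm] at h1
      exact edist_le_of_le (edist_le_add h1 h2) hN'
    · push Not at hcore
      by_cases huW : u ∈ W
      · obtain ⟨P, hP, hu⟩ := hcore u .rfl huW
        have h := huv.invariant (I := fun v => v ∈ P.interior ∧
          (monoGraph (restrictTo G P.W) (cP P)).Reachable u v) ⟨hu, .rfl⟩ (by
            rintro s t hus ⟨hsP, hs⟩ hst
            have htP : t ∈ P.W := (h𝓟 P hP).2 s hsP t (hsupp s t hst.1).2 hst.1
            refine ⟨?_, hs.trans (Adj.reachable ⟨⟨hst.1, hsP.1, htP⟩, ?_⟩)⟩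
            · obtain ⟨Q, hQ, ht⟩ := hcore t (hus.trans hst.reachable) (hsupp s t hst.1).2
              by_cases hQP : Q = P
              · exact hQP ▸ ht
              · exact (Set.disjoint_left.1 (hdisj Q hQ P hP hQP) ht htP).elim
            · rw [← hcP P hP s hsP.1, ← hcP P hP t htP]
              exact hst.2)
        exact (edist_anti (restrictTo_le P.W)).trans (hPN P hP u v h.2)
      · have : u = v := huv.invariant (I := (u = ·)) rfl (by
          rintro a b - rfl hab
          exact (huW (hsupp _ _ hab.1).1).elim)
        simp [this]

/-- Coloring the interior of a part attached along `A` so that a vertex with a color of a vertex of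
`A ∩ {v | p v = q v}` receives it only if forced to, and then as in `c'`. -/
theorem exists_part_precoloring {V : Type u} (A : Set V) {p q c' : V → ℕ}
    (hc' : ∀ v, c' v = p v ∨ c' v = q v) :
    ∃ c₀ : V → ℕ, (∀ v, c₀ v = p v ∨ c₀ v = q v) ∧ (∀ v ∈ A, c₀ v = c' v) ∧
      ∀ a ∈ A, p a = q a → ∀ v ∉ A, c₀ v = p a → p v ≠ q v → c' v = p a := by
  classical
  let K : Set ℕ := p '' {a | a ∈ A ∧ p a = q a}
  refine ⟨fun v => if v ∈ A ∨ (p v ∈ K ∧ q v ∈ K) then c' v else if p v ∈ K then q v else p v,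
    ?_, fun v hv => by simp [hv], ?_⟩
  · intro v
    dsimp only
    split_ifs
    exacts [hc' v, .inr rfl, .inl rfl]
  · intro a ha haS v hv hcv hvS
    have haK : p a ∈ K := ⟨a, ⟨ha, haS⟩, rfl⟩
    dsimp only at hcv
    split_ifs at hcv with h1 h2
    · exact hcv
    · exact (h1 (.inr ⟨h2, hcv ▸ haK⟩)).elim
    · exact (h2 (hcv ▸ haK)).elim

theorem hasRootedColorings_succ {w M' N' : ℕ} (h : HasRootedColorings.{u} w M' N') :
    ∃ N, HasRootedColorings.{u} (w + 1) ((w + 1) * (2 * (2 * (w + 1) + 1) + 1)) N := by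
  obtain ⟨r, hr⟩ : ∃ r, r = 2 * (w + 1) + 1 := ⟨_, rfl⟩
  obtain ⟨M, hM⟩ : ∃ M, M = (w + 1) * (2 * r + 1) := ⟨_, rfl⟩
  obtain ⟨D, hD⟩ : ∃ D, D = M * N' + 2 * M := ⟨_, rfl⟩
  have hM1 : 1 ≤ M := hM ▸ Nat.mul_pos (by omega) (by omega)
  refine ⟨(w + 1) * (2 * (r + (1 + D)) + 1) + (D + D), ?_⟩
  obtain ⟨N, hN⟩ : ∃ N, N = (w + 1) * (2 * (r + (1 + D)) + 1) + (D + D) := ⟨_, rfl⟩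
  rw [← hr, ← hM, ← hN]
  intro V _ G W
  induction hn : W.ncard using Nat.strong_induction_on generalizing G W with
  | _ n ih =>
  intro X hd hsupp p q c₀ hc₀ hpq
  wlog hX : X.Nonempty generalizing X
  · obtain rfl := Set.not_nonempty_iff_eq_empty.1 hX
    rcases W.eq_empty_or_nonempty with rfl | hW
    · have hG : ∀ u v, ¬ G.Adj u v := fun u v huv => (hsupp u v huv).1
      exact ⟨c₀, hc₀, fun _ _ => rfl, fun _ _ _ h => edist_le_of_forall_not_adj hG h M,
        fun _ _ h => edist_le_of_forall_not_adj hG h N⟩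
    · obtain ⟨X', hX', hd'⟩ := hd.exists_nonempty_root (Nat.succ_pos w) hW
      obtain ⟨c, h1, -, -, h4⟩ := this X' hd' hX'
      exact ⟨c, h1, fun v ⟨x, hx, _⟩ => hx.elim, fun x hx => hx.elim, h4⟩
  obtain ⟨cZ, hcZ, hcZ₀, hconf⟩ := exists_confining_coloring (G := G) hd.ncard_root_le hc₀ hpq
  rw [← hr] at hconf
  obtain ⟨Z, hZ⟩ : ∃ Z, Z = nearSet G X r := ⟨_, rfl⟩
  rw [← hZ] at hconf
  have hXZ : X ⊆ Z := hZ ▸ subset_nearSet X r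
  have hXW := hd.root_subset
  obtain ⟨𝓟, h𝓟, hdisj, hH⟩ := hd.exists_hangingParts Z (by
      obtain ⟨x, hx⟩ := hX
      exact ⟨x, hx, hXZ hx⟩) (by
    rintro Y hY ⟨y, hy⟩ hcl
    obtain ⟨x, hx, hxy⟩ : y ∈ nearSet G X r := hZ ▸ (hY hy).2
    have key : ∀ {y z : V} (l : G.Walk y z), z ∈ X → l.length ≤ r → y ∈ Y → (Y ∩ X).Nonempty := by
      intro y z l
      induction l with
      | nil => exact fun hz _ hy => ⟨_, hy, hz⟩
      | @cons a b z hab l ihl =>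
        intro hz hl ha
        rw [Walk.length_cons] at hl
        refine ihl hz (by omega) (hcl a ha b ⟨(hsupp a b hab).2, ?_⟩ hab)
        rw [hZ]
        refine ⟨z, hz, ?_⟩
        rw [edist_comm]
        exact edist_le_of_le (edist_le l) (by omega)
    have hne : G.edist y x ≠ ⊤ := by
      rw [edist_comm]
      intro h'
      simp [h'] at hxy
    obtain ⟨l, hl⟩ := exists_walk_of_edist_ne_top hne
    rw [edist_comm, ← hl] at hxy
    exact key l hx (by exact_mod_cast hxy) hy)
  let G' : SimpleGraph V :=
    { Adj := fun u v => u ≠ v ∧ u ∈ W \ Z ∧ v ∈ W \ Z ∧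
        ((G.Adj u v ∧ ∀ P ∈ 𝓟, u ∉ P.interior ∧ v ∉ P.interior) ∨
        ∃ P ∈ 𝓟, ((u ∈ P.A ∧ v ∈ P.W) ∨ (v ∈ P.A ∧ u ∈ P.W)) ∧ ¬ (p u = q u ∧ p v = q v) ∧
          (restrictTo G P.W).edist u v ≤ M)
      symm := ⟨by
        rintro u v ⟨h1, h2, h3, h4⟩
        refine ⟨h1.symm, h3, h2, ?_⟩
        rcases h4 with h4 | ⟨P, hP, h4, h5, h6⟩
        · exact .inl ⟨h4.1.symm, fun P hP => (h4.2 P hP).symm⟩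
        · exact .inr ⟨P, hP, h4.symm, fun h => h5 h.symm, by rwa [edist_comm]⟩⟩
      loopless := ⟨fun _ h => h.1 rfl⟩ }
  have hG'd : RootedDecomp w G' (W \ Z) (X \ Z) := by
    refine hH G' fun u _ v _ huv => ?_
    rcases huv.2.2.2 with h | ⟨P, hP, h, -⟩
    · exact .inl h
    · exact .inr (.inl ⟨P, hP, h⟩)
  obtain ⟨c', hc', -, -, hN'⟩ := h V G' (W \ Z) (X \ Z) hG'd (fun u v huv => ⟨huv.2.1, huv.2.2.1⟩)
    p q c₀ hc₀ (by
      intro u v huv hu hv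
      rcases huv.2.2.2 with h | ⟨P, hP, -, h, -⟩
      · exact hpq u v h.1 hu hv
      · exact (h ⟨hu, hv⟩).elim)
  have hex : ∀ P : HangingPart V, ∃ cP : V → ℕ, P ∈ 𝓟 → (∀ v, cP v = p v ∨ cP v = q v) ∧
      (∀ v ∈ P.A, cP v = c' v) ∧
      (∀ a ∈ P.A, p a = q a → ∀ v ∈ P.interior, G.Adj a v → cP v = p a → p v ≠ q v →
        c' v = p a) ∧
      (∀ x ∈ P.X, ∀ v, (monoGraph (restrictTo G P.W) cP).Reachable x v →
        (restrictTo G P.W).edist x v ≤ M) ∧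
      ∀ u v, (monoGraph (restrictTo G P.W) cP).Reachable u v →
        (restrictTo G P.W).edist u v ≤ N := by
    intro P
    by_cases hP : P ∈ 𝓟
    · obtain ⟨hPd, hPA, hPW, -, -⟩ := h𝓟 P hP
      obtain ⟨cA, hcA, hcA', hcAr⟩ := exists_part_precoloring P.A hc'
      have hlt : P.W.ncard < n := by
        rw [← hn]
        refine Set.ncard_lt_ncard ⟨fun x hx => (hPW hx).1, fun hWP => ?_⟩ (Set.toFinite _)
        obtain ⟨x, hx⟩ := hX
        exact (hPW (hWP (hXW hx))).2 (hXZ hx)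
      obtain ⟨cP, h1, h2, h3, h4⟩ := ih _ hlt (restrictTo G P.W) P.W rfl P.X
        (hPd.of_adj fun u _ v _ huv => .inl huv.1) (fun u v huv => huv.2) p q cA hcA
        (fun u v huv => hpq u v huv.1)
      refine ⟨cP, fun _ => ⟨h1, ?_, ?_, h3, h4⟩⟩
      · exact fun v hv => (h2 v (subset_nearSet _ _ (hPA hv))).trans (hcA' v hv)
      · intro a ha haS v hv hav hcv hvS
        refine hcAr a ha haS v hv.2 ?_ hvS
        rw [← hcv, h2]
        refine ⟨a, hPA ha, ?_⟩
        have : (restrictTo G P.W).Adj a v := ⟨hav, hPd.root_subset (hPA ha), hv.1⟩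
        simpa using this.edist_le_one
    · exact ⟨c', fun h => (hP h).elim⟩
  choose cP hcP using hex
  classical
  let c : V → ℕ := fun v => if v ∈ Z then cZ v else
    if h : ∃ P ∈ 𝓟, v ∈ P.interior then cP h.choose v else c' v
  have hcZ' : ∀ v ∈ Z, c v = cZ v := fun v hv => by simp [c, hv]
  have hcc' : ∀ v, v ∉ Z → (∀ P ∈ 𝓟, v ∉ P.interior) → c v = c' v := by
    intro v hvZ hv
    have : ¬ ∃ P ∈ 𝓟, v ∈ P.interior := fun ⟨P, hP, h⟩ => hv P hP h
    simp only [c, hvZ, this, if_false, dite_false]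
  have hccP : ∀ P ∈ 𝓟, ∀ v ∈ P.W, c v = cP P v := by
    intro P hP v hv
    have hvZ : v ∉ Z := ((h𝓟 P hP).2.2.1 hv).2
    by_cases hvI : ∃ Q ∈ 𝓟, v ∈ Q.interior
    · have hQ : hvI.choose = P := by
        by_contra hne
        exact Set.disjoint_left.1 (hdisj _ hvI.choose_spec.1 P hP hne) hvI.choose_spec.2 hv
      simp only [c, hvZ, hvI, if_false, dite_true, hQ]
    · have hvA : v ∈ P.A := by
        by_contra h
        exact hvI ⟨P, hP, hv, h⟩
      rw [hcc' v hvZ fun Q hQ h => hvI ⟨Q, hQ, h⟩, (hcP P hP).2.1 v hvA]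
  have hcv : ∀ v, c v = p v ∨ c v = q v := by
    intro v
    by_cases hvZ : v ∈ Z
    · rw [hcZ' v hvZ]
      exact hcZ v
    · by_cases hvI : ∃ Q ∈ 𝓟, v ∈ Q.interior
      · obtain ⟨Q, hQ, hv⟩ := hvI
        rw [hccP Q hQ v hv.1]
        exact (hcP Q hQ).1 v
      · rw [hcc' v hvZ fun Q hQ h => hvI ⟨Q, hQ, h⟩]
        exact hc' v
  have hconf' := hconf c hcZ'
  refine ⟨c, hcv, ?_, ?_, ?_⟩
  · intro v hv
    rw [hcZ' v (hZ ▸ nearSet_mono X (by omega) hv), hcZ₀ v hv]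
  · intro x hx v hxv
    rw [hM]
    exact edist_le_of_covered (monoGraph_le c) hd.ncard_root_le hxv
      fun y hy => hZ ▸ hconf' x hx y hy
  · intro u v huv
    refine edist_le_of_delete (D := D) hsupp (fun P hP => ⟨(h𝓟 P hP).2.2.1, (h𝓟 P hP).2.2.2.1⟩)
      hdisj hccP (fun P hP => (hcP P hP).2.2.2.2) ?_ hd.ncard_root_le hZ.subset (by omega)
      (by omega) huv
    intro a b haW haZ ha hab
    rw [hD]
    refine edist_le_of_glued (G' := G') (c' := c') hsupp hpq hcv
      (fun P hP => ⟨(h𝓟 P hP).2.1.trans (h𝓟 P hP).1.root_subset, (h𝓟 P hP).2.2.1,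
        (h𝓟 P hP).2.2.2.1⟩) hdisj (fun u v h1 h2 h3 h4 => ⟨h1, h2, h3, h4⟩) hM1 ?_ hN' hccP hcc'
      (fun P hP x hx => (hcP P hP).2.2.2.1 x ((h𝓟 P hP).2.1 hx)) ?_ haW haZ ha hab
    · intro u v huv
      rcases huv.2.2.2 with h | ⟨P, hP, -, -, h⟩
      · exact edist_le_of_le (a := 1) (by simpa using h.1.edist_le_one) hM1
      · exact (edist_anti (restrictTo_le P.W)).trans h
    · intro P hP a ha haS v hv hav hcv
      exact (hcP P hP).2.2.1 a ha haS v hv hav ((hccP P hP v hv.1).symm.trans hcv)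

theorem exists_hasRootedColorings (w : ℕ) : ∃ M N, HasRootedColorings.{u} w M N := by
  induction w with
  | zero => exact ⟨0, 0, hasRootedColorings_zero 0 0⟩
  | succ w ih =>
    obtain ⟨M, N, h⟩ := ih
    exact ⟨_, hasRootedColorings_succ h⟩

section TreeDecomposition

variable {ι : Type*} {T : SimpleGraph ι}

theorem SimpleGraph.IsAcyclic.mem_support_of_walk (hT : T.IsAcyclic) {A : Set ι} {s t : ι}
    (p : T.Walk s t) (hp : p.IsPath) (q : T.Walk s t) (hq : ∀ r ∈ q.support, r ∈ A) :
    ∀ r ∈ p.support, r ∈ A := by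
  classical
  have h : p = q.toPath.1 :=
    congrArg Subtype.val ((hT.subsingleton_path s t).elim ⟨p, hp⟩ q.toPath)
  intro r hr
  rw [h] at hr
  exact hq r (q.support_toPath_subset_support hr)

/-- The bags of a forest decomposition over a component of the forest form a rooted
decomposition, whose root may be chosen freely. -/
theorem RootedDecomp.of_isAcyclic [Finite ι] {V : Type u} {w : ℕ} {X : ι → Set V}
    (hw : ∀ t, (X t).ncard ≤ w) (hT : T.IsAcyclic)
    (hX : ∀ v s t (p : T.Walk s t), p.IsPath → v ∈ X s → v ∈ X t → ∀ r ∈ p.support, v ∈ X r)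
    (t₀ : ι) (G : SimpleGraph V)
    (hG : ∀ u v, G.Adj u v → ∃ t, T.Reachable t₀ t ∧ u ∈ X t ∧ v ∈ X t) :
    RootedDecomp w G {v | ∃ t, T.Reachable t₀ t ∧ v ∈ X t} (X t₀) := by
  classical
  induction T using WellFoundedLT.induction generalizing t₀ G with
  | ind T ih =>
  by_cases hiso : ∃ s, T.Adj t₀ s
  · obtain ⟨s, hs⟩ := hiso
    obtain ⟨T', hT'⟩ : ∃ T', T' = T.deleteEdges {s(t₀, s)} := ⟨_, rfl⟩
    have hle : T' ≤ T := hT' ▸ T.deleteEdges_le _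
    have hlt : T' < T := by
      refine lt_of_le_of_ne hle fun h => ?_
      rw [← h, hT', deleteEdges_adj] at hs
      exact hs.2 rfl
    have hbr : ¬ T'.Reachable t₀ s := by
      rw [hT']
      exact (isBridge_iff.1 (isAcyclic_iff_forall_adj_isBridge.1 hT hs))
    have hX' : ∀ v s t (p : T'.Walk s t), p.IsPath → v ∈ X s → v ∈ X t →
        ∀ r ∈ p.support, v ∈ X r := fun v s t p hp hvs hvt r hr =>
      hX v s t (p.mapLe hle) ((Walk.isPath_mapLe hle).2 hp) hvs hvt r (by simpa using hr)
    have hcross : ∀ v a b, T'.Reachable t₀ a → T'.Reachable s b → v ∈ X a → v ∈ X b →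
        v ∈ X t₀ ∧ v ∈ X s := by
      intro v a b ha hb hva hvb
      obtain ⟨p, hp⟩ := (((ha.mono hle).symm.trans hs.reachable).trans (hb.mono hle)).exists_isPath
      have he : s(t₀, s) ∈ p.edges := by
        by_contra he
        refine hbr ((ha.trans ?_).trans hb.symm)
        rw [hT']
        exact ⟨p.toDeleteEdge _ he⟩
      exact ⟨hX v a b p hp hva hvb _ (p.fst_mem_support_of_mem_edges he),
        hX v a b p hp hva hvb _ (p.snd_mem_support_of_mem_edges he)⟩
    have hsplit : ∀ t, T.Reachable t₀ t → T'.Reachable t₀ t ∨ T'.Reachable s t := by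
      intro t ht
      refine ht.invariant (I := fun t => T'.Reachable t₀ t ∨ T'.Reachable s t) (.inl .rfl) ?_
      intro a b _ h hab
      by_cases hab' : T'.Adj a b
      · exact h.imp (·.trans hab'.reachable) (·.trans hab'.reachable)
      · rw [hT', deleteEdges_adj, not_and_not_right] at hab'
        have := hab' hab
        rw [Set.mem_singleton_iff, Sym2.eq_iff] at this
        rcases this with ⟨-, rfl⟩ | ⟨-, rfl⟩
        · exact .inr .rfl
        · exact .inl .rfl
    let K : ι → SimpleGraph V := fun r =>
      { Adj := fun u v => G.Adj u v ∧ ∃ t, T'.Reachable r t ∧ u ∈ X t ∧ v ∈ X t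
        symm := ⟨fun _ _ ⟨h, t, ht, hu, hv⟩ => ⟨h.symm, t, ht, hv, hu⟩⟩
        loopless := ⟨fun _ h => h.1.ne rfl⟩ }
    have h₁ := (ih T' hlt (hT.anti hle) hX' t₀ (K t₀) fun u v h => h.2).of_adj (H := G) (by
      rintro u ⟨a, ha, hua⟩ v ⟨b, hb, hvb⟩ huv
      obtain ⟨t, ht, hut, hvt⟩ := hG u v huv
      rcases hsplit t ht with h | h
      · exact .inl ⟨huv, t, h, hut, hvt⟩
      · exact .inr ⟨(hcross u a t ha h hua hut).1, (hcross v b t hb h hvb hvt).1⟩)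
    have h₂ := (ih T' hlt (hT.anti hle) hX' s (K s) fun u v h => h.2).of_adj (H := G) (by
      rintro u ⟨a, ha, hua⟩ v ⟨b, hb, hvb⟩ huv
      obtain ⟨t, ht, hut, hvt⟩ := hG u v huv
      rcases hsplit t ht with h | h
      · exact .inr ⟨(hcross u t a h ha hut hua).2, (hcross v t b h hb hvt hvb).2⟩
      · exact .inl ⟨huv, t, h, hut, hvt⟩)
    have h₃ := h₁.join (h₂.move (hw t₀) ?_ ?_) ?_ ?_
    · convert h₃ using 1
      ext v
      constructor
      · rintro ⟨t, ht, hv⟩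
        rcases hsplit t ht with h | h
        · exact .inl ⟨t, h, hv⟩
        · exact .inr (.inl ⟨t, h, hv⟩)
      · rintro (⟨t, ht, hv⟩ | ⟨t, ht, hv⟩ | hv)
        · exact ⟨t, ht.mono hle, hv⟩
        · exact ⟨t, hs.reachable.trans (ht.mono hle), hv⟩
        · exact ⟨t₀, .rfl, hv⟩
    · rintro v ⟨⟨t, ht, hv⟩, hv'⟩
      exact (hcross v t₀ t .rfl ht hv' hv).2
    · rintro u ⟨a, ha, hua⟩ hu v hv hv' huv
      obtain ⟨t, ht, hut, hvt⟩ := hG u v huv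
      rcases hsplit t ht with h | h
      · exact hu (hcross u t a h ha hut hua).1
      · exact hv' ⟨t, h, hvt⟩
    · rintro v ⟨⟨a, ha, hva⟩, ⟨b, hb, hvb⟩ | hv⟩
      · exact (hcross v a b ha hb hva hvb).1
      · exact hv
    · rintro u ⟨a, ha, hua⟩ hu v (⟨b, hb, hvb⟩ | hv) hv' huv
      · obtain ⟨t, ht, hut, hvt⟩ := hG u v huv
        rcases hsplit t ht with h | h
        · exact hv' (hcross v t b h hb hvt hvb).1
        · exact hu (hcross u a t ha h hua hut).1
      · exact hv' hv
  · have hr : ∀ t, T.Reachable t₀ t → t = t₀ := fun t ht =>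
      ht.invariant (I := (· = t₀)) rfl fun a b _ ha hab => (hiso ⟨b, ha ▸ hab⟩).elim
    convert RootedDecomp.bag (G := G) (hw t₀) using 1
    ext v
    constructor
    · rintro ⟨t, ht, hv⟩
      exact hr t ht ▸ hv
    · exact fun hv => ⟨t₀, .rfl, hv⟩

end TreeDecomposition

section Contraction

theorem SimpleGraph.Reachable.exists_walk_forall_reachable {V : Type*} {G H : SimpleGraph V}
    {u v : V} (h : G.Reachable u v) (hle : G ≤ H) :
    ∃ q : H.Walk u v, ∀ r ∈ q.support, G.Reachable u r := by
  classical
  obtain ⟨p⟩ := h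
  exact ⟨p.mapLe hle, fun r hr => ⟨p.takeUntil r (by simpa using hr)⟩⟩

theorem SimpleGraph.Reachable.mem_of_restrictTo {V : Type*} {G : SimpleGraph V} {A : Set V}
    {u v : V} (h : (restrictTo G A).Reachable u v) : u ∈ A ↔ v ∈ A := by
  have key : ∀ {u v}, (restrictTo G A).Reachable u v → u ∈ A → v ∈ A := fun h hu =>
    h.invariant (I := (· ∈ A)) hu fun _ _ _ _ hab => hab.2.2
  exact ⟨key h, key h.symm⟩

variable {V : Type u} {G : SimpleGraph V} {S : Set V} {c₀ : V → ℕ}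

theorem MonoReach.reachable_monoGraph {c : V → ℕ} {a b : V} (h : MonoReach G S c a b) :
    (monoGraph G c).Reachable a b := by
  obtain ⟨p, hp⟩ := h
  have key : ∀ {x y : V} (p : G.Walk x y), (∀ v ∈ p.support, c v = c a) →
      (monoGraph G c).Reachable x y := by
    intro x y p
    induction p with
    | nil => exact fun _ => .rfl
    | @cons x y z h p ih =>
      intro hc
      have hxy : (monoGraph G c).Adj x y :=
        ⟨h, (hc x (by simp)).trans (hc y (by simp)).symm⟩
      exact hxy.reachable.trans (ih fun v hv => hc v (by simp [hv]))
  exact key p fun v hv => (hp v hv).2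

theorem color_eq_of_reachable_restrictTo {a b : V}
    (h : (restrictTo (monoGraph G c₀) S).Reachable a b) : c₀ a = c₀ b :=
  (h.mono (restrictTo_le S)).color_eq

theorem HasWeakDiamLE.edist_le {k : ℕ} (hk : HasWeakDiamLE G S c₀ k) {a b : V}
    (h : (restrictTo (monoGraph G c₀) S).Reachable a b) : G.edist a b ≤ k := by
  by_cases ha : a ∈ S
  · have hle : restrictTo (monoGraph G c₀) S ≤ G := (restrictTo_le S).trans (monoGraph_le c₀)
    obtain ⟨q, hq⟩ := h.exists_walk_forall_reachable hle
    rw [← (h.mono hle).coe_dist_eq_edist]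
    exact_mod_cast hk a b ⟨q, fun v hv =>
      ⟨(hq v hv).mem_of_restrictTo.1 ha, (color_eq_of_reachable_restrictTo (hq v hv)).symm⟩⟩
  · have : a = b := h.invariant (I := (a = ·)) rfl fun x y _ hx hxy => (ha (hx ▸ hxy.2.1)).elim
    simp [this]

/-- The quotient of `G` by the map `f`, realised on the image of `f`. -/
def imageGraph (G : SimpleGraph V) (f : V → V) : SimpleGraph V where
  Adj x y := x ≠ y ∧ ∃ u v, f u = x ∧ f v = y ∧ G.Adj u v
  symm := ⟨fun _ _ ⟨hne, u, v, hu, hv, h⟩ => ⟨hne.symm, v, u, hv, hu, h.symm⟩⟩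
  loopless := ⟨fun _ h => h.1 rfl⟩

/-- A tree-decomposition of `G` induces one of any graph obtained by contracting connected
subgraphs. -/
theorem IsTreeDecomp.rootedDecomp_imageGraph {ι : Type*} [Finite ι] [Finite V]
    {T : SimpleGraph ι} {X : ι → Set V} {w : ℕ} (h : IsTreeDecomp G T X)
    (hw : ∀ t, (X t).ncard ≤ w) {B : SimpleGraph V} (hB : B ≤ G) {f : V → V}
    (hf : ∀ u v, f u = f v → B.Reachable u v) (hf' : ∀ u v, B.Reachable u v → f u = f v) :
    ∃ W X₀, RootedDecomp w (imageGraph G f) W X₀ ∧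
      ∀ u v, (imageGraph G f).Adj u v → u ∈ W ∧ v ∈ W := by
  obtain ⟨hT, hcov, hedge, hconn⟩ := h
  obtain ⟨t₀⟩ := hT.connected.nonempty
  have hbase : ∀ x s t, x ∈ X s → x ∈ X t →
      (restrictTo T {r | f x ∈ f '' X r}).Reachable s t := by
    intro x s t hs ht
    have := (hconn x).preconnected ⟨s, hs⟩ ⟨t, ht⟩
    exact this.map (G' := restrictTo T {r | f x ∈ f '' X r})
      ⟨fun r => r.1, fun {a b} hab => ⟨hab, ⟨x, a.2, rfl⟩, ⟨x, b.2, rfl⟩⟩⟩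
  have hreach : ∀ x y s t, B.Reachable x y → x ∈ X s → y ∈ X t →
      (restrictTo T {r | f x ∈ f '' X r}).Reachable s t := by
    intro x y s t hxy hs ht
    refine hxy.invariant (I := fun y => ∀ t, y ∈ X t →
      (restrictTo T {r | f x ∈ f '' X r}).Reachable s t) (fun t ht => hbase x s t hs ht) ?_ t ht
    intro a b ha ih hab t ht
    obtain ⟨r, har, hbr⟩ := hedge (hB hab)
    have := hbase b r t hbr ht
    rw [← hf' x b (ha.trans hab.reachable)] at this
    exact (ih r har).trans this
  have hadj : ∀ u v, (imageGraph G f).Adj u v →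
      ∃ t, T.Reachable t₀ t ∧ u ∈ f '' X t ∧ v ∈ f '' X t := by
    rintro _ _ ⟨-, u, v, rfl, rfl, huv⟩
    obtain ⟨t, hut, hvt⟩ := hedge huv
    exact ⟨t, hT.connected.preconnected t₀ t, ⟨u, hut, rfl⟩, ⟨v, hvt, rfl⟩⟩
  refine ⟨_, _, RootedDecomp.of_isAcyclic (X := fun t => f '' X t)
    (fun t => (Set.ncard_image_le (Set.toFinite _)).trans (hw t)) hT.isAcyclic ?_ t₀
    (imageGraph G f) hadj, ?_⟩
  · rintro _ s t p hp ⟨x, hx, rfl⟩ ⟨y, hy, hxy⟩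
    obtain ⟨q, hq⟩ := (hreach x y s t (hf x y hxy.symm) hx hy).exists_walk_forall_reachable
      (restrictTo_le _)
    exact hT.isAcyclic.mem_support_of_walk p hp q (A := {r | f x ∈ f '' X r}) fun r hr =>
      (hq r hr).mem_of_restrictTo.1 ⟨x, hx, rfl⟩
  · intro u v huv
    obtain ⟨t, ht, hu, hv⟩ := hadj u v huv
    exact ⟨⟨t, ht, hu⟩, ⟨t, ht, hv⟩⟩

end Contraction

/-- **Theorem.** For all positive integers `w` and `k`, there exists a positive integer
`N` such that for every graph `G` of tree-width at most `w`, every 2-list-assignment `L`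
of `G`, and every pre-`L`-coloring `c₀` (with domain `S`) of `G` with weak diameter in
`G` at most `k`, `c₀` can be extended to an `L`-coloring of `G` with weak diameter in
`G` at most `N`. -/
theorem treewidth_precoloring_extension_weak_diameter (w k : ℕ) (hw : 0 < w) (hk : 0 < k) :
    ∃ N : ℕ, 0 < N ∧
      ∀ (V : Type u) [Fintype V] (G : SimpleGraph V),
        TreewidthLE G w →
        ∀ L : V → Finset ℕ,
          (∀ x, (L x).Nonempty) →
          (∀ x, (L x).card = 2) →
          ∀ (S : Set V) (c₀ : V → ℕ),
            (∀ x ∈ S, c₀ x ∈ L x) →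
            HasWeakDiamLE G S c₀ k →
            ∃ c : V → ℕ, (∀ x, c x ∈ L x) ∧ (∀ x ∈ S, c x = c₀ x) ∧
              HasWeakDiamLE G Set.univ c N := by
  classical
  obtain ⟨M, N, hN⟩ := exists_hasRootedColorings.{u} (w + 1)
  refine ⟨k + (2 * k + 1) * N + k, by omega, ?_⟩
  rintro V _ G ⟨ι, _, T, X, hTX, hX⟩ L _ hL S c₀ hc₀ hdiam
  obtain ⟨B, hB⟩ : ∃ B, B = restrictTo (monoGraph G c₀) S := ⟨_, rfl⟩
  have hBG : B ≤ G := hB ▸ (restrictTo_le S).trans (monoGraph_le c₀)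
  have hBS : ∀ {u v}, B.Reachable u v → (u ∈ S ↔ v ∈ S) := fun h => (hB ▸ h).mem_of_restrictTo
  have hBc : ∀ {u v}, B.Reachable u v → c₀ u = c₀ v := fun h =>
    color_eq_of_reachable_restrictTo (hB ▸ h)
  have hBk : ∀ {u v}, B.Reachable u v → G.edist u v ≤ k := fun h => hdiam.edist_le (hB ▸ h)
  obtain ⟨f, hf, hf'⟩ : ∃ f : V → V, (∀ v, B.Reachable v (f v)) ∧
      ∀ u v, B.Reachable u v → f u = f v :=
    ⟨fun v => (B.connectedComponentMk v).out,
      fun v => ConnectedComponent.exact (Quot.out_eq (B.connectedComponentMk v)).symm,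
      fun u v h => congrArg Quot.out (ConnectedComponent.sound h)⟩
  have hfS : ∀ v ∉ S, f v = v := fun v hv =>
    (hf v).invariant (I := (· = v)) rfl fun a b _ ha hab => by
      rw [hB] at hab
      exact (hv (ha ▸ hab.2.1)).elim
  obtain ⟨W, X₀, hd, hsupp⟩ := hTX.rootedDecomp_imageGraph hX hBG
    (fun u v h => ((hf u).trans (h ▸ .rfl)).trans (hf v).symm) hf'
  have hL' : ∀ v, ∃ a b, a ≠ b ∧ L v = {a, b} := fun v => Finset.card_eq_two.1 (hL v)
  choose p q hne hpq using hL'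
  obtain ⟨c, hc, -, -, hcN⟩ := hN V (imageGraph G f) W X₀ hd hsupp
    (fun v => if v ∈ S then c₀ v else p v) (fun v => if v ∈ S then c₀ v else q v)
    (fun v => if v ∈ S then c₀ v else p v) (fun _ => .inl rfl) (by
      rintro _ _ ⟨hxy, u, v, rfl, rfl, huv⟩ hu hv huv'
      have huS : f u ∈ S := by
        by_contra h
        simp only [h, if_false] at hu
        exact hne _ hu
      have hvS : f v ∈ S := by
        by_contra h
        simp only [h, if_false] at hv
        exact hne _ hv
      simp only [huS, hvS, if_true] at huv'
      refine hxy (hf' u v (Adj.reachable ?_))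
      rw [hB]
      exact ⟨⟨huv, (hBc (hf u)).trans (huv'.trans (hBc (hf v)).symm)⟩,
        (hBS (hf u)).2 huS, (hBS (hf v)).2 hvS⟩)
  have hcS : ∀ v ∈ S, c (f v) = c₀ v := by
    intro v hv
    have := hc (f v)
    rw [if_pos ((hBS (hf v)).1 hv), if_pos ((hBS (hf v)).1 hv), or_self] at this
    exact this.trans (hBc (hf v)).symm
  refine ⟨fun v => c (f v), fun v => ?_, hcS, ?_⟩
  · change c (f v) ∈ L v
    by_cases hv : v ∈ S
    · rw [hcS v hv]
      exact hc₀ v hv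
    · have := hc v
      rw [if_neg hv, if_neg hv] at this
      rw [hfS v hv, hpq v]
      simpa using this
  · intro a b hab
    have hab' := hab.reachable_monoGraph
    have hfab : (monoGraph (imageGraph G f) c).Reachable (f a) (f b) := by
      refine hab'.invariant (I := fun b => (monoGraph (imageGraph G f) c).Reachable (f a) (f b))
        .rfl fun x y _ hx hxy => ?_
      by_cases hxy' : f x = f y
      · exact hxy' ▸ hx
      · exact hx.trans (Adj.reachable ⟨⟨hxy', x, y, rfl, rfl, hxy.1⟩, hxy.2⟩)
    have hdist : G.edist (f a) (f b) ≤ ((2 * k + 1) * N : ℕ) := by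
      refine edist_le_mul_of_adj ?_ (hcN _ _ hfab)
      rintro _ _ ⟨-, x, y, rfl, rfl, hxy⟩
      have := edist_le_add (edist_le_add (hBk (hf x).symm)
        (by simpa using hxy.edist_le_one : G.edist x y ≤ (1 : ℕ))) (hBk (hf y))
      exact edist_le_of_le this (by omega)
    have := edist_le_add (edist_le_add (hBk (hf a)) hdist) (hBk (hf b).symm)
    rw [← (hab'.mono (monoGraph_le _)).coe_dist_eq_edist] at this
    exact_mod_cast this
end
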